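/- For each prime p, let B_{p,∞} be the quaternion algebra over ℚ ramified exactly at p and ∞, and let Λ(p) be a maximal ℤ-order in B_{p,∞}. Then the cancellation law for locally free right Λ(p)-ideals (i.e., J ⊕ Λ(p) ≅ J' ⊕ Λ(p) implies J ≅ J') holds if and only if p ∈ {2, 3, 5, 7, 13}. -/

import Mathlib

open scoped TensorProduct
open IsDedekindDomain

noncomputable section

/-- A field `K` is a *global field* if it is a number field (finite extension of `ℚ`) or a
global function field (finite separable extension of `𝔽_p(t)` for some prime `p` and some
element `t` transcendental over the prime field `𝔽_p`; `𝔽_p(t)` is realised as the subfield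
`Subfield.closure {t}` generated by `t`, and transcendence of `t` as infiniteness of this
subfield). -/
def IsGlobalField (K : Type*) [Field K] : Prop :=
  NumberField K ∨
    ∃ (p : ℕ) (t : K), p.Prime ∧ CharP K p ∧
      Infinite ↥(Subfield.closure ({t} : Set K)) ∧
      Module.Finite ↥(Subfield.closure ({t} : Set K)) K ∧
      Algebra.IsSeparable ↥(Subfield.closure ({t} : Set K)) K


/-- A `K`-algebra is *separable* if it remains semisimple after base change to an algebraic
closure of `K` (equivalently, it is semisimple with centre a product of finite separable
field extensions of `K`). -/
def IsSeparableAlgebra (K : Type*) [Field K] (A : Type*) [Ring A] [Algebra K A] : Prop :=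
  IsSemisimpleRing ((AlgebraicClosure K) ⊗[K] A)

variable (R : Type*) [CommRing R] [IsDedekindDomain R]
variable (K : Type*) [Field K] [Algebra R K] [IsFractionRing R K]
variable (A : Type*) [Ring A] [Algebra K A] [FiniteDimensional K A]
variable [Algebra R A] [IsScalarTower R K A]

/-- An `R`-order in the `K`-algebra `A`: an `R`-subring of `A` which is finitely generated
as an `R`-module and spans `A` over `K`. -/
def IsROrder (Λ : Subalgebra R A) : Prop :=
  Module.Finite R ↥Λ ∧ Submodule.span K (Λ : Set A) = ⊤

/-- The completion `A_v = K_v ⊗[K] A` of `A` at a finite place (height-one prime) `v` of `R`. -/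
def PlaceAlgebra (v : HeightOneSpectrum R) : Type _ := v.adicCompletion K ⊗[K] A

instance (v : HeightOneSpectrum R) : Ring (PlaceAlgebra R K A v) :=
  inferInstanceAs (Ring (v.adicCompletion K ⊗[K] A))

/-- The canonical identification of `K_v ⊗[K] A` with the completed algebra `A_v`. -/
def PlaceAlgebra.of (v : HeightOneSpectrum R) (z : v.adicCompletion K ⊗[K] A) :
    PlaceAlgebra R K A v := z

/-- The completed order `Λ_v = R_v ⊗[R] Λ`, realised as the subring of `A_v` generated by
the valuation integers `O_v` of `K_v` and by (the image of) `Λ`; this is exactly the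
`O_v`-span of the image of `Λ`. -/
def orderAt (Λ : Subalgebra R A) (v : HeightOneSpectrum R) : Subring (PlaceAlgebra R K A v) :=
  Subring.closure
    ((fun c : v.adicCompletion K => PlaceAlgebra.of R K A v (c ⊗ₜ[K] (1 : A))) ''
        (v.adicCompletionIntegers K : Set (v.adicCompletion K)) ∪
      (fun a : A => PlaceAlgebra.of R K A v ((1 : v.adicCompletion K) ⊗ₜ[K] a)) '' (Λ : Set A))

/-- The completed lattice `J_v = R_v ⊗[R] J ⊆ A_v`, the `O_v`-span of the image of `J`. -/
def latticeAt (J : Submodule R A) (v : HeightOneSpectrum R) :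
    AddSubgroup (PlaceAlgebra R K A v) :=
  AddSubgroup.closure
    {z | ∃ c ∈ (v.adicCompletionIntegers K : Set (v.adicCompletion K)),
      ∃ x ∈ J, z = PlaceAlgebra.of R K A v (c ⊗ₜ[K] x)}

/-- A *locally free (right) `Λ`-ideal* in `A`: a full `R`-lattice `J` in `A` (a finitely
generated `R`-submodule spanning `A` over `K`) which is a right `Λ`-module and whose
completion at every finite place `v` is a free `Λ_v`-module of rank one, i.e.
`J_v = u ⬝ Λ_v` for some unit `u` of `A_v`. -/
structure LocallyFreeIdeal (Λ : Subalgebra R A) where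
  carrier : Submodule R A
  fg : carrier.FG
  spans : Submodule.span K (carrier : Set A) = ⊤
  right_mul : ∀ x ∈ carrier, ∀ a ∈ Λ, x * a ∈ carrier
  locallyFree : ∀ v : HeightOneSpectrum R, ∃ u : (PlaceAlgebra R K A v)ˣ,
      (latticeAt R K A carrier v : Set (PlaceAlgebra R K A v)) =
        (fun y : PlaceAlgebra R K A v => u.val * y) ''
          (orderAt R K A Λ v : Set (PlaceAlgebra R K A v))

variable {R K A}

/-- A right `Λ`-module isomorphism between additive subgroups of `Fin m → A` which are stable
under the diagonal right multiplication by elements of `Λ`: an additive equivalence commuting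
with right multiplication by every element of `Λ`. -/
def RightLamIso (Λ : Subalgebra R A) {m : ℕ} (P Q : AddSubgroup (Fin m → A)) : Prop :=
  ∃ e : P ≃+ Q, ∀ (z : P) (a : A), a ∈ Λ →
    ∀ h : (fun i => z.val i * a) ∈ P,
      (e ⟨fun i => z.val i * a, h⟩).val = fun i => (e z).val i * a

/-- The external direct sum `M 0 ⊕ ⋯ ⊕ M (m-1)` of `R`-submodules of `A`, realised as an
additive subgroup of `Fin m → A`. -/
def sumLat {m : ℕ} (Ms : Fin m → Submodule R A) : AddSubgroup (Fin m → A) :=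
  AddSubgroup.pi Set.univ fun i => (Ms i).toAddSubgroup

/-- Isomorphism of locally free right `Λ`-ideals as right `Λ`-modules. -/
def IdealIso (Λ : Subalgebra R A) (I I' : LocallyFreeIdeal R K A Λ) : Prop :=
  RightLamIso Λ (sumLat ![I.carrier]) (sumLat ![I'.carrier])

/-- The lattice `J ⊕ Λ^r`, as an additive subgroup of `Fin (r+1) → A`. -/
def stdLat (Λ : Subalgebra R A) (J : Submodule R A) (r : ℕ) :
    AddSubgroup (Fin (r + 1) → A) :=
  sumLat (Fin.cons J fun _ => Subalgebra.toSubmodule Λ)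

/-- Two locally free right `Λ`-ideals `J`, `J'` are *stably isomorphic* if
`J ⊕ Λ^r ≅ J' ⊕ Λ^r` as right `Λ`-modules for some `r ≥ 0`. -/
def StablyIsomorphic (Λ : Subalgebra R A) (I I' : LocallyFreeIdeal R K A Λ) : Prop :=
  ∃ r : ℕ, RightLamIso Λ (stdLat Λ I.carrier r) (stdLat Λ I'.carrier r)

end

/-- A ring is a division ring: it is nontrivial and every non-zero element is invertible. -/
def IsDivisionRingCarrier (B : Type*) [Ring B] : Prop :=
  Nontrivial B ∧ ∀ x : B, x ≠ 0 → IsUnit x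

/-- `A` is (isomorphic to) the quaternion algebra `B_{p,∞}` over `ℚ`: a central simple
`ℚ`-algebra of dimension `4` whose set of ramified places of `ℚ` is exactly `{p, ∞}`,
i.e. it is a division algebra after base change to `ℝ` and to `ℚ_p`, and it is split
(not division) after base change to `ℚ_ℓ` for every prime `ℓ ≠ p`. -/
def IsQuaternionRamifiedExactlyAtPAndInfty (p : ℕ) (A : Type*) [Ring A] [Algebra ℚ A] :
    Prop :=
  Module.finrank ℚ A = 4 ∧ Algebra.IsCentral ℚ A ∧ IsSimpleRing A ∧
  IsDivisionRingCarrier (ℝ ⊗[ℚ] A) ∧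
  (∀ hp : p.Prime, haveI : Fact p.Prime := ⟨hp⟩;
    IsDivisionRingCarrier (ℚ_[p] ⊗[ℚ] A)) ∧
  (∀ (ℓ : ℕ) (hl : ℓ.Prime), ℓ ≠ p → haveI : Fact ℓ.Prime := ⟨hl⟩;
    ¬ IsDivisionRingCarrier (ℚ_[ℓ] ⊗[ℚ] A))

set_option linter.all false
namespace CQ

open Polynomial in
theorem exists_quad {A : Type*} [Ring A] [Algebra ℚ A] [FiniteDimensional ℚ A]
    (hR : IsDivisionRingCarrier (ℝ ⊗[ℚ] A)) (x : A) :
    ∃ t n : ℚ, x * x = t • x - n • (1 : A) := by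
  haveI : Nontrivial (ℝ ⊗[ℚ] A) := hR.1
  haveI : NoZeroDivisors (ℝ ⊗[ℚ] A) := ⟨by
    intro u v huv
    by_contra h
    push Not at h
    have := hR.2 u h.1
    exact h.2 (by simpa using (this.mul_right_eq_zero).1 huv)⟩
  haveI : IsDomain (ℝ ⊗[ℚ] A) := NoZeroDivisors.to_isDomain _
  set X : ℝ ⊗[ℚ] A := (1:ℝ) ⊗ₜ[ℚ] x with hX
  have hint : IsIntegral ℝ X := IsIntegral.of_finite ℝ X
  have hdeg := (minpoly.irreducible hint).degree_le_two
  have hq := eq_quadratic_of_degree_le_two hdeg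
  have hz := minpoly.aeval ℝ X
  rw [hq] at hz
  simp only [map_add, map_mul, aeval_C, aeval_X, map_pow] at hz
  by_contra hcon
  push Not at hcon
  have hli : LinearIndependent ℚ ![1, x, x * x] := by
    by_contra hd
    by_cases hx : ∃ r : ℚ, x = r • (1 : A)
    · obtain ⟨r, hr⟩ := hx
      refine hcon r 0 ?_
      rw [hr]; simp
    · push Not at hx
      rw [Fintype.linearIndependent_iff] at hd
      push Not at hd
      obtain ⟨g, hg, i, hi⟩ := hd
      simp [Fin.sum_univ_three] at hg
      by_cases h2 : g 2 = 0
      · by_cases h1 : g 1 = 0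
        · have h0 : g 0 ≠ 0 := by
            intro h0
            fin_cases i
            · exact hi h0
            · exact hi h1
            · exact hi h2
          rw [h1, h2] at hg
          simp at hg
          haveI : Nontrivial A := by
            by_contra hn
            rw [not_nontrivial_iff_subsingleton] at hn
            exact hx 0 (Subsingleton.elim _ _)
          rcases hg with h | h
          · exact h0 h
          · exact one_ne_zero h
        · refine hx (-(g 0 / g 1)) ?_
          rw [h2] at hg
          simp at hg
          have : x = (g 1)⁻¹ • (g 1 • x) := by rw [smul_smul, inv_mul_cancel₀ h1, one_smul]
          rw [this, eq_neg_of_add_eq_zero_right hg, smul_neg, smul_smul, neg_smul]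
          congr 2; field_simp
      · refine hcon (-(g 1 / g 2)) (g 0 / g 2) ?_
        have : x * x = (g 2)⁻¹ • (g 2 • (x * x)) := by
          rw [smul_smul, inv_mul_cancel₀ h2, one_smul]
        rw [this, eq_neg_of_add_eq_zero_right hg, smul_neg, smul_add, smul_smul, smul_smul]
        rw [div_eq_inv_mul, div_eq_inv_mul, neg_smul]
        abel
  have hli2 := Module.Flat.linearIndependent_one_tmul (S := ℝ) hli
  rw [Fintype.linearIndependent_iff] at hli2
  have hX2 : X ^ 2 = (1:ℝ) ⊗ₜ[ℚ] (x * x) := by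
    rw [hX, pow_two, Algebra.TensorProduct.tmul_mul_tmul, one_mul]
  have := hli2 ![(minpoly ℝ X).coeff 0, (minpoly ℝ X).coeff 1, (minpoly ℝ X).coeff 2] (by
    simp only [Fin.sum_univ_three]
    simp only [Matrix.cons_val_zero, Matrix.cons_val_one, Matrix.cons_val]
    rw [hX2] at hz
    rw [← hz, Algebra.algebraMap_eq_smul_one, Algebra.algebraMap_eq_smul_one,
      Algebra.algebraMap_eq_smul_one, Algebra.TensorProduct.one_def]
    simp only [smul_mul_assoc, Algebra.TensorProduct.tmul_mul_tmul, one_mul, hX]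
    abel)
  have h0 := this 0
  have h1 := this 1
  have h2 := this 2
  simp at h0 h1 h2
  apply minpoly.ne_zero hint
  rw [hq, h0, h1, h2]
  simp

open Quaternion in
/-- Quaternion data. -/
structure QD (A : Type*) [Ring A] [Algebra ℚ A] where
  a : ℚ
  b : ℚ
  ha : a < 0
  hb : b < 0
  e : A ≃ₐ[ℚ] ℍ[ℚ,a,0,b]

theorem sq_neg_aux {A : Type*} [Ring A] [Algebra ℚ A]
    (hR : IsDivisionRingCarrier (ℝ ⊗[ℚ] A)) (x : A) (a : ℚ) (hx : x * x = a • (1 : A))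
    (hxn : ∀ r : ℚ, x ≠ r • (1 : A)) : a < 0 := by
  by_contra h
  push Not at h
  have hli : LinearIndependent ℚ ![1, x] := by
    rw [LinearIndependent.pair_iff]
    intro s t hst
    have ht : t = 0 := by
      by_contra ht
      apply hxn (-(s / t))
      have : x = t⁻¹ • (t • x) := by rw [smul_smul, inv_mul_cancel₀ ht, one_smul]
      rw [this, eq_neg_of_add_eq_zero_right hst, smul_neg, smul_smul, neg_smul]
      congr 2; field_simp
    subst ht
    simp at hst
    refine ⟨?_, rfl⟩
    rcases hst with h | h
    · exact h
    · exfalso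
      apply hxn 0
      rw [← mul_one x, h]; simp
  have hli2 := Module.Flat.linearIndependent_one_tmul (S := ℝ) hli
  rw [Fintype.linearIndependent_iff] at hli2
  have key : ∀ r : ℝ, (1:ℝ) ⊗ₜ[ℚ] x + r ⊗ₜ[ℚ] (1 : A) ≠ 0 := by
    intro r hr
    have := hli2 ![r, 1] (by
      simp only [Fin.sum_univ_two]
      simp [← hr, TensorProduct.smul_tmul', add_comm]) 1
    simp at this
  have hmul : ((1:ℝ) ⊗ₜ[ℚ] x + (√(a:ℝ)) ⊗ₜ[ℚ] (1 : A)) * ((1:ℝ) ⊗ₜ[ℚ] x + (-√(a:ℝ)) ⊗ₜ[ℚ] (1 : A)) = 0 := by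
    simp only [add_mul, mul_add, Algebra.TensorProduct.tmul_mul_tmul, one_mul, mul_one, hx]
    have : √(a:ℝ) * -√(a:ℝ) = -(a:ℝ) := by
      rw [mul_neg, Real.mul_self_sqrt (by exact_mod_cast h)]
    rw [this, TensorProduct.tmul_smul, TensorProduct.smul_tmul', Rat.smul_def, mul_one,
      TensorProduct.neg_tmul, TensorProduct.neg_tmul]
    abel
  exact key _ ((hR.2 _ (key (√(a:ℝ)))).mul_right_eq_zero.1 hmul)

open Quaternion in
theorem exists_QD {A : Type*} [Ring A] [Algebra ℚ A] [FiniteDimensional ℚ A]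
    (hR : IsDivisionRingCarrier (ℝ ⊗[ℚ] A)) (h4 : Module.finrank ℚ A = 4)
    (hc : Algebra.IsCentral ℚ A) : Nonempty (QD A) := by
  have hinj : Function.Injective (fun x : A => (1:ℝ) ⊗ₜ[ℚ] x) :=
    Algebra.TensorProduct.includeRight_injective (R := ℚ) (A := ℝ) (B := A)
      (algebraMap ℚ ℝ).injective
  have hzd : ∀ x y : A, x * y = 0 → x ≠ 0 → y = 0 := by
    intro x y hxy hx
    have hx' : (1:ℝ) ⊗ₜ[ℚ] x ≠ 0 := fun h => hx (hinj (by simpa using h))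
    have := ((hR.2 _ hx').mul_right_eq_zero (b := (1:ℝ) ⊗ₜ[ℚ] y)).1 (by
      rw [Algebra.TensorProduct.tmul_mul_tmul, hxy]; simp)
    exact hinj (by simpa using this)
  have hx : ∃ x : A, ∀ r : ℚ, x ≠ r • (1:A) := by
    by_contra hcon
    push Not at hcon
    have : Module.finrank ℚ A ≤ 1 := finrank_le_one (1 : A) (fun w => by
      obtain ⟨r, hr⟩ := hcon w; exact ⟨r, hr.symm⟩)
    omega
  obtain ⟨x, hx⟩ := hx
  obtain ⟨t, n, htn⟩ := exists_quad hR x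
  set i : A := x - (t / 2) • (1 : A) with hi
  obtain ⟨a, hia⟩ : ∃ a : ℚ, i * i = a • (1 : A) := by
    refine ⟨t ^ 2 / 4 - n, ?_⟩
    rw [hi]
    simp only [sub_mul, mul_sub, smul_mul_assoc, mul_smul_comm, one_mul, mul_one, htn, smul_smul]
    module
  have hin : ∀ r : ℚ, i ≠ r • (1:A) := by
    intro r hr
    apply hx (r + t / 2)
    rw [add_smul, ← hr, hi]; abel
  have ha := sq_neg_aux hR i a hia hin
  have hy : ∃ y : A, i * y - y * i ≠ 0 := by
    by_contra hcon
    push Not at hcon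
    have : i ∈ Subalgebra.center ℚ A := by
      rw [Subalgebra.mem_center_iff]
      intro y
      exact (sub_eq_zero.1 (hcon y)).symm
    have := hc.out this
    rw [Algebra.mem_bot] at this
    obtain ⟨r, hr⟩ := this
    apply hin r
    rw [← hr, Algebra.algebraMap_eq_smul_one]
  obtain ⟨y, hy⟩ := hy
  set j : A := i * y - y * i with hj
  have hij : j * i = - (i * j) := by
    have e1 : j * i = i * y * i - y * (i * i) := by
      rw [hj]; clear_value i; noncomm_ring
    have e2 : i * j = (i * i) * y - i * y * i := by
      rw [hj]; clear_value i; noncomm_ring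
    rw [e1, e2, hia]
    simp
  have hi0 : i ≠ 0 := fun h => hin 0 (by simpa using h)
  obtain ⟨s, m, hsm⟩ := exists_quad hR j
  have hs : s • j = 0 := by
    have h1 : i * (j * j) = (j * j) * i := by
      rw [mul_assoc j j i, hij, mul_neg, ← mul_assoc j i j, hij, neg_mul, neg_neg, mul_assoc]
    rw [hsm] at h1
    simp only [mul_sub, sub_mul, mul_smul_comm, smul_mul_assoc, hij, mul_one, one_mul] at h1
    have h2 : (2 * s) • (i * j) = 0 := by
      have : (2 * s) • (i * j) = (s • (i * j) - m • i) - (s • -(i * j) - m • i) := by module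
      rw [this, h1, sub_self]
    have h3 : i * (s • j) = 0 := by
      rw [mul_smul_comm]
      have : s • (i * j) = (1/2 : ℚ) • ((2 * s) • (i * j)) := by module
      rw [this, h2, smul_zero]
    exact hzd _ _ h3 hi0
  have hjb : j * j = (-m) • (1 : A) := by rw [hsm, hs]; module
  have hjn : ∀ r : ℚ, j ≠ r • (1:A) := by
    intro r hr
    have h1 : (2 : ℚ) • (i * j) = 0 := by
      have : i * j = j * i := by rw [hr]; simp
      have h2 : i * j = - (i * j) := by rw [← hij, ← this]
      rw [two_smul]; nth_rewrite 1 [h2]; simp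
    have h3 : i * ((2:ℚ) • j) = 0 := by rw [mul_smul_comm, h1]
    have := hzd _ _ h3 hi0
    exact hy (by simpa using this)
  have hb := sq_neg_aux hR j (-m) hjb hjn
  let B : QuaternionAlgebra.Basis A a 0 (-m) :=
    { i := i, j := j, k := i * j
      i_mul_i := by rw [hia]; simp
      j_mul_j := hjb
      i_mul_j := rfl
      j_mul_i := by rw [hij]; simp }
  have hinj2 : Function.Injective B.liftHom := by
    rw [injective_iff_map_eq_zero]
    intro q hq
    have h1 : B.liftHom (star q * q) = 0 := by rw [map_mul, hq, mul_zero]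
    have h2 : ∀ N : ℚ, N = q.re^2 - a * q.imI^2 + m * q.imJ^2 - a * m * q.imK^2 →
        star q * q = algebraMap ℚ _ N := by
      intro N hN
      ext <;> simp <;> linarith
    rw [h2 _ rfl, AlgHom.commutes] at h1
    haveI : Nontrivial A := ⟨i, 0, hi0⟩
    have h3 := (map_eq_zero (algebraMap ℚ A)).1 h1
    have ham : 0 < -(a * m) := by nlinarith
    have e1 := mul_nonneg (neg_nonneg.2 ha.le) (sq_nonneg q.imI)
    have e2 := mul_nonneg (show 0 ≤ m by linarith) (sq_nonneg q.imJ)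
    have e3 := mul_nonneg ham.le (sq_nonneg q.imK)
    have e0 := sq_nonneg q.re
    have f0 : q.re ^ 2 = 0 := by linarith
    have f1 : -a * q.imI ^ 2 = 0 := by linarith
    have f2 : m * q.imJ ^ 2 = 0 := by linarith
    have f3 : -(a*m) * q.imK ^ 2 = 0 := by linarith
    have g0 : q.re = 0 := by simpa using f0
    have g1 : q.imI = 0 := by simpa [ha.ne] using f1
    have g2 : q.imJ = 0 := by
      rcases mul_eq_zero.1 f2 with h | h
      · linarith
      · simpa using h
    have g3 : q.imK = 0 := by
      rcases mul_eq_zero.1 f3 with h | h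
      · linarith
      · simpa using h
    ext <;> assumption
  have hsurj : Function.Surjective B.liftHom := by
    have := (LinearMap.injective_iff_surjective_of_finrank_eq_finrank
      (f := B.liftHom.toLinearMap) (by rw [h4, QuaternionAlgebra.finrank_eq_four])).1 hinj2
    exact this
  exact ⟨⟨a, -m, ha, hb, (AlgEquiv.ofBijective B.liftHom ⟨hinj2, hsurj⟩).symm⟩⟩

end CQ

namespace CQ

def IsZ (q : ℚ) : Prop := ∃ m : ℤ, (m : ℚ) = q

theorem IsZ.add {x y : ℚ} (hx : IsZ x) (hy : IsZ y) : IsZ (x + y) := by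
  obtain ⟨m, rfl⟩ := hx; obtain ⟨n, rfl⟩ := hy; exact ⟨m + n, by push_cast; rfl⟩
theorem IsZ.sub {x y : ℚ} (hx : IsZ x) (hy : IsZ y) : IsZ (x - y) := by
  obtain ⟨m, rfl⟩ := hx; obtain ⟨n, rfl⟩ := hy; exact ⟨m - n, by push_cast; rfl⟩
theorem IsZ.mul {x y : ℚ} (hx : IsZ x) (hy : IsZ y) : IsZ (x * y) := by
  obtain ⟨m, rfl⟩ := hx; obtain ⟨n, rfl⟩ := hy; exact ⟨m * n, by push_cast; rfl⟩
theorem IsZ.neg {x : ℚ} (hx : IsZ x) : IsZ (-x) := by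
  obtain ⟨m, rfl⟩ := hx; exact ⟨-m, by push_cast; rfl⟩
theorem IsZ.int (m : ℤ) : IsZ (m : ℚ) := ⟨m, rfl⟩
theorem IsZ.zero : IsZ 0 := ⟨0, by simp⟩

section
variable {A : Type*} [Ring A] [Algebra ℚ A] (Q : QD A)

def QD.nm (x : A) : ℚ := (Q.e x).re ^ 2 - Q.a * (Q.e x).imI ^ 2 - Q.b * (Q.e x).imJ ^ 2
  + Q.a * Q.b * (Q.e x).imK ^ 2

def QD.tr : A →ₗ[ℚ] ℚ where
  toFun x := 2 * (Q.e x).re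
  map_add' x y := by simp; ring
  map_smul' c x := by simp; ring

def QD.cj (x : A) : A := Q.tr x • (1 : A) - x

theorem QD.tr_def (x : A) : Q.tr x = 2 * (Q.e x).re := rfl

theorem QD.e_cj (x : A) : Q.e (Q.cj x) = star (Q.e x) := by
  unfold QD.cj
  rw [map_sub, map_smul, map_one]
  ext <;> simp [QD.tr_def]
  ring

theorem QD.alg_eq (N : ℚ) : Q.e (N • (1:A)) = algebraMap ℚ _ N := by
  rw [map_smul, map_one, Algebra.algebraMap_eq_smul_one]

theorem QD.mul_cj (x : A) : x * Q.cj x = Q.nm x • (1 : A) := by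
  apply Q.e.injective
  rw [map_mul, Q.e_cj, Q.alg_eq]
  have : ∀ N : ℚ, N = Q.nm x → (Q.e x) * star (Q.e x) = algebraMap ℚ _ N := by
    intro N hN
    unfold QD.nm at hN
    ext <;> simp <;> linarith
  exact this _ rfl

theorem QD.cj_mul_self (x : A) : Q.cj x * x = Q.nm x • (1 : A) := by
  rw [← Q.mul_cj]; unfold QD.cj
  simp [sub_mul, mul_sub]

theorem QD.tr_one : Q.tr 1 = 2 := by rw [QD.tr_def, map_one]; simp

theorem QD.tr_smul_one (c : ℚ) : Q.tr (c • (1:A)) = 2 * c := by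
  rw [map_smul, Q.tr_one, smul_eq_mul]; ring

theorem QD.cj_add (x y : A) : Q.cj (x + y) = Q.cj x + Q.cj y := by
  unfold QD.cj; rw [map_add]; module
theorem QD.cj_sub (x y : A) : Q.cj (x - y) = Q.cj x - Q.cj y := by
  unfold QD.cj; rw [map_sub]; module
theorem QD.cj_smul (c : ℚ) (y : A) : Q.cj (c • y) = c • Q.cj y := by
  unfold QD.cj; rw [map_smul, smul_eq_mul]; module
theorem QD.cj_one : Q.cj 1 = 1 := by
  unfold QD.cj; rw [Q.tr_one]; module
theorem QD.cj_cj (x : A) : Q.cj (Q.cj x) = x := by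
  apply Q.e.injective; rw [Q.e_cj, Q.e_cj, star_star]
theorem QD.cj_mul (x y : A) : Q.cj (x * y) = Q.cj y * Q.cj x := by
  apply Q.e.injective
  rw [Q.e_cj, map_mul, map_mul, Q.e_cj, Q.e_cj, star_mul]
theorem QD.tr_cj (x : A) : Q.tr (Q.cj x) = Q.tr x := by
  unfold QD.cj; rw [map_sub, Q.tr_smul_one]; ring
theorem QD.tr_comm (x y : A) : Q.tr (x * y) = Q.tr (y * x) := by
  rw [QD.tr_def, QD.tr_def, map_mul, map_mul]
  simp only [QuaternionAlgebra.re_mul]; ring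

theorem QD.nm_smul (c : ℚ) (x : A) : Q.nm (c • x) = c ^ 2 * Q.nm x := by
  unfold QD.nm; rw [map_smul]; simp; ring
theorem QD.nm_one : Q.nm (1:A) = 1 := by
  unfold QD.nm; rw [map_one]; simp
theorem QD.nm_zero : Q.nm (0:A) = 0 := by
  unfold QD.nm; rw [map_zero]; simp
theorem QD.nm_neg (x : A) : Q.nm (-x) = Q.nm x := by
  unfold QD.nm; rw [map_neg]; simp
theorem QD.nm_mul (x y : A) : Q.nm (x * y) = Q.nm x * Q.nm y := by
  unfold QD.nm; rw [map_mul]; simp; ring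
theorem QD.nm_cj (x : A) : Q.nm (Q.cj x) = Q.nm x := by
  unfold QD.nm; rw [Q.e_cj]; simp
theorem QD.tr_mul_cj (x : A) : Q.tr (x * Q.cj x) = 2 * Q.nm x := by
  rw [Q.mul_cj, Q.tr_smul_one]
theorem QD.nm_add (x y : A) : Q.nm (x + y) = Q.nm x + Q.nm y + Q.tr (Q.cj x * y) := by
  have := Q.tr_mul_cj (x + y)
  rw [Q.cj_add, add_mul, mul_add, mul_add, map_add, map_add, map_add, Q.tr_mul_cj, Q.tr_mul_cj] at this
  have h2 : Q.tr (y * Q.cj x) = Q.tr (Q.cj x * y) := Q.tr_comm _ _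
  have h3 : Q.tr (x * Q.cj y) = Q.tr (Q.cj x * y) := by
    rw [← Q.tr_cj (x * Q.cj y), Q.cj_mul, Q.cj_cj, h2]
  rw [h2, h3] at this
  linarith

theorem QD.nm_nonneg (x : A) : 0 ≤ Q.nm x := by
  unfold QD.nm
  have := Q.ha
  have := Q.hb
  have e1 := mul_nonneg (neg_nonneg.2 Q.ha.le) (sq_nonneg (Q.e x).imI)
  have e2 := mul_nonneg (neg_nonneg.2 Q.hb.le) (sq_nonneg (Q.e x).imJ)
  have e3 := mul_nonneg (mul_pos_of_neg_of_neg Q.ha Q.hb).le (sq_nonneg (Q.e x).imK)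
  have e0 := sq_nonneg (Q.e x).re
  linarith

theorem QD.nm_eq_zero {x : A} (h : Q.nm x = 0) : x = 0 := by
  unfold QD.nm at h
  have e1 := mul_nonneg (neg_nonneg.2 Q.ha.le) (sq_nonneg (Q.e x).imI)
  have e2 := mul_nonneg (neg_nonneg.2 Q.hb.le) (sq_nonneg (Q.e x).imJ)
  have hab := (mul_pos_of_neg_of_neg Q.ha Q.hb)
  have e3 := mul_nonneg hab.le (sq_nonneg (Q.e x).imK)
  have e0 := sq_nonneg (Q.e x).re
  have f0 : (Q.e x).re ^ 2 = 0 := by linarith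
  have f1 : -Q.a * (Q.e x).imI ^ 2 = 0 := by linarith
  have f2 : -Q.b * (Q.e x).imJ ^ 2 = 0 := by linarith
  have f3 : (Q.a*Q.b) * (Q.e x).imK ^ 2 = 0 := by linarith
  apply Q.e.injective
  rw [map_zero]
  have g0 : (Q.e x).re = 0 := by simpa using f0
  have g1 : (Q.e x).imI = 0 := by simpa [Q.ha.ne] using f1
  have g2 : (Q.e x).imJ = 0 := by simpa [Q.hb.ne] using f2
  have g3 : (Q.e x).imK = 0 := by simpa [Q.ha.ne, Q.hb.ne] using f3
  ext <;> simpa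

theorem QD.nm_pos {x : A} (h : x ≠ 0) : 0 < Q.nm x :=
  lt_of_le_of_ne (Q.nm_nonneg x) (fun h' => h (Q.nm_eq_zero h'.symm))

theorem QD.nontriv (Q : QD A) : Nontrivial A := ⟨1, 0, fun h => by
  have := Q.nm_one; rw [h, Q.nm_zero] at this; norm_num at this⟩

theorem QD.sq (x : A) : x * x = Q.tr x • x - Q.nm x • (1 : A) := by
  have := Q.mul_cj x
  unfold QD.cj at this
  rw [mul_sub, mul_smul_comm, mul_one] at this
  rw [← this]; abel

theorem QD.tr_nd {x : A} (h : ∀ y, Q.tr (x * y) = 0) : x = 0 := by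
  apply Q.nm_eq_zero
  have := Q.tr_mul_cj x
  rw [h] at this; linarith

def QD.iv (x : A) : A := (Q.nm x)⁻¹ • Q.cj x
theorem QD.mul_iv {x : A} (h : x ≠ 0) : x * Q.iv x = 1 := by
  unfold QD.iv; rw [mul_smul_comm, Q.mul_cj, smul_smul, inv_mul_cancel₀ (Q.nm_pos h).ne', one_smul]
theorem QD.iv_mul {x : A} (h : x ≠ 0) : Q.iv x * x = 1 := by
  unfold QD.iv; rw [smul_mul_assoc, Q.cj_mul_self, smul_smul, inv_mul_cancel₀ (Q.nm_pos h).ne', one_smul]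
theorem QD.nm_iv (x : A) : Q.nm (Q.iv x) = (Q.nm x)⁻¹ := by
  unfold QD.iv; rw [Q.nm_smul, Q.nm_cj]
  by_cases h : Q.nm x = 0
  · simp [h]
  · field_simp

end

/-- working context -/
structure Ctx (p : ℕ) (A : Type*) [Ring A] [Algebra ℚ A] extends QD A where
  hp : p.Prime
  hdiv : haveI : Fact p.Prime := ⟨hp⟩; IsDivisionRingCarrier (ℚ_[p] ⊗[ℚ] A)
  hspl : ∀ (ℓ : ℕ) (hl : ℓ.Prime), ℓ ≠ p → haveI : Fact ℓ.Prime := ⟨hl⟩;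
    ¬ IsDivisionRingCarrier (ℚ_[ℓ] ⊗[ℚ] A)
  Λ : Subring A
  fg : Λ.toAddSubgroup.FG
  span : Submodule.span ℚ (Λ : Set A) = ⊤
  hmax : ∀ Λ' : Subring A, Λ'.toAddSubgroup.FG → Λ ≤ Λ' → Λ' = Λ

section
variable {p : ℕ} {A : Type*} [Ring A] [Algebra ℚ A] (C : Ctx p A)

theorem Ctx.exists_gens : ∃ S : Finset A, (∀ s ∈ S, s ∈ C.Λ) ∧
    AddSubgroup.closure (S : Set A) = C.Λ.toAddSubgroup ∧
    Submodule.span ℚ (S : Set A) = ⊤ := by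
  obtain ⟨S, hS⟩ := C.fg
  refine ⟨S, ?_, hS, ?_⟩
  · intro s hs
    have : s ∈ AddSubgroup.closure (S : Set A) := AddSubgroup.subset_closure hs
    rw [hS] at this; exact this
  · rw [← top_le_iff, ← C.span, Submodule.span_le]
    intro x hx
    have hx' : x ∈ C.Λ.toAddSubgroup := hx
    rw [← hS] at hx'
    have : AddSubgroup.closure (S : Set A) ≤ (Submodule.span ℚ (S : Set A)).toAddSubgroup := by
      rw [AddSubgroup.closure_le]; exact Submodule.subset_span
    exact this hx'

theorem Ctx.ord_fg (Λ' : Subring A) (h : ∀ x ∈ Λ', ∀ y ∈ C.Λ, IsZ (C.tr (x * y))) :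
    Λ'.toAddSubgroup.FG := by
  obtain ⟨S, hSΛ, -, hS⟩ := C.exists_gens
  choose! F hF using h
  let f : Λ'.toAddSubgroup →+ (S → ℤ) :=
    { toFun := fun x s => F x.1 s.1
      map_zero' := by
        funext s
        have := hF (0:A) Λ'.zero_mem s.1 (hSΛ _ s.2)
        simpa using this
      map_add' := by
        intro x y
        funext s
        have h1 := hF x.1 x.2 s.1 (hSΛ _ s.2)
        have h2 := hF y.1 y.2 s.1 (hSΛ _ s.2)
        have h3 := hF (x.1+y.1) (Λ'.add_mem x.2 y.2) s.1 (hSΛ _ s.2)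
        rw [add_mul, map_add, ← h1, ← h2] at h3
        simp only [Pi.add_apply]
        exact_mod_cast h3 }
  have hinj : Function.Injective f := by
    rw [injective_iff_map_eq_zero]
    intro x hx
    apply Subtype.ext
    apply C.tr_nd
    have hle : Submodule.span ℚ (S : Set A) ≤ LinearMap.ker (C.tr ∘ₗ LinearMap.mulLeft ℚ x.1) := by
      rw [Submodule.span_le]
      intro s hs
      have h1 := hF x.1 x.2 s (hSΛ _ hs)
      have h2 := congrFun hx ⟨s, hs⟩
      simp only [f, AddMonoidHom.coe_mk, ZeroHom.coe_mk, Pi.zero_apply] at h2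
      simp only [SetLike.mem_coe, LinearMap.mem_ker, LinearMap.comp_apply, LinearMap.mulLeft_apply]
      rw [← h1, h2]; simp
    intro y
    have : y ∈ LinearMap.ker (C.tr ∘ₗ LinearMap.mulLeft ℚ x.1) := hle (by rw [hS]; trivial)
    simpa using this
  have := Module.Finite.of_injective (f.toIntLinearMap) hinj
  rw [← AddGroup.fg_iff_addSubgroup_fg]
  exact Module.Finite.iff_addGroup_fg.1 this

theorem Ctx.ord (Λ' : Subring A) (h : ∀ x ∈ Λ', ∀ y ∈ C.Λ, IsZ (C.tr (x * y)))
    (hle : C.Λ ≤ Λ') : Λ' = C.Λ := C.hmax Λ' (C.ord_fg Λ' h) hle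

open Polynomial in
theorem Ctx.F1 {x : A} (hx : x ∈ C.Λ) : IsZ (C.tr x) ∧ IsZ (C.nm x) := by
  haveI := C.nontriv
  haveI : Module.Finite ℤ C.Λ.toAddSubgroup :=
    Module.Finite.iff_addGroup_fg.2 (AddGroup.fg_iff_addSubgroup_fg _ |>.2 C.fg)
  haveI : Module.Finite ℤ C.Λ := this
  obtain ⟨P, hPm, hP⟩ := IsIntegral.of_finite ℤ (⟨x, hx⟩ : C.Λ)
  have hP' : aeval x (P.map (Int.castRingHom ℚ)) = 0 := by
    have := congrArg (C.Λ.subtype) hP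
    rw [Polynomial.hom_eval₂, map_zero] at this
    rw [aeval_def, eval₂_map]
    rw [← this]
    congr 1
    exact RingHom.ext_int _ _
  have hint : IsIntegral ℚ x := ⟨_, hPm.map _, hP'⟩
  have hdvd := minpoly.dvd ℚ x hP'
  obtain ⟨G, hG⟩ := IsIntegrallyClosed.eq_map_mul_C_of_dvd (R := ℤ) ℚ hPm hdvd
  rw [(minpoly.monic hint).leadingCoeff, C_1, mul_one] at hG
  set f : ℚ[X] := X ^ 2 - Polynomial.C (C.tr x) * X + Polynomial.C (C.nm x) with hf
  have hfm : f.Monic := by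
    rw [hf]; monicity!
  have hfd : f.natDegree = 2 := by rw [hf]; compute_degree!
  have hfx : aeval x f = 0 := by
    rw [hf]
    simp only [map_add, map_sub, map_mul, map_pow, aeval_X, aeval_C]
    rw [Algebra.algebraMap_eq_smul_one, Algebra.algebraMap_eq_smul_one, pow_two, C.sq x]
    simp
  have hd2 := minpoly.dvd ℚ x hfx
  have hle := natDegree_le_of_dvd hd2 hfm.ne_zero
  have hpos := minpoly.natDegree_pos hint
  rw [hfd] at hle
  by_cases h2 : (minpoly ℚ x).natDegree = 2
  · have := eq_of_monic_of_dvd_of_natDegree_le (minpoly.monic hint) hfm hd2 (by rw [hfd, h2])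
    rw [← this] at hG
    constructor
    · have h := congrArg (fun q => coeff q 1) hG
      simp [hf, coeff_X, coeff_one] at h
      exact ⟨- G.coeff 1, by push_cast; rw [h]; ring⟩
    · have h := congrArg (fun q => coeff q 0) hG
      simp [hf] at h
      exact ⟨G.coeff 0, h⟩
  · have h1 : (minpoly ℚ x).natDegree = 1 := by omega
    have hz := minpoly.aeval ℚ x
    have hX : minpoly ℚ x = X + Polynomial.C ((minpoly ℚ x).coeff 0) :=
      (minpoly.monic hint).eq_X_add_C h1
    have hc : (minpoly ℚ x).coeff 0 = (G.coeff 0 : ℚ) := by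
      rw [← hG]; simp
    rw [hX, hc] at hz
    simp only [map_add, aeval_X, aeval_C] at hz
    have hx1 : x = (-(G.coeff 0 : ℚ)) • (1 : A) := by
      rw [Algebra.algebraMap_eq_smul_one] at hz
      rw [neg_smul]; exact eq_neg_of_add_eq_zero_left hz
    rw [hx1]
    constructor
    · rw [C.tr_smul_one]; exact ⟨-2 * G.coeff 0, by push_cast; ring⟩
    · rw [C.nm_smul, C.nm_one]; exact ⟨(G.coeff 0)^2, by push_cast; ring⟩

end
end CQ

namespace CQ

section
variable {p : ℕ} [Fact p.Prime]

def PI (p : ℕ) [Fact p.Prime] (q : ℚ) : Prop := ‖(q : ℚ_[p])‖ ≤ 1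

theorem PI.of_int (m : ℤ) : PI p (m : ℚ) := by
  unfold PI; rw [Rat.cast_intCast]; exact Padic.norm_int_le_one m
theorem IsZ.pi {q : ℚ} (h : IsZ q) : PI p q := by
  obtain ⟨m, rfl⟩ := h; exact PI.of_int m
theorem PI.mul {x y : ℚ} (hx : PI p x) (hy : PI p y) : PI p (x * y) := by
  unfold PI at *; rw [Rat.cast_mul, norm_mul]; exact mul_le_one₀ hx (norm_nonneg _) hy
theorem PI.add {x y : ℚ} (hx : PI p x) (hy : PI p y) : PI p (x + y) := by
  unfold PI at *; rw [Rat.cast_add]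
  exact (Padic.nonarchimedean _ _).trans (max_le hx hy)
theorem PI.neg {x : ℚ} (hx : PI p x) : PI p (-x) := by
  unfold PI at *; rw [Rat.cast_neg, norm_neg]; exact hx
theorem PI.of_sq {x : ℚ} (hx : PI p (x * x)) : PI p x := by
  unfold PI at *
  rw [Rat.cast_mul, norm_mul] at hx
  by_contra h
  push Not at h
  nlinarith

theorem isZ_step {q : ℚ} (h : PI p q) (h2 : IsZ (p * q)) : IsZ q := by
  obtain ⟨m, hm⟩ := h2
  have hp0 : (p : ℚ) ≠ 0 := by exact_mod_cast (Fact.out : p.Prime).ne_zero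
  have hd : (p : ℤ) ∣ m := by
    rw [← Padic.norm_intCast_lt_one_iff (p := p)]
    have : ((m : ℚ) : ℚ_[p]) = ((p * q : ℚ) : ℚ_[p]) := by rw [hm]
    rw [Rat.cast_intCast, Rat.cast_mul, Rat.cast_natCast] at this
    rw [this, norm_mul]
    have h1 : ‖(p : ℚ_[p])‖ < 1 := Padic.norm_p_lt_one
    unfold PI at h
    nlinarith [norm_nonneg (p : ℚ_[p]), norm_nonneg (q : ℚ_[p])]
  obtain ⟨n, rfl⟩ := hd
  refine ⟨n, ?_⟩
  push_cast at hm
  exact mul_left_cancel₀ hp0 hm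

theorem isZ_of_pow {q : ℚ} (h : PI p q) (k : ℕ) (h2 : IsZ (p ^ k * q)) : IsZ q := by
  induction k with
  | zero => simpa using h2
  | succ k ih =>
    apply ih
    apply isZ_step (p := p)
    · apply PI.mul _ h
      have := PI.of_int (p := p) ((p:ℤ)^k); push_cast at this; exact this
    · rw [← mul_assoc, ← pow_succ']; exact h2

open Polynomial in
theorem hensel_quad (t n : ℚ_[p]) (a : ℤ_[p]) (ht : ‖t‖ ≤ 1) (hn : ‖n‖ ≤ 1)
    (h0 : ‖(a:ℚ_[p])^2 - t * a + n‖ < 1) (h1 : ‖2 * (a:ℚ_[p]) - t‖ = 1) :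
    ∃ z : ℚ_[p], z ^ 2 - t * z + n = 0 := by
  let T : ℤ_[p] := ⟨t, ht⟩
  let N : ℤ_[p] := ⟨n, hn⟩
  have hF : ∀ z : ℤ_[p], (X ^ 2 - C T * X + C N : ℤ_[p][X]).aeval z = z ^ 2 - T * z + N := by
    intro z; simp
  have hF' : (derivative (X ^ 2 - C T * X + C N : ℤ_[p][X])).aeval a = 2 * a - T := by
    simp [derivative_pow]; 
  obtain ⟨z, hz, -⟩ := hensels_lemma (F := (X ^ 2 - C T * X + C N : ℤ_[p][X])) (a := a) (by
    rw [hF, hF']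
    have e1 : ‖a ^ 2 - T * a + N‖ = ‖(a:ℚ_[p])^2 - t * a + n‖ := by
      rw [← PadicInt.padic_norm_e_of_padicInt]; push_cast; rfl
    have e2 : ‖2 * a - T‖ = ‖2 * (a:ℚ_[p]) - t‖ := by
      rw [← PadicInt.padic_norm_e_of_padicInt]; push_cast; rfl
    rw [e1, e2, h1]; simpa using h0)
  rw [hF] at hz
  refine ⟨z, ?_⟩
  have := congrArg (fun w : ℤ_[p] => (w : ℚ_[p])) hz
  push_cast at this
  exact this

variable {A : Type*} [Ring A] [Algebra ℚ A] (C : Ctx p A)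

theorem lin_indep_of {A : Type*} [Ring A] [Algebra ℚ A] [Nontrivial A] {x : A}
    (hxn : ∀ r : ℚ, x ≠ r • (1 : A)) :
    LinearIndependent ℚ ![1, x] := by
  rw [LinearIndependent.pair_iff]
  intro s t hst
  have ht : t = 0 := by
    by_contra ht
    apply hxn (-(s / t))
    have : x = t⁻¹ • (t • x) := by rw [smul_smul, inv_mul_cancel₀ ht, one_smul]
    rw [this, eq_neg_of_add_eq_zero_right hst, smul_neg, smul_smul, neg_smul]
    congr 2; field_simp
  subst ht
  simp at hst
  exact ⟨hst, rfl⟩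

theorem Ctx.no_root {x : A} (hx : ∀ c : ℚ, x ≠ c • (1 : A)) (r : ℚ_[p]) :
    r ^ 2 - (C.tr x : ℚ_[p]) * r + (C.nm x : ℚ_[p]) ≠ 0 := by
  intro h
  haveI := C.nontriv
  have hli := Module.Flat.linearIndependent_one_tmul (S := ℚ_[p]) (lin_indep_of hx)
  rw [Fintype.linearIndependent_iff] at hli
  have key : ∀ r : ℚ_[p], (1:ℚ_[p]) ⊗ₜ[ℚ] x + r ⊗ₜ[ℚ] (1 : A) ≠ 0 := by
    intro r hr
    have := hli ![r, 1] (by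
      simp only [Fin.sum_univ_two]
      simp [← hr, TensorProduct.smul_tmul', add_comm]) 1
    simp at this
  have hmul : ((1:ℚ_[p]) ⊗ₜ[ℚ] x + (-r) ⊗ₜ[ℚ] (1 : A)) *
      ((1:ℚ_[p]) ⊗ₜ[ℚ] x + (r - (C.tr x : ℚ_[p])) ⊗ₜ[ℚ] (1 : A)) = 0 := by
    simp only [add_mul, mul_add, Algebra.TensorProduct.tmul_mul_tmul, one_mul, mul_one, C.sq x]
    have e : -r * (r - (C.tr x : ℚ_[p])) = (C.nm x : ℚ_[p]) := by linear_combination (-1) * h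
    rw [e, TensorProduct.tmul_sub, TensorProduct.tmul_smul, TensorProduct.tmul_smul,
      TensorProduct.smul_tmul', TensorProduct.smul_tmul', Rat.smul_def, Rat.smul_def, mul_one, mul_one,
      TensorProduct.neg_tmul, TensorProduct.sub_tmul]
    abel
  exact key _ ((C.hdiv.2 _ (key (-r))).mul_right_eq_zero.1 hmul)

theorem Ctx.trPI {x : A} (h : PI p (C.nm x)) : PI p (C.tr x) := by
  by_cases hx : ∀ c : ℚ, x ≠ c • (1 : A)
  · by_contra ht
    unfold PI at h ht
    push Not at ht
    set t : ℚ_[p] := (C.tr x : ℚ_[p]) with htd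
    set n : ℚ_[p] := (C.nm x : ℚ_[p]) with hnd
    have ht0 : t ≠ 0 := by intro h0; rw [h0] at ht; norm_num at ht
    have hn1 : ‖n / t ^ 2‖ < 1 := by
      rw [norm_div, norm_pow, div_lt_one (by positivity)]
      nlinarith
    obtain ⟨z, hz⟩ := hensel_quad 1 (n / t^2) 1 (by simp) hn1.le (by simpa using hn1)
      (by norm_num)
    apply C.no_root hx (t * z)
    rw [← htd, ← hnd]
    field_simp at hz
    linear_combination hz
  · push Not at hx
    obtain ⟨c, rfl⟩ := hx
    rw [C.nm_smul, C.nm_one, mul_one, pow_two] at h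
    rw [C.tr_smul_one]
    have := PI.of_int (p := p) 2
    exact PI.mul (by exact_mod_cast this) h.of_sq

theorem Ctx.simple_root {x : A} (hx : ∀ c : ℚ, x ≠ c • (1 : A)) (t n a : ℤ) (ht : (t:ℚ) = C.tr x)
    (hn : (n : ℚ) = C.nm x) (h0 : (p:ℤ) ∣ a ^ 2 - t * a + n) (h1 : ¬ (p:ℤ) ∣ 2 * a - t) : False := by
  obtain ⟨z, hz⟩ := hensel_quad (p := p) t n a (Padic.norm_int_le_one t) (Padic.norm_int_le_one n)
    (by
      rw [← Padic.norm_intCast_lt_one_iff (p := p)] at h0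
      push_cast at h0 ⊢; exact h0)
    (by
      rw [← Padic.norm_intCast_lt_one_iff (p := p)] at h1
      have := Padic.norm_int_le_one (p := p) (2 * a - t)
      have h2 := le_antisymm this (not_lt.1 h1)
      push_cast at h2 ⊢; exact h2)
  apply C.no_root hx z
  rw [← ht, ← hn]
  push_cast; exact hz

theorem Ctx.int_smul_mem {x : A} (hx : x ∈ C.Λ) (m : ℤ) : (m : ℚ) • x ∈ C.Λ := by
  rw [Int.cast_smul_eq_zsmul]; exact C.Λ.zsmul_mem hx m

theorem Ctx.isZ_smul_mem {x : A} (hx : x ∈ C.Λ) {m : ℚ} (hm : IsZ m) : m • x ∈ C.Λ := by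
  obtain ⟨m, rfl⟩ := hm; exact C.int_smul_mem hx m

theorem Ctx.cj_mem {x : A} (hx : x ∈ C.Λ) : C.cj x ∈ C.Λ := by
  unfold QD.cj
  exact C.Λ.sub_mem (C.isZ_smul_mem C.Λ.one_mem (C.F1 hx).1) hx

theorem Ctx.P2 {x : A} (h : PI p (C.nm x)) (k : ℕ) (hk : ((p:ℚ) ^ k) • x ∈ C.Λ) : x ∈ C.Λ := by
  have hpk : ∀ k : ℕ, IsZ ((p:ℚ)^k) := fun k => ⟨(p:ℤ)^k, by push_cast; rfl⟩
  let L : Subring A :=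
    { carrier := {x | PI p (C.nm x) ∧ ∃ k : ℕ, ((p:ℚ) ^ k) • x ∈ C.Λ}
      mul_mem' := by
        rintro x y ⟨hx, k, hk⟩ ⟨hy, l, hl⟩
        refine ⟨by rw [C.nm_mul]; exact hx.mul hy, k + l, ?_⟩
        have := C.Λ.mul_mem hk hl
        rw [smul_mul_smul_comm, ← pow_add] at this
        exact this
      one_mem' := ⟨by rw [C.nm_one]; exact_mod_cast PI.of_int (p := p) 1, 0, by
        simpa using C.Λ.one_mem⟩
      add_mem' := by
        rintro x y ⟨hx, k, hk⟩ ⟨hy, l, hl⟩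
        refine ⟨?_, k + l, ?_⟩
        · rw [C.nm_add]
          exact (hx.add hy).add (C.trPI (by rw [C.nm_mul, C.nm_cj]; exact hx.mul hy))
        · rw [smul_add]
          apply C.Λ.add_mem
          · rw [add_comm, pow_add, mul_smul]; exact C.isZ_smul_mem hk (hpk _)
          · rw [pow_add, mul_smul]; exact C.isZ_smul_mem hl (hpk _)
      zero_mem' := ⟨by rw [C.nm_zero]; exact_mod_cast PI.of_int (p := p) 0, 0, by
        simpa using C.Λ.zero_mem⟩
      neg_mem' := by
        rintro x ⟨hx, k, hk⟩
        exact ⟨by rw [C.nm_neg]; exact hx, k, by rw [smul_neg]; exact C.Λ.neg_mem hk⟩ }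
  have hle : C.Λ ≤ L := fun x hx => ⟨(C.F1 hx).2.pi, 0, by simpa using hx⟩
  have := C.ord L (by
    rintro x hx y hy
    obtain ⟨h1, k, hk⟩ := L.mul_mem hx (hle hy)
    apply isZ_of_pow (C.trPI h1) k
    have := (C.F1 hk).1
    rwa [map_smul, smul_eq_mul] at this) hle
  rw [← this]
  exact ⟨h, k, hk⟩

theorem Ctx.exists_mul_mem (x : A) : ∃ m : ℤ, m ≠ 0 ∧ (m : ℚ) • x ∈ C.Λ := by
  have : x ∈ Submodule.span ℚ (C.Λ : Set A) := by rw [C.span]; trivial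
  induction this using Submodule.span_induction with
  | mem x h => exact ⟨1, one_ne_zero, by simpa using h⟩
  | zero => exact ⟨1, one_ne_zero, by simpa using C.Λ.zero_mem⟩
  | add x y _ _ hx hy =>
    obtain ⟨m, hm, hx⟩ := hx
    obtain ⟨n, hn, hy⟩ := hy
    refine ⟨m * n, mul_ne_zero hm hn, ?_⟩
    rw [smul_add]
    push_cast
    apply C.Λ.add_mem
    · rw [mul_comm, mul_smul]; exact C.int_smul_mem hx n
    · rw [mul_smul]; exact C.int_smul_mem hy m
  | smul c x _ hx =>
    obtain ⟨m, hm, hx⟩ := hx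
    refine ⟨m * c.den, mul_ne_zero hm (by exact_mod_cast c.den_nz), ?_⟩
    rw [smul_smul]
    have : ((m * c.den : ℤ) : ℚ) * c = (c.num : ℚ) * m := by
      push_cast
      rw [mul_assoc, Rat.den_mul_eq_num, mul_comm]
    rw [this, mul_smul]
    exact C.int_smul_mem hx _

theorem Ctx.P3 {x : A} (h : PI p (C.nm x)) : ∃ c : ℤ, ¬ (p:ℤ) ∣ c ∧ (c : ℚ) • x ∈ C.Λ := by
  obtain ⟨m, hm, hx⟩ := C.exists_mul_mem x
  obtain ⟨k, c, hc, hmc⟩ := (FiniteMultiplicity.exists_eq_pow_mul_and_not_dvd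
    (Int.finiteMultiplicity_iff.2 ⟨by simpa using (Fact.out : p.Prime).ne_one, hm⟩ :
      FiniteMultiplicity (p:ℤ) m)) |> fun ⟨c, h1, h2⟩ => (⟨multiplicity (p:ℤ) m, c, h2, h1⟩ :
        ∃ k : ℕ, ∃ c : ℤ, ¬ (p:ℤ) ∣ c ∧ m = (p:ℤ)^k * c)
  refine ⟨c, hc, ?_⟩
  apply C.P2 _ k
  · rw [smul_smul]; rw [hmc] at hx; push_cast at hx; exact hx
  · rw [C.nm_smul]
    have := PI.of_int (p := p) (c ^ 2)
    push_cast at this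
    exact this.mul h

theorem Ctx.P4' {z : A} (t n : ℤ) (ht : (t:ℚ) = C.tr z)
    (hn : (n : ℚ) = C.nm z) (h : (p:ℤ) ∣ n) : (p:ℤ) ∣ t := by
  have hp : Prime (p:ℤ) := Nat.prime_iff_prime_int.1 Fact.out
  by_cases hx : ∀ c : ℚ, z ≠ c • (1 : A)
  · by_contra h1
    exact C.simple_root hx t n 0 ht hn (by simpa using h) (by simpa using h1)
  · push Not at hx
    obtain ⟨c, rfl⟩ := hx
    rw [C.nm_smul, C.nm_one, mul_one] at hn
    rw [C.tr_smul_one] at ht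
    have : t ^ 2 = 4 * n := by
      have : (t:ℚ)^2 = 4 * n := by rw [ht, hn]; ring
      exact_mod_cast this
    apply hp.dvd_of_dvd_pow (n := 2)
    rw [this]; exact dvd_mul_of_dvd_right h _

theorem Ctx.P4 {x y : A} (hx : x ∈ C.Λ) (hy : y ∈ C.Λ) (n t : ℤ) (hn : (n : ℚ) = C.nm x)
    (ht : (t:ℚ) = C.tr (C.cj x * y)) (h : (p:ℤ) ∣ n) : (p:ℤ) ∣ t := by
  obtain ⟨m, hm⟩ := (C.F1 hy).2
  apply C.P4' t (n * m) ht _ (dvd_mul_of_dvd_left h _)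
  rw [C.nm_mul, C.nm_cj]; push_cast; rw [hn, hm]

theorem Ctx.P5 {x : A} (hx : x ∈ C.Λ) (n : ℤ) (hn : (n : ℚ) = C.nm x)
    (h : (p:ℤ) ^ 2 ∣ n) : (p:ℚ)⁻¹ • x ∈ C.Λ := by
  have hp0 : (p : ℚ) ≠ 0 := by exact_mod_cast (Fact.out : p.Prime).ne_zero
  apply C.P2 _ 1
  · rw [smul_smul, pow_one, mul_inv_cancel₀ hp0, one_smul]; exact hx
  · obtain ⟨k, rfl⟩ := h
    rw [C.nm_smul, ← hn]
    push_cast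
    rw [← mul_assoc, ← mul_pow, inv_mul_cancel₀ hp0, one_pow, one_mul]
    exact PI.of_int k

end
end CQ

namespace CQ

open Quaternion in
theorem isotropic {A : Type*} [Ring A] [Algebra ℚ A] (Q : QD A) (F : Type*) [Field F] [Algebra ℚ F]
    (h : ¬ IsDivisionRingCarrier (F ⊗[ℚ] A)) :
    ∃ x0 x1 x2 x3 : F, (x0 ≠ 0 ∨ x1 ≠ 0 ∨ x2 ≠ 0 ∨ x3 ≠ 0) ∧
      x0 ^ 2 - (Q.a : F) * x1 ^ 2 - (Q.b:F) * x2 ^ 2 + (Q.a:F) * Q.b * x3 ^ 2 = 0 := by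
  have : CharZero F := algebraRat.charZero F
  haveI := Q.nontriv
  have hinj : Function.Injective (fun x : A => (1:F) ⊗ₜ[ℚ] x) :=
    Algebra.TensorProduct.includeRight_injective (R := ℚ) (A := F) (B := A)
      (algebraMap ℚ F).injective
  have hnt : Nontrivial (F ⊗[ℚ] A) := hinj.nontrivial
  let i : A := Q.e.symm ⟨0,1,0,0⟩
  let j : A := Q.e.symm ⟨0,0,1,0⟩
  let k : A := Q.e.symm ⟨0,0,0,1⟩
  have hii : i * i = Q.a • (1 : A) := by
    apply Q.e.injective; rw [map_mul, map_smul, map_one]; simp only [i, AlgEquiv.apply_symm_apply]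
    ext <;> simp
  have hjj : j * j = Q.b • (1 : A) := by
    apply Q.e.injective; rw [map_mul, map_smul, map_one]; simp only [j, AlgEquiv.apply_symm_apply]
    ext <;> simp
  have hij : i * j = k := by
    apply Q.e.injective; rw [map_mul]; simp only [i, j, k, AlgEquiv.apply_symm_apply]
    ext <;> simp
  have hji : j * i = -k := by
    apply Q.e.injective; rw [map_mul, map_neg]; simp only [i, j, k, AlgEquiv.apply_symm_apply]
    ext <;> simp
  have hx : ∀ x : A, x = (Q.e x).re • (1:A) + (Q.e x).imI • i + (Q.e x).imJ • j + (Q.e x).imK • k := by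
    intro x
    apply Q.e.injective; simp only [map_add, map_smul, map_one, i, j, k, AlgEquiv.apply_symm_apply]
    ext <;> simp
  have key : ∀ c : ℚ, (1:F) ⊗ₜ[ℚ] (c • (1 : A)) = (c : F) • (1 : F ⊗[ℚ] A) := by
    intro c
    rw [← TensorProduct.smul_tmul, Algebra.TensorProduct.one_def, TensorProduct.smul_tmul']
    congr 1; rw [Algebra.smul_def]; simp
  let B : QuaternionAlgebra.Basis (F ⊗[ℚ] A) (Q.a : F) 0 (Q.b : F) :=
    { i := (1:F) ⊗ₜ[ℚ] i, j := (1:F) ⊗ₜ[ℚ] j, k := (1:F) ⊗ₜ[ℚ] k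
      i_mul_i := by rw [Algebra.TensorProduct.tmul_mul_tmul, hii, mul_one, key]; simp
      j_mul_j := by rw [Algebra.TensorProduct.tmul_mul_tmul, hjj, mul_one, key]
      i_mul_j := by rw [Algebra.TensorProduct.tmul_mul_tmul, hij, mul_one]
      j_mul_i := by
        rw [Algebra.TensorProduct.tmul_mul_tmul, hji, mul_one, TensorProduct.tmul_neg]; simp }
  have hB : ∀ q : ℍ[F,(Q.a:F),0,(Q.b:F)], B.liftHom q = q.re • (1 : F ⊗[ℚ] A) + q.imI • B.i + q.imJ • B.j
      + q.imK • B.k := by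
    intro q
    change B.lift q = _
    unfold QuaternionAlgebra.Basis.lift
    rw [Algebra.algebraMap_eq_smul_one]
  have hsurj : ∀ z, ∃ q, B.liftHom q = z := by
    intro z
    induction z using TensorProduct.induction_on with
    | zero => exact ⟨0, map_zero _⟩
    | add x y hx hy =>
      obtain ⟨u, hu⟩ := hx
      obtain ⟨v, hv⟩ := hy
      exact ⟨u + v, by rw [map_add, hu, hv]⟩
    | tmul c x =>
      have e : ∀ (r : ℚ) (w : A), c ⊗ₜ[ℚ] (r • w) = (c * r) • ((1:F) ⊗ₜ[ℚ] w) := by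
        intro r w
        rw [← TensorProduct.smul_tmul, TensorProduct.smul_tmul']
        congr 1; rw [Algebra.smul_def]; simp [mul_comm]
      refine ⟨⟨c * (Q.e x).re, c * (Q.e x).imI, c * (Q.e x).imJ, c * (Q.e x).imK⟩, ?_⟩
      rw [hB]
      conv_rhs => rw [hx x]
      rw [TensorProduct.tmul_add, TensorProduct.tmul_add, TensorProduct.tmul_add, e, e, e, e]
      rfl
  unfold IsDivisionRingCarrier at h
  push Not at h
  obtain ⟨z, hz, hzu⟩ := h hnt
  obtain ⟨q, rfl⟩ := hsurj z
  refine ⟨q.re, q.imI, q.imJ, q.imK, ?_, ?_⟩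
  · by_contra hcon
    push Not at hcon
    obtain ⟨h0, h1, h2, h3⟩ := hcon
    apply hz
    rw [hB, h0, h1, h2, h3]; simp
  · by_contra hN
    set N := q.re ^ 2 - (Q.a : F) * q.imI ^ 2 - (Q.b:F) * q.imJ ^ 2 + (Q.a:F) * Q.b * q.imK ^ 2 with hNd
    have e1 : q * star q = algebraMap F _ N := by
      clear_value N
      ext <;> simp <;> first | ring1 | linear_combination (-1) * hNd
    have e2 : star q * q = algebraMap F _ N := by
      clear_value N
      ext <;> simp <;> first | ring1 | linear_combination (-1) * hNd
    apply hzu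
    have f1 := congrArg B.liftHom e1
    have f2 := congrArg B.liftHom e2
    rw [map_mul, AlgHom.commutes, Algebra.algebraMap_eq_smul_one] at f1 f2
    refine ⟨⟨B.liftHom q, N⁻¹ • B.liftHom (star q), ?_, ?_⟩, rfl⟩
    · rw [mul_smul_comm, f1, smul_smul, inv_mul_cancel₀ hN, one_smul]
    · rw [smul_mul_assoc, f2, smul_smul, inv_mul_cancel₀ hN, one_smul]

theorem norm_rep {F : Type*} [Field F] [CharZero F] (a b x0 x1 x2 x3 : F) (ha : a ≠ 0)
    (h : x0 ≠ 0 ∨ x1 ≠ 0 ∨ x2 ≠ 0 ∨ x3 ≠ 0)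
    (h0 : x0 ^ 2 - a * x1 ^ 2 - b * x2 ^ 2 + a * b * x3 ^ 2 = 0) :
    ∃ α β : F, α ^ 2 - a * β ^ 2 = b := by
  by_cases hD : x2 ^ 2 - a * x3 ^ 2 = 0
  · obtain ⟨d, hd⟩ : ∃ d, a = d ^ 2 := by
      by_cases h3 : x3 = 0
      · have h2 : x2 = 0 := by rw [h3] at hD; simpa using hD
        have h1 : x1 ≠ 0 := by
          intro h1
          rw [h1, h2, h3] at h0
          have : x0 = 0 := by simpa using h0
          simp_all
        refine ⟨x0 / x1, ?_⟩
        rw [h2, h3] at h0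
        field_simp; linear_combination (-1) * h0
      · refine ⟨x2 / x3, ?_⟩
        field_simp; linear_combination (-1) * hD
    have hd0 : d ≠ 0 := by rintro rfl; simp at hd; exact ha hd
    refine ⟨(b + 1) / 2, (b - 1) / (2 * d), ?_⟩
    rw [hd]; field_simp; ring
  · refine ⟨(x0 * x2 - a * x1 * x3) / (x2 ^ 2 - a * x3 ^ 2),
      (x1 * x2 - x0 * x3) / (x2 ^ 2 - a * x3 ^ 2), ?_⟩
    field_simp
    linear_combination (x2 ^ 2 - a * x3 ^ 2) * h0

open Quaternion in
theorem exists_phi {A : Type*} [Ring A] [Algebra ℚ A] (Q : QD A) (F : Type*) [Field F] [Algebra ℚ F]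
    (h : ¬ IsDivisionRingCarrier (F ⊗[ℚ] A)) :
    ∃ φ : A →ₐ[ℚ] Matrix (Fin 2) (Fin 2) F, (∀ x, (φ x).trace = (Q.tr x : F)) ∧
      (∀ x, (φ x).det = (Q.nm x : F)) ∧ Submodule.span F (Set.range φ) = ⊤ := by
  have : CharZero F := algebraRat.charZero F
  obtain ⟨x0, x1, x2, x3, hx, h0⟩ := isotropic Q F h
  have ha : (Q.a : F) ≠ 0 := by exact_mod_cast Q.ha.ne
  have hb0 : (Q.b : F) ≠ 0 := by exact_mod_cast Q.hb.ne
  obtain ⟨α, β, hb⟩ := norm_rep (Q.a : F) (Q.b : F) x0 x1 x2 x3 ha hx h0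
  have hs : ∀ (q : ℚ) (m : F), q • m = (q : F) * m := by
    intro q m; rw [Algebra.smul_def]; simp
  let B : QuaternionAlgebra.Basis (Matrix (Fin 2) (Fin 2) F) Q.a (0:ℚ) Q.b :=
    { i := !![0, (Q.a : F); 1, 0], j := !![α, -(Q.a : F) * β; β, -α]
      k := !![(Q.a:F) * β, -(Q.a:F) * α; α, -(Q.a:F) * β]
      i_mul_i := by
        ext u v; fin_cases u <;> fin_cases v <;> simp [Matrix.mul_apply, Fin.sum_univ_two, hs]
      j_mul_j := by
        ext u v; fin_cases u <;> fin_cases v <;> simp [Matrix.mul_apply, Fin.sum_univ_two, hs] <;>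
          first | ring1 | linear_combination hb
      i_mul_j := by
        ext u v; fin_cases u <;> fin_cases v <;> simp [Matrix.mul_apply, Fin.sum_univ_two, hs]
      j_mul_i := by
        ext u v; fin_cases u <;> fin_cases v <;> simp [Matrix.mul_apply, Fin.sum_univ_two, hs] <;> ring }
  let φ : A →ₐ[ℚ] Matrix (Fin 2) (Fin 2) F := B.liftHom.comp Q.e.toAlgHom
  have hφ : ∀ x, φ x = (Q.e x).re • (1 : Matrix (Fin 2) (Fin 2) F) + (Q.e x).imI • B.i + (Q.e x).imJ • B.j
      + (Q.e x).imK • B.k := by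
    intro x
    change B.lift (Q.e x) = _
    unfold QuaternionAlgebra.Basis.lift
    rw [Algebra.algebraMap_eq_smul_one]
  refine ⟨φ, ?_, ?_, ?_⟩
  · intro x
    rw [hφ, Q.tr_def]
    simp [Matrix.trace, Fin.sum_univ_two, B, hs]; ring
  · intro x
    rw [hφ]
    unfold QD.nm
    simp [Matrix.det_fin_two, B, hs]
    linear_combination (- ((Q.e x).imJ : F) ^ 2 + (Q.a : F) * ((Q.e x).imK : F) ^ 2) * hb
  · rw [eq_top_iff]
    rintro X -
    have hI : ∀ q, B.liftHom q ∈ Submodule.span F (Set.range φ) := fun q =>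
      Submodule.subset_span ⟨Q.e.symm q, by simp [φ]⟩
    have hi := hI ⟨0,1,0,0⟩
    have hj := hI ⟨0,0,1,0⟩
    have hk := hI ⟨0,0,0,1⟩
    have h1 := hI 1
    rw [map_one] at h1
    change B.lift _ ∈ _ at hi hj hk
    simp only [QuaternionAlgebra.Basis.lift, map_zero, zero_smul, one_smul, zero_add, add_zero] at hi hj hk
    have : X = ((X 0 0 + X 1 1) / 2) • (1 : Matrix (Fin 2) (Fin 2) F)
        + ((X 0 1 / Q.a + X 1 0) / 2) • B.i
        + ((α * ((X 0 0 - X 1 1) / 2) - Q.a * β * ((X 1 0 - X 0 1 / Q.a) / 2)) / Q.b) • B.j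
        + ((α * ((X 1 0 - X 0 1 / Q.a) / 2) - β * ((X 0 0 - X 1 1) / 2)) / Q.b) • B.k := by
      rw [← hb] at hb0 ⊢
      ext u v
      fin_cases u <;> fin_cases v <;> simp [B] <;> field_simp <;> ring
    rw [this]
    exact add_mem (add_mem (add_mem (Submodule.smul_mem _ _ h1) (Submodule.smul_mem _ _ hi))
      (Submodule.smul_mem _ _ hj)) (Submodule.smul_mem _ _ hk)

end CQ

namespace CQ

section
variable {p : ℕ} {A : Type*} [Ring A] [Algebra ℚ A] (C : Ctx p A) {ℓ : ℕ} [Fact ℓ.Prime]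

theorem Ctx.exists_phi_int (hl : ℓ ≠ p) :
    ∃ φ : A →+* Matrix (Fin 2) (Fin 2) ℚ_[ℓ], (∀ x, (φ x).trace = (C.tr x : ℚ_[ℓ])) ∧
      (∀ x, (φ x).det = (C.nm x : ℚ_[ℓ])) ∧
      Submodule.span ℚ_[ℓ] (φ '' (C.Λ : Set A)) = ⊤ ∧
      (∀ x ∈ C.Λ, ∀ i j, ‖φ x i j‖ ≤ 1) := by
  obtain ⟨φ, h1, h2, h3⟩ := exists_phi C.toQD ℚ_[ℓ] (C.hspl ℓ Fact.out hl)
  have h3 : Submodule.span ℚ_[ℓ] (φ '' (C.Λ : Set A)) = ⊤ := by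
    rw [eq_top_iff, ← h3, Submodule.span_le]
    rintro _ ⟨x, rfl⟩
    haveI : Fact p.Prime := ⟨C.hp⟩
    obtain ⟨m, hm, hx⟩ := C.exists_mul_mem x
    have : φ x = ((m:ℚ_[ℓ]))⁻¹ • φ ((m : ℚ) • x) := by
      rw [map_smul]
      have : (m : ℚ) • φ x = (m : ℚ_[ℓ]) • φ x := by
        rw [Int.cast_smul_eq_zsmul, Int.cast_smul_eq_zsmul]
      rw [this, smul_smul, inv_mul_cancel₀ (by exact_mod_cast hm), one_smul]
    rw [this]
    exact Submodule.smul_mem _ _ (Submodule.subset_span ⟨_, hx, rfl⟩)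
  obtain ⟨S, hSΛ, hS, -⟩ := C.exists_gens
  let V := Fin 2 → ℚ_[ℓ]
  let e1 : V := Pi.single 0 1
  let ev : A → V := fun x => (φ x).mulVec e1
  let M : Submodule ℤ_[ℓ] V := Submodule.span ℤ_[ℓ] (ev '' (S : Set A))
  have hev : ∀ x ∈ C.Λ, ev x ∈ M := by
    intro x hx
    have hx' : x ∈ C.Λ.toAddSubgroup := hx
    rw [← hS] at hx'
    induction hx' using AddSubgroup.closure_induction with
    | mem x h => exact Submodule.subset_span ⟨x, h, rfl⟩
    | zero => rw [show ev 0 = 0 from by simp only [ev, map_zero, Matrix.zero_mulVec]]; exact zero_mem _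
    | add x y _ _ h1 h2 =>
      have hx1 : x ∈ C.Λ := by
        rename_i h _; rw [hS] at h; exact h
      have hx2 : y ∈ C.Λ := by
        rename_i h; rw [hS] at h; exact h
      have := add_mem (h1 hx1) (h2 hx2)
      rw [show ev (x + y) = ev x + ev y from by simp only [ev, map_add, Matrix.add_mulVec]]; exact this
    | neg x h' h1 =>
      have hx1 : x ∈ C.Λ := by
        rw [hS] at h'; exact h'
      have := neg_mem (h1 hx1)
      rw [show ev (-x) = - ev x from by simp only [ev, map_neg, Matrix.neg_mulVec]]; exact this
  have hstab : ∀ x ∈ C.Λ, ∀ m ∈ M, (φ x).mulVec m ∈ M := by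
    intro x hx m hm
    induction hm using Submodule.span_induction with
    | mem m h =>
      obtain ⟨s, hs, rfl⟩ := h
      have := hev _ (C.Λ.mul_mem hx (hSΛ s hs))
      rw [show (φ x).mulVec (ev s) = ev (x * s) from by simp only [ev, map_mul, Matrix.mulVec_mulVec]]; exact this
    | zero => simp
    | add u v _ _ hu hv => rw [Matrix.mulVec_add]; exact add_mem hu hv
    | smul c u _ hu =>
      have : (φ x).mulVec (c • u) = c • (φ x).mulVec u := by
        rw [← Matrix.mulVec_smul]
      rw [this]; exact Submodule.smul_mem _ _ hu
  haveI : M.IsLattice ℚ_[ℓ] := by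
    constructor
    · exact Submodule.fg_span (Set.Finite.image _ S.finite_toSet)
    · rw [eq_top_iff]
      rintro w -
      let g : Matrix (Fin 2) (Fin 2) ℚ_[ℓ] →ₗ[ℚ_[ℓ]] V :=
        { toFun := fun X => X.mulVec e1
          map_add' := fun X Y => Matrix.add_mulVec _ _ _
          map_smul' := fun c X => Matrix.smul_mulVec _ _ _ }
      have hle : Submodule.span ℚ_[ℓ] (φ '' (C.Λ : Set A)) ≤
          (Submodule.span ℚ_[ℓ] (M : Set V)).comap g := by
        rw [Submodule.span_le]
        rintro _ ⟨x, hx, rfl⟩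
        exact Submodule.subset_span (hev x hx)
      have hw : w = g (Matrix.of fun (i : Fin 2) (_ : Fin 2) => w i) := by
        funext i
        change _ = (Matrix.of fun (i : Fin 2) (_ : Fin 2) => w i).mulVec (Pi.single 0 1) i
        simp
      rw [hw]
      exact hle (by rw [h3]; trivial)
  haveI : Module.Free ℤ_[ℓ] M := Submodule.IsLattice.free ℚ_[ℓ] M
  let b0 := Module.finBasisOfFinrankEq ℤ_[ℓ] M (n := 2)
    (by simpa using Submodule.IsLattice.finrank_of_pi ℚ_[ℓ] M)
  let B := b0.extendOfIsLattice ℚ_[ℓ]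
  have hB : ∀ k, B k = (b0 k).val := fun k => Module.Basis.extendOfIsLattice_apply ℚ_[ℓ] b0 k
  have hrepr : ∀ m ∈ M, ∀ i, ‖B.repr m i‖ ≤ 1 := by
    intro m hm i
    have : m = ∑ k, (b0.repr ⟨m, hm⟩ k : ℤ_[ℓ]).val • B k := by
      have := congrArg Subtype.val (b0.sum_repr ⟨m, hm⟩)
      simp only [Submodule.coe_sum, Submodule.coe_smul] at this
      conv_lhs => rw [← this]
      apply Finset.sum_congr rfl
      intro k _
      rw [hB]; rfl
    rw [this, B.repr_sum_self]
    exact (b0.repr ⟨m, hm⟩ i).2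
  let E : Matrix (Fin 2) (Fin 2) ℚ_[ℓ] ≃ₐ[ℚ_[ℓ]] Matrix (Fin 2) (Fin 2) ℚ_[ℓ] :=
    Matrix.toLinAlgEquiv'.trans (LinearMap.toMatrixAlgEquiv B)
  have hE : ∀ X, E X = LinearMap.toMatrix B B (Matrix.toLin' X) := fun X => rfl
  refine ⟨E.toAlgHom.toRingHom.comp φ.toRingHom, ?_, ?_, ?_, ?_⟩
  · intro x
    change (E (φ x)).trace = _
    rw [hE, ← LinearMap.trace_eq_matrix_trace, Matrix.trace_toLin'_eq, h1]
  · intro x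
    change (E (φ x)).det = _
    rw [hE, LinearMap.det_toMatrix, LinearMap.det_toLin', h2]
  · have : (E.toAlgHom.toRingHom.comp φ.toRingHom) '' (C.Λ : Set A) =
        E.toLinearMap '' (φ '' (C.Λ : Set A)) := by
      rw [Set.image_image]; rfl
    rw [this, ← Submodule.map_span, h3, Submodule.map_top, LinearMap.range_eq_top]
    exact E.surjective
  · intro x hx i j
    change ‖E (φ x) i j‖ ≤ 1
    rw [hE, LinearMap.toMatrix_apply]
    apply hrepr
    rw [Matrix.toLin'_apply, hB]
    exact hstab x hx _ (b0 j).2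

theorem padic_approx (c : ℚ_[ℓ]) : ∃ (r : ℚ) (k : ℕ), IsZ ((ℓ:ℚ) ^ k * r) ∧ ‖c - r‖ < 1 := by
  have hl0 : (ℓ : ℚ) ≠ 0 := by exact_mod_cast (Fact.out : ℓ.Prime).ne_zero
  have hl0' : (ℓ : ℚ_[ℓ]) ≠ 0 := by exact_mod_cast (Fact.out : ℓ.Prime).ne_zero
  obtain ⟨k, hk⟩ : ∃ k : ℕ, ‖(ℓ : ℚ_[ℓ]) ^ k * c‖ ≤ 1 := by
    have h1 : ‖(ℓ : ℚ_[ℓ])‖ < 1 := Padic.norm_p_lt_one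
    have := (tendsto_pow_atTop_nhds_zero_of_lt_one (norm_nonneg _) h1).mul_const ‖c‖
    rw [zero_mul] at this
    obtain ⟨k, hk⟩ := (this.eventually (gt_mem_nhds (zero_lt_one))).exists
    exact ⟨k, by rw [norm_mul, norm_pow]; exact hk.le⟩
  obtain ⟨Z, hZ⟩ : ∃ Z : ℤ_[ℓ], (Z : ℚ_[ℓ]) = (ℓ : ℚ_[ℓ]) ^ k * c := ⟨⟨_, hk⟩, rfl⟩
  obtain ⟨n, hn⟩ := PadicInt.denseRange_natCast.exists_dist_lt Z
    (ε := ‖(ℓ : ℚ_[ℓ]) ^ k‖) (by rw [norm_pos_iff]; exact pow_ne_zero _ hl0')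
  refine ⟨n / (ℓ:ℚ)^k, k, ⟨n, by push_cast; field_simp⟩, ?_⟩
  rw [dist_eq_norm, ← PadicInt.padic_norm_e_of_padicInt] at hn
  push_cast at hn
  rw [hZ] at hn
  have e : c - ((n / (ℓ:ℚ)^k : ℚ) : ℚ_[ℓ]) = ((ℓ : ℚ_[ℓ]) ^ k * c - n) / (ℓ : ℚ_[ℓ]) ^ k := by
    push_cast; field_simp
  rw [e, norm_div, div_lt_one (by rw [norm_pos_iff]; exact pow_ne_zero _ hl0')]
  exact hn

theorem Ctx.exists_psi (hl : ℓ ≠ p) :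
    ∃ ψ : C.Λ →+* Matrix (Fin 2) (Fin 2) (ZMod ℓ), Function.Surjective ψ ∧
      (∀ x : C.Λ, ψ x = 0 → (ℓ:ℚ)⁻¹ • x.1 ∈ C.Λ) ∧
      (∀ (x : C.Λ) (n : ℤ), (n : ℚ) = C.nm x.1 → (ψ x).det = n) ∧
      (∀ (x : C.Λ) (t : ℤ), (t : ℚ) = C.tr x.1 → (ψ x).trace = t) := by
  obtain ⟨φ, h1, h2, h3, h4⟩ := C.exists_phi_int hl
  have hl0 : (ℓ : ℚ) ≠ 0 := by exact_mod_cast (Fact.out : ℓ.Prime).ne_zero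
  have hl0' : (ℓ : ℚ_[ℓ]) ≠ 0 := by exact_mod_cast (Fact.out : ℓ.Prime).ne_zero
  haveI : Fact p.Prime := ⟨C.hp⟩
  have hpk : ∀ k : ℕ, IsZ ((ℓ:ℚ)^k) := fun k => ⟨(ℓ:ℤ)^k, by push_cast; rfl⟩
  have hsc : ∀ (r : ℚ) (x : A), φ (r • x) = (r : ℚ_[ℓ]) • φ x := by
    intro r x
    have e1 : (r.den : ℚ_[ℓ]) • φ (r • x) = (r.num : ℚ_[ℓ]) • φ x := by
      rw [Nat.cast_smul_eq_nsmul, Int.cast_smul_eq_zsmul, ← map_nsmul, ← map_zsmul,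
        ← Nat.cast_smul_eq_nsmul ℚ, ← Int.cast_smul_eq_zsmul ℚ, smul_smul, Rat.den_mul_eq_num]
    have hd : (r.den : ℚ_[ℓ]) ≠ 0 := by exact_mod_cast r.den_nz
    have e2 : (r : ℚ_[ℓ]) = (r.den : ℚ_[ℓ])⁻¹ * r.num := by
      rw [Rat.cast_def]; field_simp
    rw [e2, mul_smul, ← e1, smul_smul, inv_mul_cancel₀ hd, one_smul]
  -- local characterisation
  have K1 : ∀ x : A, (∀ i j, ‖φ x i j‖ ≤ 1) → ∀ k : ℕ, ((ℓ:ℚ)^k) • x ∈ C.Λ → x ∈ C.Λ := by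
    let L : Subring A :=
      { carrier := {x | (∀ i j, ‖φ x i j‖ ≤ 1) ∧ ∃ k : ℕ, ((ℓ:ℚ) ^ k) • x ∈ C.Λ}
        mul_mem' := by
          rintro x y ⟨hx, k, hk⟩ ⟨hy, l, hl⟩
          refine ⟨?_, k + l, ?_⟩
          · intro i j
            rw [map_mul, Matrix.mul_apply, Fin.sum_univ_two]
            refine (Padic.nonarchimedean _ _).trans (max_le ?_ ?_)
            · rw [norm_mul]; exact mul_le_one₀ (hx _ _) (norm_nonneg _) (hy _ _)
            · rw [norm_mul]; exact mul_le_one₀ (hx _ _) (norm_nonneg _) (hy _ _)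
          have := C.Λ.mul_mem hk hl
          rw [smul_mul_smul_comm, ← pow_add] at this
          exact this
        one_mem' := ⟨h4 1 C.Λ.one_mem, 0, by simpa using C.Λ.one_mem⟩
        add_mem' := by
          rintro x y ⟨hx, k, hk⟩ ⟨hy, l, hl⟩
          refine ⟨?_, k + l, ?_⟩
          · intro i j
            rw [map_add, Matrix.add_apply]
            exact (Padic.nonarchimedean _ _).trans (max_le (hx _ _) (hy _ _))
          · rw [smul_add]
            apply C.Λ.add_mem
            · rw [add_comm, pow_add, mul_smul]; exact C.isZ_smul_mem hk (hpk _)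
            · rw [pow_add, mul_smul]; exact C.isZ_smul_mem hl (hpk _)
        zero_mem' := ⟨h4 0 C.Λ.zero_mem, 0, by simpa using C.Λ.zero_mem⟩
        neg_mem' := by
          rintro x ⟨hx, k, hk⟩
          exact ⟨by intro i j; rw [map_neg, Matrix.neg_apply, norm_neg]; exact hx i j,
            k, by rw [smul_neg]; exact C.Λ.neg_mem hk⟩ }
    have hle : C.Λ ≤ L := fun x hx => ⟨h4 x hx, 0, by simpa using hx⟩
    have := C.ord L (by
      rintro x hx y hy
      obtain ⟨h5, k, hk⟩ := L.mul_mem hx (hle hy)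
      apply isZ_of_pow (p := ℓ) (k := k)
      · unfold PI
        rw [← h1, Matrix.trace_fin_two]
        exact (Padic.nonarchimedean _ _).trans (max_le (h5 _ _) (h5 _ _))
      have := (C.F1 hk).1
      rwa [map_smul, smul_eq_mul] at this) hle
    intro x hx k hk
    rw [← this]
    exact ⟨hx, k, hk⟩
  let c : Matrix (Fin 2) (Fin 2) ℤ_[ℓ] →+* Matrix (Fin 2) (Fin 2) ℚ_[ℓ] :=
    (PadicInt.Coe.ringHom (p := ℓ)).mapMatrix
  have hc : Function.Injective c := by
    intro X Y h
    ext i j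
    have := congrFun (congrFun h i) j
    exact Subtype.ext this
  let F : C.Λ → Matrix (Fin 2) (Fin 2) ℤ_[ℓ] := fun x => Matrix.of fun i j => ⟨φ x.1 i j, h4 x.1 x.2 i j⟩
  have hF : ∀ x, c (F x) = φ x.1 := by
    intro x; ext i j; rfl
  let Φ : C.Λ →+* Matrix (Fin 2) (Fin 2) ℤ_[ℓ] :=
    { toFun := F
      map_one' := hc (by rw [hF, map_one]; simp)
      map_mul' := fun x y => hc (by rw [map_mul, hF, hF, hF]; simp)
      map_zero' := hc (by rw [hF, map_zero]; simp)
      map_add' := fun x y => hc (by rw [map_add, hF, hF, hF]; simp) }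
  let ψ : C.Λ →+* Matrix (Fin 2) (Fin 2) (ZMod ℓ) := (PadicInt.toZMod (p := ℓ)).mapMatrix.comp Φ
  have hψ : ∀ x i j, ψ x i j = PadicInt.toZMod (F x i j) := fun x i j => rfl
  have hker : ∀ z : ℤ_[ℓ], PadicInt.toZMod z = 0 ↔ ‖z‖ < 1 := by
    intro z
    rw [← RingHom.mem_ker, PadicInt.ker_toZMod, PadicInt.maximalIdeal_eq_span_p,
      PadicInt.norm_lt_one_iff_dvd, Ideal.mem_span_singleton]
  refine ⟨ψ, ?_, ?_, ?_, ?_⟩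
  · intro Y
    have happ : ∀ X : Matrix (Fin 2) (Fin 2) ℚ_[ℓ], X ∈ Submodule.span ℚ_[ℓ] (φ '' (C.Λ : Set A)) →
        ∀ d : ℚ_[ℓ], ∃ x : A, (∃ k : ℕ, ((ℓ:ℚ)^k) • x ∈ C.Λ) ∧ ∀ i j, ‖(d • X) i j - φ x i j‖ < 1 := by
      intro X hX
      induction hX using Submodule.span_induction with
      | mem X h =>
        obtain ⟨x, hx, rfl⟩ := h
        intro d
        obtain ⟨r, k, hr, hd⟩ := padic_approx d
        refine ⟨r • x, ⟨k, by rw [smul_smul]; exact C.isZ_smul_mem hx hr⟩, ?_⟩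
        intro i j
        rw [hsc, Matrix.smul_apply, Matrix.smul_apply, smul_eq_mul, smul_eq_mul, ← sub_mul, norm_mul]
        have := h4 x hx i j
        nlinarith [norm_nonneg (φ x i j), norm_nonneg (d - r)]
      | zero => intro d; exact ⟨0, ⟨0, by simpa using C.Λ.zero_mem⟩, by simp⟩
      | add X Y _ _ hX hY =>
        intro d
        obtain ⟨x, ⟨k, hk⟩, hx⟩ := hX d
        obtain ⟨y, ⟨l, hl⟩, hy⟩ := hY d
        refine ⟨x + y, ⟨k + l, ?_⟩, ?_⟩
        · rw [smul_add]
          apply C.Λ.add_mem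
          · rw [add_comm, pow_add, mul_smul]; exact C.isZ_smul_mem hk (hpk _)
          · rw [pow_add, mul_smul]; exact C.isZ_smul_mem hl (hpk _)
        · intro i j
          have e : (d • (X + Y)) i j - φ (x + y) i j = ((d • X) i j - φ x i j) + ((d • Y) i j - φ y i j) := by
            rw [smul_add, map_add, Matrix.add_apply, Matrix.add_apply]; ring
          rw [e]
          exact (Padic.nonarchimedean _ _).trans_lt (max_lt (hx _ _) (hy _ _))
      | smul c X _ hX =>
        intro d
        rw [smul_smul]; exact hX _
    have hlift : ∀ y : ZMod ℓ, ∃ z : ℤ_[ℓ], PadicInt.toZMod z = y := by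
      intro y
      exact ⟨(y.val : ℤ_[ℓ]), by rw [map_natCast]; exact ZMod.natCast_zmod_val y⟩
    choose s hs using hlift
    obtain ⟨x, ⟨k, hk⟩, hx⟩ := happ (Matrix.of fun i j => ((s (Y i j) : ℤ_[ℓ]) : ℚ_[ℓ])) (by rw [h3]; trivial) 1
    have hxint : ∀ i j, ‖φ x i j‖ ≤ 1 := by
      intro i j
      have e : φ x i j = (s (Y i j) : ℚ_[ℓ]) + -((s (Y i j) : ℚ_[ℓ]) - φ x i j) := by ring
      rw [e]
      refine (Padic.nonarchimedean _ _).trans (max_le (s (Y i j)).2 ?_)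
      rw [norm_neg]
      have := (hx i j).le
      rwa [one_smul] at this
    refine ⟨⟨x, K1 x hxint k hk⟩, ?_⟩
    ext i j
    rw [hψ, ← hs (Y i j), ← sub_eq_zero, ← map_sub, hker]
    have := hx i j
    rw [one_smul, norm_sub_rev] at this
    rw [← PadicInt.padic_norm_e_of_padicInt]
    exact this
  · intro x hx
    apply K1 _ _ 1
    · rw [smul_smul, pow_one, mul_inv_cancel₀ hl0, one_smul]; exact x.2
    · intro i j
      have h := congrFun (congrFun hx i) j
      rw [hψ, Matrix.zero_apply, hker, PadicInt.norm_lt_one_iff_dvd] at h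
      obtain ⟨w, hw⟩ := h
      have hw' : φ x.1 i j = (ℓ : ℚ_[ℓ]) * w := by
        have := congrArg (fun z : ℤ_[ℓ] => (z : ℚ_[ℓ])) hw
        push_cast at this; exact this
      rw [hsc, Matrix.smul_apply, hw']
      push_cast
      rw [smul_eq_mul, ← mul_assoc, inv_mul_cancel₀ hl0', one_mul]
      exact w.2
  · intro x n hn
    have e : (Φ x).det = (n : ℤ_[ℓ]) := by
      apply Subtype.ext
      have := h2 x.1
      rw [← hF x, ← hn] at this
      rw [← RingHom.map_det] at this
      push_cast at this ⊢
      exact this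
    change ((PadicInt.toZMod (p := ℓ)).mapMatrix (Φ x)).det = _
    rw [← RingHom.map_det, e, map_intCast]
  · intro x t ht
    have e : (Φ x).trace = (t : ℤ_[ℓ]) := by
      apply Subtype.ext
      have := h1 x.1
      rw [← ht, Matrix.trace_fin_two] at this
      rw [Matrix.trace_fin_two]
      push_cast at this ⊢
      exact this
    rw [Matrix.trace_fin_two, hψ, hψ, ← map_add]
    rw [Matrix.trace_fin_two] at e
    change PadicInt.toZMod (Φ x 0 0 + Φ x 1 1) = _
    rw [e, map_intCast]

end
end CQ

namespace CQ

section
variable {p : ℕ} {A : Type*} [Ring A] [Algebra ℚ A] (C : Ctx p A)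

theorem Ctx.L1 {ℓ : ℕ} [Fact ℓ.Prime] (hl : ℓ ≠ p) {x : A} (hx : x ∈ C.Λ)
    (h : ∀ y ∈ C.Λ, IsZ ((ℓ:ℚ)⁻¹ * C.tr (x * y))) : (ℓ:ℚ)⁻¹ • x ∈ C.Λ := by
  obtain ⟨ψ, hs, hk, -, ht⟩ := C.exists_psi hl
  have hl0 : (ℓ : ℚ) ≠ 0 := by exact_mod_cast (Fact.out : ℓ.Prime).ne_zero
  apply hk ⟨x, hx⟩
  have key : ∀ Y, (ψ ⟨x, hx⟩ * Y).trace = 0 := by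
    intro Y
    obtain ⟨y, rfl⟩ := hs Y
    obtain ⟨m, hm⟩ := h y.1 y.2
    rw [← map_mul, ht _ ((ℓ:ℤ) * m)]
    · push_cast; simp
    · push_cast; rw [hm]
      change _ = C.tr (x * y.1)
      field_simp
  ext i j
  have := key (Matrix.single j i 1)
  rw [Matrix.trace_mul_single] at this
  simpa using this

theorem Ctx.MEM [Fact p.Prime] {z : A} (h : ∀ y ∈ C.Λ, IsZ (C.tr (z * y))) (hn : PI p (C.nm z)) :
    z ∈ C.Λ := by
  obtain ⟨c, hc, hcz⟩ := C.P3 hn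
  have : ∀ (n : ℕ), n ≠ 0 → ¬ p ∣ n → (n : ℚ) • z ∈ C.Λ → z ∈ C.Λ := by
    intro n
    induction n using Nat.strong_induction_on with
    | _ n ih =>
      intro hn0 hpn hnz
      by_cases h1 : n = 1
      · subst h1; simpa using hnz
      · obtain ⟨ℓ, hℓ, m, rfl⟩ := Nat.exists_prime_and_dvd h1
        haveI : Fact ℓ.Prime := ⟨hℓ⟩
        have hl0 : (ℓ : ℚ) ≠ 0 := by exact_mod_cast hℓ.ne_zero
        have hlp : ℓ ≠ p := by rintro rfl; exact hpn (dvd_mul_right _ _)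
        have hm0 : m ≠ 0 := by rintro rfl; simp at hn0
        refine ih m ?_ hm0 (fun h => hpn (dvd_mul_of_dvd_right h _)) ?_
        · have := hℓ.two_le; nlinarith [Nat.pos_of_ne_zero hm0]
        · have := C.L1 hlp hnz (by
            intro y hy
            rw [smul_mul_assoc, map_smul, smul_eq_mul]
            push_cast
            rw [← mul_assoc, ← mul_assoc, inv_mul_cancel₀ hl0, one_mul]
            exact (IsZ.int (m:ℤ)).mul (h y hy))
          push_cast at this
          rwa [smul_smul, ← mul_assoc, inv_mul_cancel₀ hl0, one_mul] at this
  apply this c.natAbs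
  · rintro h0; rw [Int.natAbs_eq_zero] at h0; rw [h0] at hc; simp at hc
  · intro h; exact hc (Int.natCast_dvd.2 h)
  · rcases Int.natAbs_eq c with h | h
    · have e : ((c.natAbs : ℕ) : ℚ) = (c : ℚ) := by conv_rhs => rw [h]
                                                    rfl
      rw [e]; exact hcz
    · have e : ((c.natAbs : ℕ) : ℚ) = -(c : ℚ) := by
        conv_rhs => rw [h]
        push_cast; simp
      rw [e, neg_smul]; exact C.Λ.neg_mem hcz

theorem Ctx.finrank_four (C : Ctx p A) : Module.finrank ℚ A = 4 := by
  rw [C.e.toLinearEquiv.finrank_eq, QuaternionAlgebra.finrank_eq_four]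

/-- a spanning independent tuple -/
def IsB (I : AddSubgroup A) (e : Fin 4 → A) : Prop :=
  LinearIndependent ℚ e ∧ (∀ i, e i ∈ I) ∧ ∀ x ∈ I, ∃ c : Fin 4 → ℤ, x = ∑ i, (c i : ℚ) • e i

theorem Ctx.exists_basis (I : AddSubgroup A) (hI : I ≤ C.Λ.toAddSubgroup)
    (hm : ∃ m : ℤ, m ≠ 0 ∧ ∀ x ∈ C.Λ, (m:ℚ) • x ∈ I) : ∃ e : Fin 4 → A, IsB I e := by
  let M : Submodule ℤ A := AddSubgroup.toIntSubmodule I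
  haveI : Module.Finite ℚ A := Module.finite_of_finrank_pos (by rw [C.finrank_four]; norm_num)
  haveI : M.IsLattice ℚ := by
    constructor
    · have h1 : Module.Finite ℤ C.Λ.toAddSubgroup :=
        Module.Finite.iff_addGroup_fg.2 (AddGroup.fg_iff_addSubgroup_fg _ |>.2 C.fg)
      have h2 : Module.Finite ℤ (AddSubgroup.toIntSubmodule C.Λ.toAddSubgroup) := h1
      haveI : IsNoetherian ℤ (AddSubgroup.toIntSubmodule C.Λ.toAddSubgroup) := isNoetherian_of_isNoetherianRing_of_finite ℤ _
      have hle : M ≤ AddSubgroup.toIntSubmodule C.Λ.toAddSubgroup := hI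
      haveI : IsNoetherian ℤ M := isNoetherian_of_le hle
      exact (Module.Finite.iff_fg).1 inferInstance
    · obtain ⟨m, hm, hmx⟩ := hm
      rw [eq_top_iff, ← C.span, Submodule.span_le]
      intro x hx
      have : x = (m:ℚ)⁻¹ • ((m:ℚ) • x) := by
        rw [smul_smul, inv_mul_cancel₀ (by exact_mod_cast hm), one_smul]
      rw [this]
      exact Submodule.smul_mem _ _ (Submodule.subset_span (hmx x hx))
  haveI : Module.Free ℤ M := Submodule.IsLattice.free ℚ M
  let b0 := Module.finBasisOfFinrankEq ℤ M (n := 4)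
    (by rw [← C.finrank_four]; exact congrArg Cardinal.toNat (Submodule.IsLattice.rank' ℚ M))
  refine ⟨fun i => (b0 i).val, ?_, fun i => (b0 i).2, ?_⟩
  · have := (b0.extendOfIsLattice ℚ).linearIndependent
    have hfun : (fun i => (b0 i).val) = ⇑(b0.extendOfIsLattice ℚ) :=
      funext fun i => (Module.Basis.extendOfIsLattice_apply ..).symm
    rw [hfun]; exact this
  · intro x hx
    refine ⟨fun i => b0.repr ⟨x, hx⟩ i, ?_⟩
    have := congrArg Subtype.val (b0.sum_repr ⟨x, hx⟩)
    simp only [Submodule.coe_sum, Submodule.coe_smul] at this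
    conv_lhs => rw [← this]
    apply Finset.sum_congr rfl
    intro k _
    rw [Int.cast_smul_eq_zsmul]

open MvPolynomial in
theorem chev3 {p : ℕ} (hp : p.Prime) (q1 q2 q3 b12 b13 b23 : ℤ) : ∃ c1 c2 c3 : ℤ,
    (¬ (p:ℤ) ∣ c1 ∨ ¬ (p:ℤ) ∣ c2 ∨ ¬ (p:ℤ) ∣ c3) ∧
    (p:ℤ) ∣ q1 * c1 ^ 2 + q2 * c2 ^ 2 + q3 * c3 ^ 2 + b12 * c1 * c2 + b13 * c1 * c3 + b23 * c2 * c3 := by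
  haveI : Fact p.Prime := ⟨hp⟩
  let f : MvPolynomial (Fin 3) (ZMod p) := C (q1 : ZMod p) * (X 0 * X 0) + C (q2 : ZMod p) * (X 1 * X 1)
    + C (q3 : ZMod p) * (X 2 * X 2) + C (b12 : ZMod p) * (X 0 * X 1)
    + C (b13 : ZMod p) * (X 0 * X 2) + C (b23 : ZMod p) * (X 1 * X 2)
  have hm : ∀ (c : ZMod p) (i j : Fin 3), (C c * (X i * X j) : MvPolynomial (Fin 3) (ZMod p)).totalDegree ≤ 2 := by
    intro c i j
    refine (totalDegree_mul _ _).trans ?_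
    rw [totalDegree_C, zero_add]
    refine (totalDegree_mul _ _).trans ?_
    rw [totalDegree_X, totalDegree_X]
  have hadd : ∀ g h : MvPolynomial (Fin 3) (ZMod p), g.totalDegree ≤ 2 → h.totalDegree ≤ 2 → (g + h).totalDegree ≤ 2 :=
    fun g h hg hh => (totalDegree_add _ _).trans (max_le hg hh)
  have hdeg : f.totalDegree < Fintype.card (Fin 3) := by
    have : f.totalDegree ≤ 2 :=
      hadd _ _ (hadd _ _ (hadd _ _ (hadd _ _ (hadd _ _ (hm _ _ _) (hm _ _ _)) (hm _ _ _)) (hm _ _ _)) (hm _ _ _)) (hm _ _ _)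
    simp; omega
  have hcard := char_dvd_card_solutions (p := p) hdeg
  have hex : ∃ x : Fin 3 → ZMod p, x ≠ 0 ∧ eval x f = 0 := by
    by_contra hcon
    push Not at hcon
    have h1 : Fintype.card { x : Fin 3 → ZMod p // eval x f = 0 } = 1 := by
      rw [Fintype.card_eq_one_iff]
      refine ⟨⟨0, by simp [f]⟩, ?_⟩
      rintro ⟨y, hy⟩
      by_contra hne
      exact hcon y (fun h => hne (Subtype.ext h)) hy
    rw [h1] at hcard
    exact hp.one_lt.ne' (Nat.dvd_one.1 hcard)
  obtain ⟨x, hx, hf⟩ := hex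
  have hz : ∀ i, (((x i).val : ℤ) : ZMod p) = x i := by intro i; simp
  have hd : ∀ i, (p:ℤ) ∣ ((x i).val : ℤ) ↔ x i = 0 := by
    intro i; rw [← ZMod.intCast_zmod_eq_zero_iff_dvd, hz]
  refine ⟨(x 0).val, (x 1).val, (x 2).val, ?_, ?_⟩
  · rw [hd, hd, hd]
    by_contra hcon
    push Not at hcon
    apply hx
    funext i
    fin_cases i
    · exact hcon.1
    · exact hcon.2.1
    · exact hcon.2.2
  · rw [← ZMod.intCast_zmod_eq_zero_iff_dvd]
    push_cast
    simp [f] at hf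
    simp only [ZMod.natCast_val, ZMod.cast_id', id_eq]
    linear_combination hf

/-- three combination -/
theorem Ctx.q3 (x y z : A) (c1 c2 c3 : ℚ) : C.nm (c1 • x + c2 • y + c3 • z) =
    C.nm x * c1 ^ 2 + C.nm y * c2 ^ 2 + C.nm z * c3 ^ 2 + C.tr (C.cj x * y) * c1 * c2
    + C.tr (C.cj x * z) * c1 * c3 + C.tr (C.cj y * z) * c2 * c3 := by
  rw [C.nm_add, C.nm_add]
  simp only [C.nm_smul, C.cj_add, C.cj_smul, add_mul, map_add, smul_mul_assoc, mul_smul_comm, map_smul, smul_eq_mul]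
  ring

theorem Ctx.odd_trace [Fact p.Prime] : ∃ x ∈ C.Λ, ∃ t : ℤ, (t : ℚ) = C.tr x ∧ ¬ (p:ℤ) ∣ t := by
  by_cases hp2 : p = 2
  swap
  · refine ⟨1, C.Λ.one_mem, 2, by rw [C.tr_one]; norm_num, ?_⟩
    intro h
    have h1 : p ∣ 2 := by exact_mod_cast h
    exact hp2 ((Nat.prime_dvd_prime_iff_eq Fact.out Nat.prime_two).1 h1)
  by_contra hcon
  push Not at hcon
  have hev : ∀ x ∈ C.Λ, ∃ t : ℤ, (2 * t : ℚ) = C.tr x := by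
    intro x hx
    obtain ⟨t, ht⟩ := (C.F1 hx).1
    obtain ⟨s, rfl⟩ := hcon x hx t ht
    exact ⟨s, by rw [← ht, hp2]; push_cast; rfl⟩
  obtain ⟨e, hli, heI, hsp⟩ := C.exists_basis C.Λ.toAddSubgroup le_rfl ⟨1, one_ne_zero, by
    intro x hx; simpa using hx⟩
  have heI : ∀ i, e i ∈ C.Λ := heI
  -- three vectors with even norm
  have hW : ∃ (w : Fin 3 → A) (s : Fin 3 → Fin 4), (∀ i, w i ∈ C.Λ) ∧ (∀ i, ∃ n : ℤ, (2 * n : ℚ) = C.nm (w i)) ∧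
      (∀ c : Fin 3 → ℚ, (∃ d : Fin 4 → ℤ, ∑ i, c i • w i = (2:ℚ) • ∑ i, (d i : ℚ) • e i) →
        ∀ i, ∃ m : ℤ, (2 * m : ℚ) = c i) := by
    have hgen : ∀ (k : Fin 4) (n : Fin 3 → ℤ), (∀ c : Fin 3 → ℚ,
        (∃ d : Fin 4 → ℤ, ∑ i, c i • (e (k.succAbove i) + (n i : ℚ) • e k) = (2:ℚ) • ∑ i, (d i : ℚ) • e i) →
        ∀ i, ∃ m : ℤ, (2 * m : ℚ) = c i) := by
      rintro k n c ⟨d, hd⟩ i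
      rw [Fin.sum_univ_succAbove _ k] at hd
      simp only [smul_add, Finset.sum_add_distrib, Finset.smul_sum, smul_smul] at hd
      rw [← Finset.sum_smul] at hd
      have h0 : ∑ j, (Fin.insertNth (α := fun _ => ℚ) k ((∑ x, c x * n x) - 2 * d k) (fun i => c i - 2 * d (k.succAbove i)) j) • e j = 0 := by
        rw [Fin.sum_univ_succAbove _ k]
        simp only [Fin.insertNth_apply_same, Fin.insertNth_apply_succAbove, sub_smul, Finset.sum_sub_distrib]
        rw [add_comm, ← sub_eq_zero] at hd
        rw [← hd]; abel
      have := Fintype.linearIndependent_iff.1 hli _ h0 (k.succAbove i)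
      simp only [Fin.insertNth_apply_succAbove] at this
      exact ⟨d (k.succAbove i), by linarith⟩
    have hpar : ∀ x ∈ C.Λ, (∃ n : ℤ, (2 * n : ℚ) = C.nm x) ∨ (∃ n : ℤ, (2 * n + 1 : ℚ) = C.nm x) := by
      intro x hx
      obtain ⟨n, hn⟩ := (C.F1 hx).2
      rcases Int.even_or_odd' n with ⟨m, h | h⟩
      · left; exact ⟨m, by rw [← hn, h]; push_cast; rfl⟩
      · right; exact ⟨m, by rw [← hn, h]; push_cast; rfl⟩
    by_cases hall : ∀ i, ∃ n : ℤ, (2 * n : ℚ) = C.nm (e i)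
    · refine ⟨fun i => e ((0 : Fin 4).succAbove i) + ((0:ℤ) : ℚ) • e 0, fun i => i.succ, ?_, ?_, hgen 0 (fun _ => 0)⟩
      · intro i; simpa using heI _
      · intro i; simpa using hall _
    · push Not at hall
      obtain ⟨k, hk⟩ := hall
      obtain ⟨nk, hnk⟩ := (hpar (e k) (heI k)).resolve_left (fun ⟨n, hn⟩ => hk n hn)
      have : ∀ i : Fin 3, ∃ n : ℤ, ∃ m : ℤ, (2 * m : ℚ) = C.nm (e (k.succAbove i) + (n : ℚ) • e k) := by
        intro i
        rcases hpar _ (heI (k.succAbove i)) with ⟨n, hn⟩ | ⟨n, hn⟩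
        · exact ⟨0, n, by simpa using hn⟩
        · obtain ⟨t, ht⟩ := hev _ (C.Λ.mul_mem (C.cj_mem (heI (k.succAbove i))) (heI k))
          refine ⟨1, n + nk + 1 + t, ?_⟩
          rw [Int.cast_one, one_smul, C.nm_add, ← hn, ← hnk, ← ht]
          push_cast; ring
      choose n hn using this
      refine ⟨fun i => e (k.succAbove i) + (n i : ℚ) • e k, fun i => i.succ, ?_, hn, hgen k n⟩
      intro i; exact C.Λ.add_mem (heI _) (C.int_smul_mem (heI _) _)
  obtain ⟨w, -, hw, hwn, hwi⟩ := hW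
  choose n hn using hwn
  obtain ⟨t12, ht12⟩ := hev _ (C.Λ.mul_mem (C.cj_mem (hw 0)) (hw 1))
  obtain ⟨t13, ht13⟩ := hev _ (C.Λ.mul_mem (C.cj_mem (hw 0)) (hw 2))
  obtain ⟨t23, ht23⟩ := hev _ (C.Λ.mul_mem (C.cj_mem (hw 1)) (hw 2))
  obtain ⟨c1, c2, c3, hc, m, hm⟩ := chev3 Nat.prime_two (n 0) (n 1) (n 2) t12 t13 t23
  have hv : (c1:ℚ) • w 0 + (c2:ℚ) • w 1 + (c3:ℚ) • w 2 ∈ C.Λ :=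
    C.Λ.add_mem (C.Λ.add_mem (C.int_smul_mem (hw _) _) (C.int_smul_mem (hw _) _)) (C.int_smul_mem (hw _) _)
  have := C.P5 hv (4 * m) (by
    rw [C.q3, ← hn, ← hn, ← hn, ← ht12, ← ht13, ← ht23]
    have : ((n 0 * c1 ^ 2 + n 1 * c2 ^ 2 + n 2 * c3 ^ 2 + t12 * c1 * c2 + t13 * c1 * c3 + t23 * c2 * c3 : ℤ) : ℚ) = ((2:ℕ) * m : ℤ) := by
      rw [hm]
    push_cast at this ⊢
    linear_combination (-2) * this) (by rw [hp2]; exact ⟨m, by norm_num⟩)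
  obtain ⟨d, hd⟩ := hsp _ this
  have key := hwi ![(c1:ℚ), c2, c3] ⟨d, by
    rw [← hd, smul_smul, hp2]
    simp [Fin.sum_univ_three]⟩
  have k0 := key 0
  have k1 := key 1
  have k2 := key 2
  simp only [Matrix.cons_val_zero, Matrix.cons_val_one, Matrix.cons_val] at k0 k1 k2
  obtain ⟨m0, k0⟩ := k0
  obtain ⟨m1, k1⟩ := k1
  obtain ⟨m2, k2⟩ := k2
  rcases hc with h | h | h
  · exact h ⟨m0, by exact_mod_cast k0.symm⟩
  · exact h ⟨m1, by exact_mod_cast k1.symm⟩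
  · exact h ⟨m2, by exact_mod_cast k2.symm⟩

theorem Ctx.DUAL [Fact p.Prime] {z : A} (h : ∀ y ∈ C.Λ, IsZ (C.tr (z * y))) : PI p (p * C.nm z) := by
  by_contra hcon
  obtain ⟨x, hx, t, ht, htp⟩ := C.odd_trace
  have hp0 : (p : ℚ) ≠ 0 := by exact_mod_cast (Fact.out : p.Prime).ne_zero
  have hz : z ≠ 0 := by
    rintro rfl; apply hcon; rw [C.nm_zero, mul_zero]; exact IsZ.zero.pi
  have hnz := (C.nm_pos hz).ne'
  have hn : PI p (C.nm ((p:ℚ)⁻¹ • (C.iv z * x))) := by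
    rw [C.nm_smul, C.nm_mul, C.nm_iv]
    rw [← mul_assoc]
    apply PI.mul _ (C.F1 hx).2.pi
    unfold PI at hcon ⊢
    push Not at hcon
    have h1 : (p:ℝ) ≤ ‖((p * C.nm z : ℚ) : ℚ_[p])‖ := by
      have := Padic.norm_le_pow_iff_norm_lt_pow_add_one (p := p) ((p * C.nm z : ℚ) : ℚ_[p]) 0
      simp only [zpow_zero, zero_add, zpow_one] at this
      by_contra h2
      push Not at h2
      exact absurd (this.2 h2) (not_le.2 hcon)
    push_cast at h1 ⊢
    rw [norm_mul, Padic.norm_p] at h1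
    rw [norm_mul, norm_pow, norm_inv, norm_inv, Padic.norm_p, inv_inv]
    have hpp : (0:ℝ) < p := by exact_mod_cast (Fact.out : p.Prime).pos
    have hnzp : 0 < ‖(C.nm z : ℚ_[p])‖ := by
      rw [norm_pos_iff]; exact_mod_cast hnz
    rw [← div_eq_mul_inv, div_le_one hnzp]
    have : (p:ℝ) * p ≤ p * ((p:ℝ)⁻¹ * ‖(C.nm z : ℚ_[p])‖) := mul_le_mul_of_nonneg_left h1 hpp.le
    rw [← mul_assoc, mul_inv_cancel₀ hpp.ne', one_mul] at this
    rw [pow_two]; exact this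
  obtain ⟨c, hc, hcm⟩ := C.P3 hn
  obtain ⟨m, hm⟩ := h _ hcm
  rw [mul_smul_comm, mul_smul_comm, ← mul_assoc, C.mul_iv hz, one_mul, map_smul, map_smul, smul_eq_mul,
    smul_eq_mul, ← ht] at hm
  have : (p:ℤ) ∣ c * t := ⟨m, by
    have : (c * t : ℚ) = p * m := by rw [hm]; field_simp
    exact_mod_cast this⟩
  rcases (Nat.prime_iff_prime_int.1 (Fact.out : p.Prime)).dvd_or_dvd this with h | h
  · exact hc h
  · exact htp h

end
end CQ

namespace CQ

section
variable {p : ℕ} {A : Type*} [Ring A] [Algebra ℚ A]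

/-- a normalised right ideal -/
structure Lat (C : Ctx p A) where
  I : AddSubgroup A
  le : I ≤ C.Λ.toAddSubgroup
  right : ∀ x ∈ I, ∀ a ∈ C.Λ, x * a ∈ I
  N : ℚ
  hN : 0 < N
  int : ∀ y ∈ I, IsZ (C.nm y / N)
  prim : ∀ ℓ : ℕ, ℓ.Prime → ∃ x ∈ I, ∃ m : ℤ, (m:ℚ) = C.nm x / N ∧ ¬ (ℓ:ℤ) ∣ m

theorem zsm {I : AddSubgroup A} {x : A} (hx : x ∈ I) (m : ℤ) : (m:ℚ) • x ∈ I := by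
  rw [Int.cast_smul_eq_zsmul]; exact I.zsmul_mem hx m

theorem glue (I : AddSubgroup A) (z : A)
    (h : ∀ ℓ : ℕ, ℓ.Prime → ∃ m : ℤ, ¬ (ℓ:ℤ) ∣ m ∧ (m:ℚ) • z ∈ I) : z ∈ I := by
  let J : Ideal ℤ :=
    { carrier := {m | (m:ℚ) • z ∈ I}
      add_mem' := by
        intro a b ha hb
        simp only [Set.mem_setOf_eq] at *
        push_cast; rw [add_smul]; exact I.add_mem ha hb
      zero_mem' := by simp
      smul_mem' := by
        intro c a ha
        simp only [Set.mem_setOf_eq, smul_eq_mul] at *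
        push_cast; rw [mul_smul]; exact zsm ha c }
  have hJ : J = ⊤ := by
    obtain ⟨g, hg⟩ := (IsPrincipalIdealRing.principal J).principal
    by_contra hne
    have hu : ¬ IsUnit g := by
      intro hu; apply hne; rw [hg]; exact Ideal.span_singleton_eq_top.2 hu
    have : g.natAbs ≠ 1 := fun h => hu (Int.isUnit_iff_natAbs_eq.2 h)
    obtain ⟨ℓ, hl, hd⟩ := Nat.exists_prime_and_dvd this
    obtain ⟨m, hm, hmz⟩ := h ℓ hl
    have : m ∈ J := hmz
    rw [hg] at this
    have h1 : g ∣ m := Ideal.mem_span_singleton.1 this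
    exact hm ((Int.natCast_dvd.2 hd).trans h1)
  have : (1:ℤ) ∈ J := by rw [hJ]; trivial
  have : ((1:ℤ):ℚ) • z ∈ I := this
  simpa using this

variable {C : Ctx p A} (L : Lat C)

def Lat.q (x : A) : ℚ := C.nm x / L.N

def Lat.b : LinearMap.BilinForm ℚ A :=
  LinearMap.mk₂ ℚ (fun x y => C.tr (C.cj x * y) / L.N)
    (by intro x y z; rw [C.cj_add, add_mul, map_add, add_div])
    (by intro c x y; rw [C.cj_smul, smul_mul_assoc, map_smul, smul_eq_mul, smul_eq_mul, mul_div_assoc])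
    (by intro x y z; rw [mul_add, map_add, add_div])
    (by intro c x y; rw [mul_smul_comm, map_smul, smul_eq_mul, smul_eq_mul, mul_div_assoc])

theorem Lat.b_def (x y : A) : L.b x y = C.tr (C.cj x * y) / L.N := rfl

theorem Lat.b_symm (x y : A) : L.b x y = L.b y x := by
  rw [L.b_def, L.b_def, ← C.tr_cj, C.cj_mul, C.cj_cj]

theorem Lat.b_self (x : A) : L.b x x = 2 * L.q x := by
  rw [L.b_def, C.cj_mul_self, C.tr_smul_one]; unfold Lat.q; ring

theorem Lat.q_add (x y : A) : L.q (x + y) = L.q x + L.q y + L.b x y := by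
  unfold Lat.q; rw [C.nm_add, L.b_def]; ring

theorem Lat.q_pos {x : A} (h : x ≠ 0) : 0 < L.q x := div_pos (C.nm_pos h) L.hN

theorem Lat.q_int {x : A} (h : x ∈ L.I) : IsZ (L.q x) := L.int x h

theorem Lat.b_int {x y : A} (hx : x ∈ L.I) (hy : y ∈ L.I) : IsZ (L.b x y) := by
  have := ((L.q_int (L.I.add_mem hx hy)).sub (L.q_int hx)).sub (L.q_int hy)
  rw [L.q_add] at this
  convert this using 1; ring

variable [Fact p.Prime]

theorem Lat.V {x y : A} (hx : x ∈ L.I) (hy : y ∈ L.I) : L.N⁻¹ • (C.cj x * y) ∈ C.Λ := by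
  apply C.MEM
  · intro w hw
    have := L.b_int hx (L.right y hy w hw)
    rw [L.b_def] at this
    rw [smul_mul_assoc, map_smul, smul_eq_mul, mul_assoc]
    convert this using 1; ring
  · have : C.nm (L.N⁻¹ • (C.cj x * y)) = L.q x * L.q y := by
      rw [C.nm_smul, C.nm_mul, C.nm_cj]; unfold Lat.q; ring
    rw [this]; exact ((L.q_int hx).mul (L.q_int hy)).pi

theorem Lat.nmV (x y : A) : C.nm (L.N⁻¹ • (C.cj x * y)) = L.q x * L.q y := by
  rw [C.nm_smul, C.nm_mul, C.nm_cj]; unfold Lat.q; ring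

theorem Lat.trV (x y : A) : C.tr (L.N⁻¹ • (C.cj x * y)) = L.b x y := by
  rw [map_smul, L.b_def, smul_eq_mul]; ring

theorem Lat.mulV (x y : A) : x * (L.N⁻¹ • (C.cj x * y)) = L.q x • y := by
  rw [mul_smul_comm, ← mul_assoc, C.mul_cj, smul_mul_assoc, one_mul, smul_smul]; unfold Lat.q
  congr 1; ring

theorem Lat.glue' {z : A} (h : ∀ x ∈ L.I, L.q x • z ∈ L.I) : z ∈ L.I := by
  apply glue
  intro ℓ hl
  obtain ⟨x, hx, m, hm, hd⟩ := L.prim ℓ hl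
  exact ⟨m, hd, by rw [hm]; exact h x hx⟩

theorem Lat.dual_pi {x z : A} (hz : ∀ y ∈ L.I, IsZ (L.b z y)) (hx : x ∈ L.I) :
    PI p (p * (L.q z * L.q x)) := by
  rw [← L.nmV]
  apply C.DUAL
  intro w hw
  have := hz _ (L.right x hx w hw)
  rw [L.b_def] at this
  rw [smul_mul_assoc, map_smul, smul_eq_mul, mul_assoc]
  convert this using 1; ring

theorem Lat.i {z : A} (hz : ∀ y ∈ L.I, IsZ (L.b z y)) : (p:ℚ) • z ∈ L.I := by
  apply L.glue'
  intro x hx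
  have h1 : (p:ℚ) • (L.N⁻¹ • (C.cj z * x)) ∈ C.Λ := by
    apply C.MEM
    · intro w hw
      have := (IsZ.int (p:ℤ)).mul (hz _ (L.right x hx w hw))
      rw [L.b_def] at this
      rw [smul_mul_assoc, smul_mul_assoc, map_smul, map_smul, smul_eq_mul, smul_eq_mul, mul_assoc]
      convert this using 1; push_cast; ring
    · rw [C.nm_smul, L.nmV, pow_two, mul_assoc]
      exact (IsZ.int (p:ℤ)).pi.mul (L.dual_pi hz hx)
  have h2 := C.cj_mem h1
  rw [C.cj_smul, C.cj_smul, C.cj_mul, C.cj_cj] at h2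
  have h3 := L.right x hx _ h2
  rw [mul_smul_comm, L.mulV] at h3
  rwa [smul_comm]

theorem Lat.ii {x y : A} (hx : x ∈ L.I) (hy : y ∈ L.I) (n t : ℤ) (hn : (n:ℚ) = L.q x)
    (ht : (t:ℚ) = L.b x y) (h : (p:ℤ) ∣ n) : (p:ℤ) ∣ t := by
  obtain ⟨m, hm⟩ := L.q_int hy
  apply C.P4' (z := L.N⁻¹ • (C.cj x * y)) t (n * m)
  · rw [L.trV, ht]
  · rw [L.nmV]; push_cast; rw [hn, hm]
  · exact dvd_mul_of_dvd_left h _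

theorem Lat.iii {x : A} (hx : x ∈ L.I) (n : ℤ) (hn : (n:ℚ) = L.q x) (h : (p:ℤ) ^ 2 ∣ n) :
    (p:ℚ)⁻¹ • x ∈ L.I := by
  apply L.glue'
  intro y hy
  obtain ⟨m, hm⟩ := L.q_int hy
  have h1 := C.P5 (L.V hy hx) (m * n) (by rw [L.nmV]; push_cast; rw [hn, hm]) (dvd_mul_of_dvd_right h _)
  have h3 := L.right y hy _ h1
  rw [mul_smul_comm, L.mulV] at h3
  rwa [smul_comm]

theorem PI.dvd {n : ℤ} {r : ℚ} (hr : PI p r) (h : (n:ℚ) = p * r) : (p:ℤ) ∣ n := by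
  rw [← Padic.norm_intCast_lt_one_iff (p := p)]
  have : ((n:ℚ) : ℚ_[p]) = ((p * r : ℚ) : ℚ_[p]) := by rw [h]
  rw [Rat.cast_intCast] at this
  rw [this]
  push_cast
  rw [norm_mul]
  have h1 : ‖(p:ℚ_[p])‖ < 1 := Padic.norm_p_lt_one
  have h2 : ‖(r:ℚ_[p])‖ ≤ 1 := hr
  have := mul_le_mul_of_nonneg_left h2 (norm_nonneg (p:ℚ_[p]))
  linarith

theorem Lat.iv {z : A} (hz : ∀ y ∈ L.I, IsZ (L.b z y)) (n : ℤ) (hn : (n:ℚ) = L.q ((p:ℚ) • z)) :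
    (p:ℤ) ∣ n := by
  obtain ⟨x, hx, m, hm, hd⟩ := L.prim p Fact.out
  have := L.dual_pi hz hx
  have h2 : (p:ℤ) ∣ n * m := by
    apply PI.dvd this
    push_cast
    rw [hn, hm]
    unfold Lat.q
    rw [C.nm_smul]; ring
  exact ((Nat.prime_iff_prime_int.1 (Fact.out : p.Prime)).dvd_or_dvd h2).resolve_right hd

/-- Key: a minimal vector generates. -/
theorem Lat.gen {x : A} (hx : x ∈ L.I) (h : L.q x = 1) (y : A) : y ∈ L.I ↔ ∃ a ∈ C.Λ, y = x * a := by
  constructor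
  · intro hy
    exact ⟨_, L.V hx hy, by rw [L.mulV, h, one_smul]⟩
  · rintro ⟨a, ha, rfl⟩; exact L.right x hx a ha

theorem Lat.full : ∃ m : ℤ, m ≠ 0 ∧ ∀ x ∈ C.Λ, (m:ℚ) • x ∈ L.I := by
  obtain ⟨x, hx, m, hm, hd⟩ := L.prim 2 Nat.prime_two
  have hx0 : x ≠ 0 := by
    rintro rfl
    rw [C.nm_zero, zero_div] at hm
    have : m = 0 := by exact_mod_cast hm
    rw [this] at hd; simp at hd
  obtain ⟨k, hk⟩ := (C.F1 (L.le hx)).2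
  refine ⟨k, ?_, ?_⟩
  · rintro rfl
    have := C.nm_pos hx0
    rw [← hk] at this; simp at this
  · intro a ha
    have := L.right x hx _ (C.Λ.mul_mem (C.cj_mem (L.le hx)) ha)
    rwa [← mul_assoc, C.mul_cj, smul_mul_assoc, one_mul, ← hk] at this

theorem Lat.exists_basis : ∃ e : Fin 4 → A, IsB L.I e := C.exists_basis L.I L.le L.full

def Lat.d3 (x y z : A) : ℚ := L.b x x * L.b y y * L.b z z + 2 * L.b x y * L.b y z * L.b x z
  - L.b x x * L.b y z ^ 2 - L.b y y * L.b x z ^ 2 - L.b z z * L.b x y ^ 2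

theorem Lat.q3 (x y z : A) (c1 c2 c3 : ℚ) : L.q (c1 • x + c2 • y + c3 • z) =
    L.q x * c1 ^ 2 + L.q y * c2 ^ 2 + L.q z * c3 ^ 2 + L.b x y * c1 * c2
    + L.b x z * c1 * c3 + L.b y z * c2 * c3 := by
  unfold Lat.q; rw [C.q3, L.b_def, L.b_def, L.b_def]; ring

theorem Lat.det3 {x y z : A} (hx : x ∈ L.I) (hy : y ∈ L.I) (hz : z ∈ L.I) :
    ∃ m : ℤ, L.d3 x y z = p * m := by
  obtain ⟨q1, h1⟩ := L.q_int hx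
  obtain ⟨q2, h2⟩ := L.q_int hy
  obtain ⟨q3, h3⟩ := L.q_int hz
  obtain ⟨b12, h12⟩ := L.b_int hx hy
  obtain ⟨b13, h13⟩ := L.b_int hx hz
  obtain ⟨b23, h23⟩ := L.b_int hy hz
  obtain ⟨c1, c2, c3, hc, hd⟩ := chev3 (Fact.out : p.Prime) q1 q2 q3 b12 b13 b23
  have hv : (c1:ℚ) • x + (c2:ℚ) • y + (c3:ℚ) • z ∈ L.I :=
    L.I.add_mem (L.I.add_mem (zsm hx _) (zsm hy _)) (zsm hz _)
  have hn := L.q3 x y z c1 c2 c3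
  rw [← h1, ← h2, ← h3, ← h12, ← h13, ← h23] at hn
  have A1 := L.ii hv hx _ (2 * q1 * c1 + b12 * c2 + b13 * c3) (by rw [hn]; push_cast; rfl) (by
    simp only [map_add, map_smul, LinearMap.add_apply, LinearMap.smul_apply, smul_eq_mul]
    rw [L.b_self, L.b_symm y x, L.b_symm z x, ← h1, ← h12, ← h13]; push_cast; ring) hd
  have A2 := L.ii hv hy _ (b12 * c1 + 2 * q2 * c2 + b23 * c3) (by rw [hn]; push_cast; rfl) (by
    simp only [map_add, map_smul, LinearMap.add_apply, LinearMap.smul_apply, smul_eq_mul]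
    rw [L.b_self, L.b_symm z y, ← h2, ← h12, ← h23]; push_cast; ring) hd
  have A3 := L.ii hv hz _ (b13 * c1 + b23 * c2 + 2 * q3 * c3) (by rw [hn]; push_cast; rfl) (by
    simp only [map_add, map_smul, LinearMap.add_apply, LinearMap.smul_apply, smul_eq_mul]
    rw [L.b_self, ← h3, ← h13, ← h23]; push_cast; ring) hd
  let D : ℤ := (2*q1)*(2*q2)*(2*q3) + 2*b12*b23*b13 - 2*q1*b23^2 - 2*q2*b13^2 - 2*q3*b12^2
  have hD : L.d3 x y z = D := by
    unfold Lat.d3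
    rw [L.b_self, L.b_self, L.b_self, ← h1, ← h2, ← h3, ← h12, ← h13, ← h23]; push_cast [D]; ring
  have hpp := Nat.prime_iff_prime_int.1 (Fact.out : p.Prime)
  have : (p:ℤ) ∣ D := by
    obtain ⟨a1, A1⟩ := A1
    obtain ⟨a2, A2⟩ := A2
    obtain ⟨a3, A3⟩ := A3
    rcases hc with h | h | h
    · refine (hpp.dvd_or_dvd (a := D) (b := c1) ⟨a1 * (4*q2*q3 - b23^2) - a2 * (2*b12*q3 - b13*b23) + a3 * (b12*b23 - 2*q2*b13), ?_⟩).resolve_right h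
      simp only [D]
      linear_combination (4*q2*q3 - b23^2) * A1 - (2*b12*q3 - b13*b23) * A2 + (b12*b23 - 2*q2*b13) * A3
    · refine (hpp.dvd_or_dvd (a := D) (b := c2) ⟨-a1 * (2*b12*q3 - b13*b23) + a2 * (4*q1*q3 - b13^2) - a3 * (2*q1*b23 - b12*b13), ?_⟩).resolve_right h
      simp only [D]
      linear_combination (-(2*b12*q3 - b13*b23)) * A1 + (4*q1*q3 - b13^2) * A2 - (2*q1*b23 - b12*b13) * A3
    · refine (hpp.dvd_or_dvd (a := D) (b := c3) ⟨a1 * (b12*b23 - 2*q2*b13) - a2 * (2*q1*b23 - b12*b13) + a3 * (4*q1*q2 - b12^2), ?_⟩).resolve_right h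
      simp only [D]
      linear_combination (b12*b23 - 2*q2*b13) * A1 - (2*q1*b23 - b12*b13) * A2 + (4*q1*q2 - b12^2) * A3
  obtain ⟨m, hm⟩ := this
  exact ⟨m, by rw [hD, hm]; push_cast; rfl⟩

theorem rank2 {p : ℕ} (hp : p.Prime) (H : Matrix (Fin 4) (Fin 4) ℤ) (c d : Fin 4 → ℤ) (a b : Fin 4)
    (ha : ¬ (p:ℤ) ∣ c a) (hb : ¬ (p:ℤ) ∣ d b) (hda : d a = 0)
    (hc : ∀ j, (p:ℤ) ∣ ∑ i, c i * H i j) (hd : ∀ j, (p:ℤ) ∣ ∑ i, d i * H i j) :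
    (p:ℤ) ^ 2 ∣ H.det := by
  have hpp := Nat.prime_iff_prime_int.1 hp
  choose w hw using hc
  choose w' hw' using hd
  have e1 : ∑ k, c k • H k = (p:ℤ) • w := by
    funext j; simp [Finset.sum_apply, hw]
  have e2 : ∑ k, d k • (H.updateRow a w) k = (p:ℤ) • w' := by
    have : ∑ k, d k • (H.updateRow a w) k = ∑ k, d k • H k := by
      apply Finset.sum_congr rfl
      intro k _
      by_cases hk : k = a
      · subst hk; rw [hda, zero_smul, zero_smul]
      · rw [Matrix.updateRow_ne hk]
    rw [this]
    funext j; simp [Finset.sum_apply, hw']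
  have f1 := Matrix.det_updateRow_sum H a c
  have f2 := Matrix.det_updateRow_sum (H.updateRow a w) b d
  rw [e1, Matrix.det_updateRow_smul, smul_eq_mul] at f1
  rw [e2, Matrix.det_updateRow_smul, smul_eq_mul] at f2
  have g2 : (p:ℤ) ∣ (H.updateRow a w).det :=
    (hpp.dvd_or_dvd ⟨_, f2.symm⟩).resolve_left hb
  obtain ⟨k, hk⟩ := g2
  rw [hk] at f1
  have : (p:ℤ)^2 ∣ c a * H.det := ⟨k, by rw [← f1]; ring⟩
  exact hpp.pow_dvd_of_dvd_mul_left 2 ha this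

theorem Lat.det4 {e : Fin 4 → A} (he : IsB L.I e) :
    (Matrix.of fun i j => L.b (e i) (e j)).det ≠ 0 ∧
    |(Matrix.of fun i j => L.b (e i) (e j)).det| ≤ (p:ℚ) ^ 2 := by
  obtain ⟨hli, heI, hsp⟩ := he
  have hp0 : (p : ℚ) ≠ 0 := by exact_mod_cast (Fact.out : p.Prime).ne_zero
  let bs : Module.Basis (Fin 4) ℚ A := basisOfLinearIndependentOfCardEqFinrank hli (by rw [C.finrank_four]; simp)
  have hbs : ∀ i, bs i = e i := by intro i; simp [bs]
  have hnd0 : ∀ x, L.b x x = 0 → x = 0 := by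
    intro x hx
    by_contra h
    have := L.q_pos h
    rw [L.b_self] at hx; linarith
  have hnd : L.b.Nondegenerate := ⟨fun x hx => hnd0 x (hx x), fun x hx => hnd0 x (hx x)⟩
  let f := L.b.dualBasis hnd bs
  have hf : ∀ i j, L.b (f i) (e j) = if j = i then 1 else 0 := by
    intro i j; rw [← hbs]; exact L.b.apply_dualBasis_left hnd bs i j
  have hfd : ∀ i, ∀ y ∈ L.I, IsZ (L.b (f i) y) := by
    intro i y hy
    obtain ⟨c, rfl⟩ := hsp y hy
    rw [map_sum]
    simp only [map_smul, hf, smul_eq_mul, mul_ite, mul_one, mul_zero]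
    rw [Finset.sum_ite_eq']
    simp [IsZ.int]
  have hy : ∀ i, (p:ℚ) • f i ∈ L.I := fun i => L.i (hfd i)
  choose H hH using fun i => hsp _ (hy i)
  -- H G = p
  have hHG : ∀ i k, ∑ j, (H i j : ℚ) * L.b (e j) (e k) = if k = i then (p:ℚ) else 0 := by
    intro i k
    have h1 : L.b ((p:ℚ) • f i) (e k) = if k = i then (p:ℚ) else 0 := by
      rw [map_smul, LinearMap.smul_apply, hf]; simp
    rw [← h1, hH i]
    simp [map_sum, LinearMap.sum_apply]
  have hbf : ∀ i j, L.b ((p:ℚ) • f i) ((p:ℚ) • f j) = p * H j i := by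
    intro i j
    rw [hH j, map_sum]
    simp only [map_smul, LinearMap.smul_apply, hf, smul_eq_mul, mul_ite, mul_one, mul_zero]
    rw [Finset.sum_ite_eq']
    simp [mul_comm]
  have hHs : ∀ i j, H i j = H j i := by
    intro i j
    have h1 := hbf i j
    rw [L.b_symm, hbf] at h1
    have := mul_left_cancel₀ hp0 h1
    exact_mod_cast this
  have hcomb : ∀ k : Fin 4, ∃ c : Fin 4 → ℤ, c k = 0 ∧ (∃ a, ¬ (p:ℤ) ∣ c a) ∧
      ∀ j, (p:ℤ) ∣ ∑ i, c i * H i j := by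
    intro k
    have hq : ∀ i, ∃ n : ℤ, (p * n : ℚ) = L.q ((p:ℚ) • f i) := by
      intro i
      obtain ⟨n, hn⟩ := L.q_int (hy i)
      obtain ⟨m, rfl⟩ := L.iv (hfd i) n hn
      exact ⟨m, by rw [← hn]; push_cast; rfl⟩
    choose n hn using hq
    let s := k.succAbove
    obtain ⟨c1, c2, c3, hc, m, hm⟩ := chev3 (Fact.out : p.Prime) (n (s 0)) (n (s 1)) (n (s 2))
      (H (s 0) (s 1)) (H (s 0) (s 2)) (H (s 1) (s 2))
    have hv : (c1:ℚ) • (p:ℚ) • f (s 0) + (c2:ℚ) • (p:ℚ) • f (s 1) + (c3:ℚ) • (p:ℚ) • f (s 2) ∈ L.I :=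
      L.I.add_mem (L.I.add_mem (zsm (hy _) _) (zsm (hy _) _)) (zsm (hy _) _)
    have hqv := L.q3 ((p:ℚ) • f (s 0)) ((p:ℚ) • f (s 1)) ((p:ℚ) • f (s 2)) c1 c2 c3
    rw [hbf, hbf, hbf, ← hn, ← hn, ← hn, hHs (s 1) (s 0), hHs (s 2) (s 0), hHs (s 2) (s 1)] at hqv
    have hmq : ((n (s 0) * c1 ^ 2 + n (s 1) * c2 ^ 2 + n (s 2) * c3 ^ 2 + H (s 0) (s 1) * c1 * c2
      + H (s 0) (s 2) * c1 * c3 + H (s 1) (s 2) * c2 * c3 : ℤ) : ℚ) = ((p * m : ℤ):ℚ) := by rw [hm]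
    have hz := L.iii hv (p ^ 2 * m) (by rw [hqv]; push_cast at hmq ⊢; linear_combination (-p:ℚ) * hmq)
      (dvd_mul_right _ _)
    obtain ⟨w, hw⟩ := hsp _ hz
    let c : Fin 4 → ℤ := Fin.insertNth (α := fun _ => ℤ) k 0 ![c1, c2, c3]
    have hcs : ∀ i, c (s i) = ![c1, c2, c3] i := fun i => Fin.insertNth_apply_succAbove ..
    have hck : c k = 0 := Fin.insertNth_apply_same ..
    refine ⟨c, hck, ?_, ?_⟩
    · rcases hc with h | h | h
      · exact ⟨s 0, by rw [hcs]; exact h⟩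
      · exact ⟨s 1, by rw [hcs]; exact h⟩
      · exact ⟨s 2, by rw [hcs]; exact h⟩
    · intro j
      refine ⟨w j, ?_⟩
      have h1 : (p:ℚ) • ((p:ℚ)⁻¹ • ((c1:ℚ) • (p:ℚ) • f (s 0) + (c2:ℚ) • (p:ℚ) • f (s 1) + (c3:ℚ) • (p:ℚ) • f (s 2)))
          = ∑ i, (c i : ℚ) • ∑ j, (H i j : ℚ) • e j := by
        rw [smul_smul, mul_inv_cancel₀ hp0, one_smul, Fin.sum_univ_succAbove _ k, hck]
        simp only [← hH]
        change _ = _ + ∑ i, (c (s i) : ℚ) • _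
        rw [Fin.sum_univ_three, hcs, hcs, hcs]
        simp [s]
      rw [hw] at h1
      have h2 : ∑ j, ((p:ℚ) * w j - ∑ i, (c i : ℚ) * H i j) • e j = 0 := by
        simp only [sub_smul, Finset.sum_sub_distrib, Finset.sum_smul]
        rw [sub_eq_zero]
        simp only [Finset.smul_sum, smul_smul] at h1
        rw [h1, Finset.sum_comm]
      have h3 := Fintype.linearIndependent_iff.1 hli _ h2 j
      have h4 : (∑ i, c i * H i j : ℚ) = p * w j := by linarith
      exact_mod_cast h4
  obtain ⟨c, hc0, ⟨a, ha⟩, hc⟩ := hcomb 0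
  obtain ⟨d, hda, ⟨b, hb⟩, hd⟩ := hcomb a
  obtain ⟨k, hk⟩ := rank2 (Fact.out : p.Prime) (Matrix.of H) c d a b ha hb hda hc hd
  set G : Matrix (Fin 4) (Fin 4) ℚ := Matrix.of fun i j => L.b (e i) (e j) with hG
  have hGdet : (k:ℚ) * G.det = p ^ 2 := by
    have h1 : (Matrix.of H).map (Int.cast : ℤ → ℚ) * G = (p:ℚ) • 1 := by
      ext i j
      rw [Matrix.mul_apply]
      simp only [Matrix.map_apply, Matrix.of_apply, hG, hHG, Matrix.smul_apply, Matrix.one_apply, smul_eq_mul]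
      by_cases h : i = j
      · simp [h]
      · simp [h, Ne.symm h]
    have h2 := congrArg Matrix.det h1
    rw [Matrix.det_mul, Matrix.det_smul, Matrix.det_one] at h2
    have h3 : ((Matrix.of H).map (Int.cast : ℤ → ℚ)).det = ((Matrix.of H).det : ℚ) :=
      (Int.cast_det (R := ℚ) (Matrix.of H)).symm
    rw [h3, hk] at h2
    push_cast at h2
    simp at h2
    have hp2 : (p:ℚ)^2 ≠ 0 := pow_ne_zero _ hp0
    apply mul_left_cancel₀ hp2
    linear_combination h2
  have hp2 : (0:ℚ) < (p:ℚ)^2 := by positivity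
  have hk0 : k ≠ 0 := by
    rintro rfl
    rw [Int.cast_zero, zero_mul] at hGdet; linarith
  refine ⟨?_, ?_⟩
  · intro h; rw [h, mul_zero] at hGdet; linarith
  · have h1 : |(k:ℚ)| * |G.det| = p ^ 2 := by rw [← abs_mul, hGdet, abs_of_pos hp2]
    have h2 : (1:ℚ) ≤ |(k:ℚ)| := by exact_mod_cast Int.one_le_abs hk0
    rw [← h1]
    exact le_mul_of_one_le_left (abs_nonneg _) h2

end
end CQ

namespace CQ

section
variable {p : ℕ} {A : Type*} [Ring A] [Algebra ℚ A] {C : Ctx p A} (L : Lat C)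

def Lat.d2 (x y : A) : ℚ := L.b x x * L.b y y - L.b x y ^ 2
def Lat.e2 (x y z : A) : ℚ := L.b x x * L.b y z - L.b x y * L.b x z
def Lat.e3 (x y z w : A) : ℚ :=
  (L.b x y * L.b y z - L.b x z * L.b y y) * L.b x w + (L.b x y * L.b x z - L.b x x * L.b y z) * L.b y w
    + (L.b x x * L.b y y - L.b x y ^ 2) * L.b z w
def Lat.d4 (x y z w : A) : ℚ := L.d3 x y z * L.b w w
  - ((L.b y y * L.b z z - L.b y z ^ 2) * L.b x w ^ 2 + (L.b x x * L.b z z - L.b x z ^ 2) * L.b y w ^ 2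
    + (L.b x x * L.b y y - L.b x y ^ 2) * L.b z w ^ 2
    + 2 * (L.b x z * L.b y z - L.b x y * L.b z z) * L.b x w * L.b y w
    + 2 * (L.b x y * L.b y z - L.b x z * L.b y y) * L.b x w * L.b z w
    + 2 * (L.b x y * L.b x z - L.b x x * L.b y z) * L.b y w * L.b z w)

theorem Lat.id1 (x y : A) : L.b x x * L.b y y - L.b x y ^ 2 = L.d2 x y := rfl
theorem Lat.id2 (x y z : A) : L.d2 x y * L.d2 x z - L.e2 x y z ^ 2 = L.b x x * L.d3 x y z := by
  unfold Lat.d2 Lat.e2 Lat.d3; ring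
theorem Lat.id3 (x y z w : A) : L.d3 x y z * L.d3 x y w - L.e3 x y z w ^ 2 = L.d2 x y * L.d4 x y z w := by
  unfold Lat.d4 Lat.d2 Lat.e3 Lat.d3; ring

theorem Lat.d2_sw (x y : A) : L.d2 y x = L.d2 x y := by
  unfold Lat.d2; rw [L.b_symm y x]; ring
theorem Lat.d3_sw (x y z : A) : L.d3 y x z = L.d3 x y z := by
  unfold Lat.d3; rw [L.b_symm y x]; ring
theorem Lat.d3_sw2 (x y z : A) : L.d3 x z y = L.d3 x y z := by
  unfold Lat.d3; rw [L.b_symm z y]; ring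
theorem Lat.d4_sw (x y z w : A) : L.d4 y x z w = L.d4 x y z w := by
  unfold Lat.d4 Lat.d3; rw [L.b_symm y x]; ring
theorem Lat.d4_sw2 (x y z w : A) : L.d4 x z y w = L.d4 x y z w := by
  unfold Lat.d4 Lat.d3; rw [L.b_symm z y]; ring
theorem Lat.d4_sw3 (x y z w : A) : L.d4 x y w z = L.d4 x y z w := by
  unfold Lat.d4 Lat.d3; rw [L.b_symm w z]; ring

def Lat.T (x y z w : A) : Prop := (x ∈ L.I ∧ y ∈ L.I ∧ z ∈ L.I ∧ w ∈ L.I) ∧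
  0 < L.b x x ∧ 0 < L.d2 x y ∧ 0 < L.d3 x y z ∧ 0 < L.d4 x y z w ∧ L.d4 x y z w ≤ (p:ℚ) ^ 2

variable {L}

theorem Lat.T.sw1 {x y z w : A} (h : L.T x y z w) : L.T y x z w := by
  obtain ⟨⟨hx, hy, hz, hw⟩, h1, h2, h3, h4, h5⟩ := h
  refine ⟨⟨hy, hx, hz, hw⟩, ?_, by rwa [L.d2_sw], by rwa [L.d3_sw], by rwa [L.d4_sw], by rwa [L.d4_sw]⟩
  have := L.id1 x y
  by_contra h; push Not at h
  nlinarith [sq_nonneg (L.b x y)]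

theorem Lat.T.sw2 {x y z w : A} (h : L.T x y z w) : L.T x z y w := by
  obtain ⟨⟨hx, hy, hz, hw⟩, h1, h2, h3, h4, h5⟩ := h
  refine ⟨⟨hx, hz, hy, hw⟩, h1, ?_, by rwa [L.d3_sw2], by rwa [L.d4_sw2], by rwa [L.d4_sw2]⟩
  have := L.id2 x y z
  by_contra h; push Not at h
  nlinarith [sq_nonneg (L.e2 x y z), mul_pos h1 h3]

theorem Lat.T.sw3 {x y z w : A} (h : L.T x y z w) : L.T x y w z := by
  obtain ⟨⟨hx, hy, hz, hw⟩, h1, h2, h3, h4, h5⟩ := h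
  refine ⟨⟨hx, hy, hw, hz⟩, h1, h2, ?_, by rwa [L.d4_sw3], by rwa [L.d4_sw3]⟩
  have := L.id3 x y z w
  by_contra h; push Not at h
  nlinarith [sq_nonneg (L.e3 x y z w), mul_pos h2 h4]

theorem Lat.d2_sh (x y : A) (k : ℚ) : L.d2 x (y - k • x) = L.d2 x y := by
  unfold Lat.d2
  simp only [map_sub, map_smul, LinearMap.sub_apply, LinearMap.smul_apply, smul_eq_mul]
  rw [L.b_symm y x]; ring
theorem Lat.d3_sh1 (x y z : A) (k : ℚ) : L.d3 x (y - k • x) z = L.d3 x y z := by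
  unfold Lat.d3
  simp only [map_sub, map_smul, LinearMap.sub_apply, LinearMap.smul_apply, smul_eq_mul]
  rw [L.b_symm y x]; ring
theorem Lat.d3_sh2 (x y z : A) (k l : ℚ) : L.d3 x y (z - k • y - l • x) = L.d3 x y z := by
  unfold Lat.d3
  simp only [map_sub, map_smul, LinearMap.sub_apply, LinearMap.smul_apply, smul_eq_mul]
  rw [L.b_symm y x, L.b_symm z x, L.b_symm z y]; ring
theorem Lat.e2_sh (x y z : A) (k l : ℚ) : L.e2 x y (z - k • y - l • x) = L.e2 x y z - k * L.d2 x y := by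
  unfold Lat.e2 Lat.d2
  simp only [map_sub, map_smul, LinearMap.sub_apply, LinearMap.smul_apply, smul_eq_mul]
  rw [L.b_symm y x]; ring
theorem Lat.d4_sh1 (x y z w : A) (k : ℚ) : L.d4 x (y - k • x) z w = L.d4 x y z w := by
  unfold Lat.d4; rw [L.d3_sh1]; unfold Lat.d3
  simp only [map_sub, map_smul, LinearMap.sub_apply, LinearMap.smul_apply, smul_eq_mul]
  rw [L.b_symm y x]; ring
theorem Lat.d4_sh2 (x y z w : A) (k l : ℚ) : L.d4 x y (z - k • y - l • x) w = L.d4 x y z w := by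
  unfold Lat.d4; rw [L.d3_sh2]; unfold Lat.d3
  simp only [map_sub, map_smul, LinearMap.sub_apply, LinearMap.smul_apply, smul_eq_mul]
  rw [L.b_symm y x, L.b_symm z x, L.b_symm z y]; ring
theorem Lat.d4_sh3 (x y z w : A) (k : ℚ) : L.d4 x y z (w - k • z) = L.d4 x y z w := by
  unfold Lat.d4 Lat.d3
  simp only [map_sub, map_smul, LinearMap.sub_apply, LinearMap.smul_apply, smul_eq_mul]
  rw [L.b_symm w z]; ring
theorem Lat.e3_sh (x y z w : A) (k : ℚ) : L.e3 x y z (w - k • z) = L.e3 x y z w - k * L.d3 x y z := by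
  unfold Lat.e3 Lat.d3
  simp only [map_sub, map_smul, LinearMap.sub_apply, LinearMap.smul_apply, smul_eq_mul]
  ring

theorem rnd (a d : ℚ) (hd : 0 < d) : ∃ k : ℤ, |2 * (a - k * d)| ≤ d := by
  refine ⟨round (a / d), ?_⟩
  have h := abs_sub_round (a / d)
  have : 2 * (a - round (a/d) * d) = 2 * d * (a / d - round (a/d)) := by field_simp
  rw [this, abs_mul, abs_of_pos (by positivity)]
  nlinarith

theorem Lat.reduce {x y z w : A} (h : L.T x y z w) : ∃ y' z' w', L.T x y' z' w' ∧
    L.b x x * L.d2 x y' * L.d3 x y' z' = L.b x x * L.d2 x y * L.d3 x y z ∧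
    |2 * L.b x y'| ≤ L.b x x ∧ |2 * L.e2 x y' z'| ≤ L.d2 x y' ∧ |2 * L.b x z'| ≤ L.b x x ∧
    |2 * L.e3 x y' z' w'| ≤ L.d3 x y' z' := by
  obtain ⟨⟨hx, hy, hz, hw⟩, h1, h2, h3, h4, h5⟩ := h
  obtain ⟨k, hk⟩ := rnd (L.b x y) (L.b x x) h1
  set y' := y - (k:ℚ) • x with hy'
  have hyI : y' ∈ L.I := L.I.sub_mem hy (zsm hx k)
  have e1 : L.b x y' = L.b x y - k * L.b x x := by simp [hy']
  rw [← L.d2_sh x y k] at h2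
  obtain ⟨m, hm⟩ := rnd (L.e2 x y' z) (L.d2 x y') h2
  obtain ⟨l, hl⟩ := rnd (L.b x (z - (m:ℚ) • y')) (L.b x x) h1
  set z' := z - (m:ℚ) • y' - (l:ℚ) • x with hz'
  have hzI : z' ∈ L.I := L.I.sub_mem (L.I.sub_mem hz (zsm hyI m)) (zsm hx l)
  have e2 : L.b x z' = L.b x (z - (m:ℚ) • y') - l * L.b x x := by simp [hz']
  have e3 : L.e2 x y' z' = L.e2 x y' z - m * L.d2 x y' := L.e2_sh ..
  have e4 : L.d3 x y' z' = L.d3 x y z := by rw [hz', L.d3_sh2, hy', L.d3_sh1]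
  have e5 : L.d4 x y' z' w = L.d4 x y z w := by rw [hz', L.d4_sh2, hy', L.d4_sh1]
  rw [← e4] at h3
  obtain ⟨n, hn⟩ := rnd (L.e3 x y' z' w) (L.d3 x y' z') h3
  have e6 : L.d4 x y' z' (w - (n:ℚ) • z') = L.d4 x y z w := by rw [L.d4_sh3, e5]
  refine ⟨y', z', w - (n:ℚ) • z', ⟨⟨hx, hyI, hzI, L.I.sub_mem hw (zsm hzI n)⟩, h1, h2, h3, by rwa [e6], by rwa [e6]⟩, ?_, ?_, ?_, ?_, ?_⟩
  · rw [e4, hy', L.d2_sh]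
  · rw [e1]; exact hk
  · rw [e3]; exact hm
  · rw [e2]; exact hl
  · rw [L.e3_sh]; exact hn

theorem Lat.d2_int {x y : A} (hx : x ∈ L.I) (hy : y ∈ L.I) : IsZ (L.d2 x y) := by
  unfold Lat.d2; rw [pow_two]
  exact ((L.b_int hx hx).mul (L.b_int hy hy)).sub ((L.b_int hx hy).mul (L.b_int hx hy))

theorem IsZ.nat {q : ℚ} (h : IsZ q) (h0 : 0 < q) : ∃ n : ℕ, (n:ℚ) = q := by
  obtain ⟨m, rfl⟩ := h
  have : 0 < m := by exact_mod_cast h0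
  exact ⟨m.toNat, by
    have : ((m.toNat : ℤ) : ℚ) = m := by rw [Int.toNat_of_nonneg this.le]
    exact_mod_cast this⟩

theorem Lat.LLL [Fact p.Prime] (X : Set A) (h : ∃ x ∈ X, ∃ y z w, L.T x y z w) :
    ∃ x ∈ X, ∃ y z w, L.T x y z w ∧ (y ∈ X → L.b x x ≤ L.b y y) ∧
    |2 * L.b x y| ≤ L.b x x ∧ |2 * L.e2 x y z| ≤ L.d2 x y ∧ |2 * L.b x z| ≤ L.b x x ∧
    3 * L.d2 x y ^ 2 ≤ 4 * (L.b x x * L.d3 x y z) ∧ 3 * L.d3 x y z ^ 2 ≤ 4 * (L.d2 x y * L.d4 x y z w) := by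
  let S : Set ℕ := {n | ∃ x ∈ X, ∃ y z w, L.T x y z w ∧ (n:ℚ) = L.b x x * L.d2 x y * L.d3 x y z}
  have hI : ∀ {x y z w}, L.T x y z w → ∃ n : ℕ, (n:ℚ) = L.b x x * L.d2 x y * L.d3 x y z := by
    rintro x y z w ⟨⟨hx, hy, hz, hw⟩, h1, h2, h3, -⟩
    apply IsZ.nat _ (mul_pos (mul_pos h1 h2) h3)
    obtain ⟨m, hm⟩ := L.det3 hx hy hz
    rw [hm]
    exact ((L.b_int hx hx).mul (L.d2_int hx hy)).mul ((IsZ.int (p:ℤ)).mul (IsZ.int m))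
  have hS : S.Nonempty := by
    obtain ⟨x, hx, y, z, w, hT⟩ := h
    obtain ⟨n, hn⟩ := hI hT
    exact ⟨n, x, hx, y, z, w, hT, hn⟩
  obtain ⟨n, ⟨x, hx, y0, z0, w0, hT0, hn0⟩, hmin⟩ := WellFounded.has_min (Nat.lt_wfRel.wf) S hS
  obtain ⟨y, z, w, hT, he, r1, r2, r3, r4⟩ := Lat.reduce hT0
  have hn : (n:ℚ) = L.b x x * L.d2 x y * L.d3 x y z := by rw [he, hn0]
  have hle : ∀ x' ∈ X, ∀ y' z' w', L.T x' y' z' w' →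
      L.b x x * L.d2 x y * L.d3 x y z ≤ L.b x' x' * L.d2 x' y' * L.d3 x' y' z' := by
    intro x' hx' y' z' w' hT'
    obtain ⟨m, hm⟩ := hI hT'
    have : ¬ (m < n) := hmin m ⟨x', hx', y', z', w', hT', hm⟩
    push Not at this
    rw [← hn, ← hm]; exact_mod_cast this
  have hT' := hT
  obtain ⟨-, h1, h2, h3, h4, -⟩ := hT'
  refine ⟨x, hx, y, z, w, hT, ?_, r1, r2, r3, ?_, ?_⟩
  · intro hy
    have := hle y hy x z w hT.sw1
    rw [L.d2_sw x y, L.d3_sw x y z, mul_assoc, mul_assoc] at this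
    exact le_of_mul_le_mul_right this (mul_pos h2 h3)
  · have := hle x hx z y w hT.sw2
    rw [L.d3_sw2 x y z] at this
    have h5 := le_of_mul_le_mul_left (le_of_mul_le_mul_right this h3) h1
    have h6 := L.id2 x y z
    have h7 : (2 * L.e2 x y z) ^ 2 ≤ L.d2 x y ^ 2 := sq_le_sq' (by linarith [(abs_le.1 r2).1]) (abs_le.1 r2).2
    nlinarith [mul_le_mul_of_nonneg_left h5 h2.le]
  · have := hle x hx y w z hT.sw3
    have h5 := le_of_mul_le_mul_left this (mul_pos h1 h2)
    have h6 := L.id3 x y z w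
    have h7 : (2 * L.e3 x y z w) ^ 2 ≤ L.d3 x y z ^ 2 := sq_le_sq' (by linarith [(abs_le.1 r4).1]) (abs_le.1 r4).2
    nlinarith [mul_le_mul_of_nonneg_left h5 h3.le]

theorem Lat.T_of_basis [Fact p.Prime] {e : Fin 4 → A} (he : IsB L.I e) : L.T (e 0) (e 1) (e 2) (e 3) := by
  obtain ⟨hd0, hdp⟩ := L.det4 he
  obtain ⟨hli, heI, hsp⟩ := he
  set x := e 0
  set y := e 1
  set z := e 2
  set w := e 3
  have hdet : (Matrix.of fun i j => L.b (e i) (e j)).det = L.d4 x y z w := by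
    rw [Matrix.det_succ_row_zero]
    simp only [Fin.sum_univ_four, Matrix.det_fin_three]
    simp [Fin.succAbove, Matrix.submatrix_apply, Fin.lt_def]
    unfold Lat.d4 Lat.d3
    simp only [show e 0 = x from rfl, show e 1 = y from rfl, show e 2 = z from rfl, show e 3 = w from rfl]
    rw [L.b_symm y x, L.b_symm z x, L.b_symm w x, L.b_symm z y, L.b_symm w y, L.b_symm w z]
    ring
  rw [hdet] at hd0 hdp
  have hpos : ∀ c1 c2 c3 c4 : ℚ, (c1 ≠ 0 ∨ c2 ≠ 0 ∨ c3 ≠ 0 ∨ c4 ≠ 0) →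
      0 < L.b (c1 • x + c2 • y + c3 • z + c4 • w) (c1 • x + c2 • y + c3 • z + c4 • w) := by
    intro c1 c2 c3 c4 hc
    rw [L.b_self]
    refine mul_pos two_pos (L.q_pos ?_)
    intro h0
    have := Fintype.linearIndependent_iff.1 hli ![c1, c2, c3, c4] (by
      rw [Fin.sum_univ_four]; exact h0)
    have t0 := this 0
    have t1 := this 1
    have t2 := this 2
    have t3 := this 3
    simp at t0 t1 t2 t3
    rcases hc with h | h | h | h
    · exact h t0
    · exact h t1
    · exact h t2
    · exact h t3
  have hexp : ∀ c1 c2 c3 c4 : ℚ, L.b (c1 • x + c2 • y + c3 • z + c4 • w) (c1 • x + c2 • y + c3 • z + c4 • w)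
      = c1^2 * L.b x x + c2^2 * L.b y y + c3^2 * L.b z z + c4^2 * L.b w w + 2*c1*c2*L.b x y + 2*c1*c3*L.b x z
       + 2*c1*c4*L.b x w + 2*c2*c3*L.b y z + 2*c2*c4*L.b y w + 2*c3*c4*L.b z w := by
    intro c1 c2 c3 c4
    simp only [map_add, map_smul, LinearMap.add_apply, LinearMap.smul_apply, smul_eq_mul]
    rw [L.b_symm y x, L.b_symm z x, L.b_symm w x, L.b_symm z y, L.b_symm w y, L.b_symm w z]
    ring
  have h1 : 0 < L.b x x := by
    have := hpos 1 0 0 0 (by simp)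
    simpa using this
  have h2 : 0 < L.d2 x y := by
    have := hpos (-L.b x y) (L.b x x) 0 0 (Or.inr (Or.inl h1.ne'))
    rw [hexp] at this
    have e : 0 < L.b x x * L.d2 x y := by unfold Lat.d2; linarith
    exact (pos_iff_pos_of_mul_pos e).1 h1
  have h3 : 0 < L.d3 x y z := by
    have := hpos (L.b x y * L.b y z - L.b x z * L.b y y) (L.b x y * L.b x z - L.b x x * L.b y z) (L.d2 x y) 0
      (Or.inr (Or.inr (Or.inl h2.ne')))
    rw [hexp] at this
    have e : 0 < L.d2 x y * L.d3 x y z := by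
      refine lt_of_lt_of_eq this ?_
      unfold Lat.d3 Lat.d2; ring
    exact (pos_iff_pos_of_mul_pos e).1 h2
  have h4 : 0 < L.d4 x y z w := by
    have := hpos
      (-((L.b y y * L.b z z - L.b y z ^ 2) * L.b x w + (L.b x z * L.b y z - L.b x y * L.b z z) * L.b y w
        + (L.b x y * L.b y z - L.b x z * L.b y y) * L.b z w))
      (-((L.b x z * L.b y z - L.b x y * L.b z z) * L.b x w + (L.b x x * L.b z z - L.b x z ^ 2) * L.b y w
        + (L.b x y * L.b x z - L.b x x * L.b y z) * L.b z w))
      (-((L.b x y * L.b y z - L.b x z * L.b y y) * L.b x w + (L.b x y * L.b x z - L.b x x * L.b y z) * L.b y w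
        + (L.b x x * L.b y y - L.b x y ^ 2) * L.b z w)) (L.d3 x y z)
      (Or.inr (Or.inr (Or.inr h3.ne')))
    rw [hexp] at this
    have e : 0 < L.d3 x y z * L.d4 x y z w := by
      refine lt_of_lt_of_eq this ?_
      unfold Lat.d4 Lat.d3; ring
    exact (pos_iff_pos_of_mul_pos e).1 h3
  exact ⟨⟨heI 0, heI 1, heI 2, heI 3⟩, h1, h2, h3, h4, (le_abs_self _).trans hdp⟩

end
end CQ

namespace CQ

section
variable {p : ℕ} {A : Type*} [Ring A] [Algebra ℚ A] {C : Ctx p A} (L : Lat C)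

theorem Lat.excl [Fact p.Prime] {x y : A} (hx : x ∈ L.I) (hy : y ∈ L.I) (n t a : ℤ) (hn : (n:ℚ) = L.q x * L.q y)
    (ht : (t:ℚ) = L.b x y) (hne : t ^ 2 ≠ 4 * n) (h0 : (p:ℤ) ∣ a ^ 2 - t * a + n) (h1 : ¬ (p:ℤ) ∣ 2 * a - t) : False := by
  refine C.simple_root (x := L.N⁻¹ • (C.cj x * y)) ?_ t n a (by rw [L.trV, ht]) (by rw [L.nmV, hn]) h0 h1
  intro c hc
  have e1 := L.nmV x y
  have e2 := L.trV x y
  rw [hc, C.nm_smul, C.nm_one, ← hn] at e1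
  rw [hc, C.tr_smul_one, ← ht] at e2
  apply hne
  have : (t:ℚ)^2 = 4 * n := by rw [← e1, ← e2]; ring
  exact_mod_cast this

theorem Lat.exists_min [Fact p.Prime] (hp : p = 2 ∨ p = 3 ∨ p = 5 ∨ p = 7 ∨ p = 13) : ∃ x ∈ L.I, L.q x = 1 := by
  by_contra hcon
  push Not at hcon
  have hq2 : ∀ x ∈ L.I, 0 < L.b x x → ∃ n : ℤ, (n:ℚ) = L.q x ∧ 2 ≤ n := by
    intro x hx h0
    obtain ⟨n, hn⟩ := L.q_int hx
    rw [L.b_self, ← hn] at h0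
    have h1 := hcon x hx
    rw [← hn] at h1
    have h2 : 0 < n := by
      have : (0:ℚ) < n := by linarith
      exact_mod_cast this
    have h3 : n ≠ 1 := by exact_mod_cast h1
    exact ⟨n, hn, by omega⟩
  obtain ⟨e, he⟩ := L.exists_basis
  obtain ⟨x, -, y, z, w, hT, h1, r1, r2, r3, s2, s3⟩ := Lat.LLL (L := L) Set.univ ⟨_, trivial, _, _, _, Lat.T_of_basis he⟩
  replace h1 := h1 trivial
  have hT1 := hT.sw1
  obtain ⟨⟨hx, hy, hz, hw⟩, p1, p2, p3, p4, p5⟩ := hT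
  obtain ⟨q1, e1, hq1⟩ := hq2 x hx p1
  obtain ⟨q2, e2, hq2'⟩ := hq2 y hy hT1.2.1
  obtain ⟨q3, e3⟩ := L.q_int hz
  obtain ⟨b12, f12⟩ := L.b_int hx hy
  obtain ⟨b13, f13⟩ := L.b_int hx hz
  obtain ⟨b23, f23⟩ := L.b_int hy hz
  have E : 27 * L.d2 x y ^ 3 ≤ 64 * L.b x x ^ 2 * L.d4 x y z w := by
    have t1 : (3 * L.d2 x y ^ 2) ^ 2 ≤ (4 * (L.b x x * L.d3 x y z)) ^ 2 := pow_le_pow_left₀ (by positivity) s2 2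
    have t2 := mul_le_mul_of_nonneg_left s3 (sq_nonneg (L.b x x))
    have : L.d2 x y * (27 * L.d2 x y ^ 3) ≤ L.d2 x y * (64 * L.b x x ^ 2 * L.d4 x y z w) := by nlinarith
    exact le_of_mul_le_mul_left this p2
  have hd1 : L.b x x = 2 * q1 := by rw [L.b_self, e1]
  have hd2 : L.d2 x y = 4 * q1 * q2 - b12 ^ 2 := by
    unfold Lat.d2; rw [L.b_self, L.b_self, ← e1, ← e2, ← f12]; ring
  have hd3 : L.d3 x y z = 8 * q1 * q2 * q3 + 2 * b12 * b23 * b13 - 2 * q1 * b23 ^ 2 - 2 * q2 * b13 ^ 2 - 2 * q3 * b12 ^ 2 := by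
    unfold Lat.d3; rw [L.b_self, L.b_self, L.b_self, ← e1, ← e2, ← e3, ← f12, ← f13, ← f23]; ring
  have h12 : q1 ≤ q2 := by
    rw [hd1, L.b_self y, ← e2] at h1
    have : (q1:ℚ) ≤ q2 := by linarith
    exact_mod_cast this
  have hb12 : |b12| ≤ q1 := by
    rw [hd1, ← f12, abs_mul] at r1
    have : |(b12:ℚ)| ≤ q1 := by
      have : |(2:ℚ)| = 2 := by norm_num
      rw [this] at r1; linarith
    exact_mod_cast this
  have hb13 : |b13| ≤ q1 := by
    rw [hd1, ← f13, abs_mul] at r3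
    have : |(b13:ℚ)| ≤ q1 := by
      have : |(2:ℚ)| = 2 := by norm_num
      rw [this] at r3; linarith
    exact_mod_cast this
  have E' : 27 * (4 * q1 * q2 - b12 ^ 2) ^ 3 ≤ 64 * (2 * q1) ^ 2 * (p:ℤ) ^ 2 := by
    have : 64 * L.b x x ^ 2 * L.d4 x y z w ≤ 64 * L.b x x ^ 2 * (p:ℚ) ^ 2 :=
      mul_le_mul_of_nonneg_left p5 (by positivity)
    have := E.trans this
    rw [hd1, hd2] at this
    exact_mod_cast this
  have hb12s : b12 ^ 2 ≤ q1 ^ 2 := sq_le_sq' (by linarith [(abs_le.1 hb12).1]) (abs_le.1 hb12).2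
  have hd2l : 3 * q1 ^ 2 ≤ 4 * q1 * q2 - b12 ^ 2 := by nlinarith
  have hcub : 27 * (3 * q1 ^ 2) ^ 3 ≤ 64 * (2 * q1) ^ 2 * (p:ℤ) ^ 2 := by
    have : (3 * q1 ^ 2) ^ 3 ≤ (4 * q1 * q2 - b12 ^ 2) ^ 3 := pow_le_pow_left₀ (by positivity) hd2l 3
    linarith
  have hcub2 : 729 * q1 ^ 4 ≤ 256 * (p:ℤ) ^ 2 := by
    have : (q1 ^ 2) * (729 * q1 ^ 4) ≤ (q1 ^ 2) * (256 * (p:ℤ) ^ 2) := by nlinarith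
    exact le_of_mul_le_mul_left this (by positivity)
  have hp13 : (p:ℤ) ≤ 13 := by rcases hp with h | h | h | h | h <;> rw [h] <;> norm_num
  have hq12 : q1 = 2 := by
    by_contra h
    have h3 : 3 ≤ q1 := by omega
    have : (3:ℤ) ^ 4 ≤ q1 ^ 4 := pow_le_pow_left₀ (by norm_num) h3 4
    have : (p:ℤ)^2 ≤ 13 ^ 2 := pow_le_pow_left₀ (by positivity) hp13 2
    linarith
  subst hq12
  have hp7 : p = 7 ∨ p = 13 := by
    rcases hp with h | h | h | h | h
    · subst h; norm_num at hcub2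
    · subst h; norm_num at hcub2
    · subst h; norm_num at hcub2
    · exact Or.inl h
    · exact Or.inr h
  have hd18 : 4 * 2 * q2 - b12 ^ 2 ≤ 18 := by
    by_contra h
    push Not at h
    have : (19:ℤ) ^ 3 ≤ (4 * 2 * q2 - b12 ^ 2) ^ 3 := pow_le_pow_left₀ (by norm_num) h 3
    have : (p:ℤ)^2 ≤ 13 ^ 2 := pow_le_pow_left₀ (by positivity) hp13 2
    linarith
  have hbb := abs_le.1 hb12
  have hq22 : q2 = 2 := by
    have : b12 ^ 2 ≤ 4 := by linarith
    omega
  subst hq22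
  have hn4 : ((4:ℤ):ℚ) = L.q x * L.q y := by rw [← e1, ← e2]; norm_num
  have hbcases : b12 = -2 ∨ b12 = -1 ∨ b12 = 0 ∨ b12 = 1 ∨ b12 = 2 := by omega
  rcases hp7 with rfl | rfl
  · rcases hbcases with rfl | rfl | rfl | rfl | rfl
    · exact L.excl hx hy 4 (-2) (-3) hn4 f12 (by norm_num) (by norm_num) (by norm_num)
    · norm_num at E'
    · norm_num at E'
    · norm_num at E'
    · exact L.excl hx hy 4 2 3 hn4 f12 (by norm_num) (by norm_num) (by norm_num)
  · have hb1 : b12 = -1 ∨ b12 = 1 := by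
      rcases hbcases with rfl | rfl | rfl | rfl | rfl
      · exact (L.excl hx hy 4 (-2) (-7) hn4 f12 (by norm_num) (by norm_num) (by norm_num)).elim
      · exact Or.inl rfl
      · exact (L.excl hx hy 4 0 3 hn4 f12 (by norm_num) (by norm_num) (by norm_num)).elim
      · exact Or.inr rfl
      · exact (L.excl hx hy 4 2 7 hn4 f12 (by norm_num) (by norm_num) (by norm_num)).elim
    have hbs : (b12:ℚ) ^ 2 = 1 := by rcases hb1 with h | h <;> rw [h] <;> norm_num
    have hd2' : L.d2 x y = 15 := by rw [hd2, hbs]; norm_num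
    rw [hd2', hd1] at s2
    rw [hd2'] at s3 r2
    push_cast at p5
    have u1 : 3 * L.d3 x y z ^ 2 ≤ 60 * 169 := by linarith
    obtain ⟨m, hm⟩ := L.det3 hx hy hz
    rw [hm] at s2 u1 hd3
    push_cast at s2 u1
    have m1 : 3 < m := by
      have : (3:ℚ) < m := by linarith
      exact_mod_cast this
    have m2 : m < 5 := by
      have : (m:ℚ) < 5 := by nlinarith
      exact_mod_cast this
    have hm4 : m = 4 := by omega
    subst hm4
    have hd3' : (52:ℤ) = 32 * q3 + 2 * b12 * b23 * b13 - 4 * b23 ^ 2 - 4 * b13 ^ 2 - 2 * q3 * b12 ^ 2 := by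
      have : (52:ℚ) = 32 * q3 + 2 * b12 * b23 * b13 - 4 * b23 ^ 2 - 4 * b13 ^ 2 - 2 * q3 * b12 ^ 2 := by
        push_cast at hd3; linarith
      exact_mod_cast this
    have r2' : |2 * (4 * b23 - b12 * b13)| ≤ 15 := by
      unfold Lat.e2 at r2
      rw [hd1, ← f12, ← f13, ← f23] at r2
      have : |2 * (4 * b23 - b12 * b13 : ℚ)| ≤ 15 := by
        refine le_trans (le_of_eq ?_) r2
        congr 1; push_cast; ring
      exact_mod_cast this
    have hc := abs_le.1 hb13
    have hd := abs_le.1 r2'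
    have hb13c : b13 = -2 ∨ b13 = -1 ∨ b13 = 0 ∨ b13 = 1 ∨ b13 = 2 := by omega
    have hb23l : -2 ≤ b23 ∧ b23 ≤ 2 := by
      rcases hb1 with rfl | rfl <;> rcases hb13c with rfl | rfl | rfl | rfl | rfl <;> omega
    have hb23c : b23 = -2 ∨ b23 = -1 ∨ b23 = 0 ∨ b23 = 1 ∨ b23 = 2 := by omega
    rcases hb1 with rfl | rfl <;> rcases hb13c with rfl | rfl | rfl | rfl | rfl <;>
      rcases hb23c with rfl | rfl | rfl | rfl | rfl <;> omega

end
end CQ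

namespace CQ

section
variable {p : ℕ} {A : Type*} [Ring A] [Algebra ℚ A]

theorem Ctx.mkLat (C : Ctx p A) (I : AddSubgroup A) (le : I ≤ C.Λ.toAddSubgroup)
    (right : ∀ x ∈ I, ∀ a ∈ C.Λ, x * a ∈ I) (hne : ∃ x ∈ I, x ≠ 0) : ∃ L : Lat C, L.I = I := by
  let J : Ideal ℤ := Ideal.span {n | ∃ x ∈ I, (n:ℚ) = C.nm x}
  obtain ⟨g, hg⟩ := (IsPrincipalIdealRing.principal J).principal
  have hdvd : ∀ n, n ∈ J → g ∣ n := by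
    intro n hn; rw [hg] at hn; exact Ideal.mem_span_singleton.1 hn
  have hg0 : g ≠ 0 := by
    rintro rfl
    obtain ⟨x, hx, hx0⟩ := hne
    obtain ⟨n, hn⟩ := (C.F1 (le hx)).2
    have h1 := zero_dvd_iff.1 (hdvd n (Ideal.subset_span ⟨x, hx, hn⟩))
    have h2 := C.nm_pos hx0
    rw [← hn, h1] at h2; simp at h2
  have hgq : ((|g| : ℤ) : ℚ) ≠ 0 := by exact_mod_cast (abs_pos.2 hg0).ne'
  have hkey : ∀ y ∈ I, ∃ m : ℤ, (m:ℚ) = C.nm y / ((|g| : ℤ) : ℚ) := by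
    intro y hy
    obtain ⟨n, hn⟩ := (C.F1 (le hy)).2
    obtain ⟨m, hm⟩ := (abs_dvd g n).2 (hdvd n (Ideal.subset_span ⟨y, hy, hn⟩))
    refine ⟨m, ?_⟩
    rw [← hn, hm]; push_cast; push_cast at hgq; field_simp
  refine ⟨⟨I, le, right, ((|g| : ℤ) : ℚ), by exact_mod_cast abs_pos.2 hg0, hkey, ?_⟩, rfl⟩
  intro ℓ hl
  by_contra hcon
  push Not at hcon
  have hle : J ≤ Ideal.span {(ℓ:ℤ) * |g|} := by
    rw [Ideal.span_le]
    rintro n ⟨x, hx, hn⟩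
    obtain ⟨m, hm⟩ := hkey x hx
    obtain ⟨k, rfl⟩ := hcon x hx m hm
    rw [SetLike.mem_coe, Ideal.mem_span_singleton]
    refine ⟨k, ?_⟩
    have : (n:ℚ) = ((ℓ * k : ℤ) : ℚ) * ((|g| : ℤ) : ℚ) := by
      rw [hm, hn]; field_simp
    have h2 : n = ℓ * k * |g| := by exact_mod_cast this
    rw [h2]; ring
  have hgJ : g ∈ J := by rw [hg]; exact Ideal.mem_span_singleton_self g
  have h1 := (abs_dvd_abs _ _).2 (Ideal.mem_span_singleton.1 (hle hgJ))
  obtain ⟨k, hk⟩ := h1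
  rw [abs_mul, abs_abs] at hk
  have h3 : (1:ℤ) = |(ℓ:ℤ)| * k := by
    apply mul_left_cancel₀ (abs_pos.2 hg0).ne'
    linear_combination hk
  rw [Nat.abs_cast] at h3
  have : (ℓ:ℤ) ∣ 1 := ⟨k, h3⟩
  have : ℓ ∣ 1 := by exact_mod_cast this
  exact hl.one_lt.ne' (Nat.dvd_one.1 this)

theorem Ctx.principal (C : Ctx p A) [Fact p.Prime] (hp : p = 2 ∨ p = 3 ∨ p = 5 ∨ p = 7 ∨ p = 13)
    (I : AddSubgroup A) (hfg : I.FG)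
    (right : ∀ x ∈ I, ∀ a ∈ C.Λ, x * a ∈ I) (hne : ∃ x ∈ I, x ≠ 0) :
    ∃ x, x ≠ 0 ∧ ∀ y, y ∈ I ↔ ∃ a ∈ C.Λ, y = x * a := by
  have hm : ∃ m : ℤ, m ≠ 0 ∧ ∀ y ∈ I, (m:ℚ) • y ∈ C.Λ := by
    obtain ⟨S, hS⟩ := hfg
    have : ∀ T : Finset A, ∃ m : ℤ, m ≠ 0 ∧ ∀ y ∈ T, (m:ℚ) • y ∈ C.Λ := by
      classical
      intro T
      induction T using Finset.induction_on with
      | empty => exact ⟨1, one_ne_zero, by simp⟩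
      | insert a T ha ih =>
        obtain ⟨m, hm, h⟩ := ih
        obtain ⟨n, hn, h'⟩ := C.exists_mul_mem a
        refine ⟨m * n, mul_ne_zero hm hn, ?_⟩
        intro y hy
        rcases Finset.mem_insert.1 hy with rfl | hy
        · push_cast; rw [mul_smul]; exact C.int_smul_mem h' m
        · push_cast; rw [mul_comm, mul_smul]; exact C.int_smul_mem (h y hy) n
    obtain ⟨m, hm, h⟩ := this S
    refine ⟨m, hm, ?_⟩
    intro y hy
    rw [← hS] at hy
    induction hy using AddSubgroup.closure_induction with
    | mem x hx => exact h x hx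
    | zero => rw [smul_zero]; exact C.Λ.zero_mem
    | add x y _ _ hx hy => rw [smul_add]; exact C.Λ.add_mem hx hy
    | neg x _ hx => rw [smul_neg]; exact C.Λ.neg_mem hx
  obtain ⟨m, hm0, hm⟩ := hm
  have hmq : (m:ℚ) ≠ 0 := by exact_mod_cast hm0
  let I' : AddSubgroup A := I.comap (DistribSMul.toAddMonoidHom A ((m:ℚ)⁻¹))
  have hI' : ∀ y, y ∈ I' ↔ (m:ℚ)⁻¹ • y ∈ I := fun y => Iff.rfl
  have hcan : ∀ y : A, (m:ℚ)⁻¹ • (m:ℚ) • y = y := by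
    intro y; rw [smul_smul, inv_mul_cancel₀ hmq, one_smul]
  have hcan' : ∀ y : A, (m:ℚ) • (m:ℚ)⁻¹ • y = y := by
    intro y; rw [smul_smul, mul_inv_cancel₀ hmq, one_smul]
  obtain ⟨L, hL⟩ := C.mkLat I' (by
      intro y hy
      have := hm _ ((hI' y).1 hy)
      rw [hcan'] at this; exact this) (by
      intro x hx a ha
      rw [hI', ← smul_mul_assoc]; exact right _ ((hI' x).1 hx) a ha) (by
      obtain ⟨x, hx, hx0⟩ := hne
      exact ⟨(m:ℚ) • x, by rw [hI', hcan]; exact hx, smul_ne_zero hmq hx0⟩)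
  obtain ⟨x, hx, hx1⟩ := L.exists_min hp
  have hx0 : x ≠ 0 := by
    rintro rfl
    unfold Lat.q at hx1; rw [C.nm_zero, zero_div] at hx1; norm_num at hx1
  refine ⟨(m:ℚ)⁻¹ • x, smul_ne_zero (inv_ne_zero hmq) hx0, ?_⟩
  intro y
  have h1 : y ∈ I ↔ (m:ℚ) • y ∈ L.I := by rw [hL, hI', hcan]
  rw [h1, L.gen hx hx1]
  constructor
  · rintro ⟨a, ha, h⟩
    exact ⟨a, ha, by rw [smul_mul_assoc, ← h, hcan]⟩
  · rintro ⟨a, ha, rfl⟩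
    exact ⟨a, ha, by rw [smul_mul_assoc, hcan']⟩

theorem isZ_glue {r : ℚ} (h : ∀ ℓ : ℕ, ℓ.Prime → ∃ m : ℤ, ¬ (ℓ:ℤ) ∣ m ∧ IsZ (m * r)) : IsZ r := by
  have := glue (A := ℚ) (AddMonoidHom.range (Int.castAddHom ℚ)) r (by
    intro ℓ hl
    obtain ⟨m, hm, n, hn⟩ := h ℓ hl
    exact ⟨m, hm, n, by simpa using hn⟩)
  obtain ⟨n, hn⟩ := this
  exact ⟨n, hn⟩

theorem Lat.nm_int {C : Ctx p A} (L L' : Lat C) (hN : L.N = L'.N) (x : A) (h : ∀ j ∈ L.I, x * j ∈ L'.I) :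
    IsZ (C.nm x) := by
  apply isZ_glue
  intro ℓ hl
  obtain ⟨y, hy, m, hm, hd⟩ := L.prim ℓ hl
  refine ⟨m, hd, ?_⟩
  have := L'.int _ (h y hy)
  rw [C.nm_mul, ← hN] at this
  rw [hm]; convert this using 1; ring

def Stab {C : Ctx p A} (L L' : Lat C) : Prop := ∃ z ∈ C.Λ, ∃ z' ∈ C.Λ, (∀ j ∈ L.I, z' * j ∈ L'.I) ∧
  (∀ j ∈ L'.I, z * j ∈ L.I) ∧ (∀ c ∈ C.Λ, c - z' * z * c ∈ L'.I) ∧ (∀ a ∈ C.Λ, a - z * z' * a ∈ L.I)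

def Canc (C : Ctx p A) : Prop := ∀ L L' : Lat C, Stab L L' → ∃ x, ∀ y, y ∈ L'.I ↔ ∃ j ∈ L.I, y = x * j

theorem Canc.nm_one {C : Ctx p A} (H : Canc C) {L L' : Lat C} (hN : L.N = L'.N) (hs : Stab L L') :
    ∃ x, C.nm x = 1 ∧ ∀ y, y ∈ L'.I ↔ ∃ j ∈ L.I, y = x * j := by
  obtain ⟨x, hx⟩ := H L L' hs
  have hx0 : x ≠ 0 := by
    rintro rfl
    obtain ⟨y, hy, m, hm, hd⟩ := L'.prim 2 Nat.prime_two
    obtain ⟨j, -, rfl⟩ := (hx y).1 hy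
    rw [zero_mul, C.nm_zero, zero_div] at hm
    have : m = 0 := by exact_mod_cast hm
    rw [this] at hd; simp at hd
  obtain ⟨m, hm⟩ := L.nm_int L' hN x (fun j hj => (hx _).2 ⟨j, hj, rfl⟩)
  obtain ⟨n, hn⟩ := L'.nm_int L hN.symm (C.iv x) (by
    intro y hy
    obtain ⟨j, hj, rfl⟩ := (hx y).1 hy
    rw [← mul_assoc, C.iv_mul hx0, one_mul]; exact hj)
  have hpos := C.nm_pos hx0
  rw [C.nm_iv] at hn
  refine ⟨x, ?_, hx⟩
  have h1 : (m:ℚ) * n = 1 := by rw [hm, hn, mul_inv_cancel₀ hpos.ne']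
  have h2 : m * n = 1 := by exact_mod_cast h1
  have h3 : 0 < m := by rw [← hm] at hpos; exact_mod_cast hpos
  have := Int.eq_one_or_neg_one_of_mul_eq_one h2
  have h4 : m = 1 := by omega
  rw [← hm, h4]; norm_num

/-- the local splitting -/
structure Psi (C : Ctx p A) (ℓ : ℕ) where
  hlp : ℓ ≠ p
  ψ : C.Λ →+* Matrix (Fin 2) (Fin 2) (ZMod ℓ)
  surj : Function.Surjective ψ
  ker : ∀ x, ψ x = 0 → (ℓ:ℚ)⁻¹ • x.1 ∈ C.Λ
  det : ∀ x (n : ℤ), (n:ℚ) = C.nm x.1 → (ψ x).det = n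
  tr : ∀ x (t : ℤ), (t:ℚ) = C.tr x.1 → (ψ x).trace = t

theorem Ctx.psi (C : Ctx p A) [Fact p.Prime] {ℓ : ℕ} [Fact ℓ.Prime] (hl : ℓ ≠ p) : Nonempty (Psi C ℓ) := by
  obtain ⟨ψ, h1, h2, h3, h4⟩ := C.exists_psi hl
  exact ⟨⟨hl, ψ, h1, h2, h3, h4⟩⟩

variable {C : Ctx p A} {ℓ : ℕ} [Fact ℓ.Prime] [Fact p.Prime] (P : Psi C ℓ)

theorem Psi.ne_zero_of {x : C.Λ} (h : P.ψ x ≠ 0) : (ℓ:ℚ)⁻¹ • x.1 ∉ C.Λ := by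
  intro hx
  apply h
  have hl0 : (ℓ : ℚ) ≠ 0 := by exact_mod_cast (Fact.out : ℓ.Prime).ne_zero
  have : x = (ℓ : C.Λ) * ⟨_, hx⟩ := by
    apply Subtype.ext
    push_cast
    rw [mul_smul_comm]
    have : ((ℓ:ℕ):A) * x.1 = (ℓ:ℚ) • x.1 := by rw [← nsmul_eq_mul, Nat.cast_smul_eq_nsmul]
    rw [this, smul_smul, inv_mul_cancel₀ hl0, one_smul]
  rw [this, map_mul, map_natCast]
  simp [CharP.cast_eq_zero]

theorem Psi.unif {M : Matrix (Fin 2) (Fin 2) (ZMod ℓ)} (hM : M ≠ 0) (hdet : M.det = 0) :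
    ∃ x, P.ψ x = M ∧ ∃ m : ℤ, (ℓ * m : ℚ) = C.nm x.1 ∧ ¬ (ℓ:ℤ) ∣ m := by
  have hl0 : (ℓ : ℚ) ≠ 0 := by exact_mod_cast (Fact.out : ℓ.Prime).ne_zero
  obtain ⟨x, rfl⟩ := P.surj M
  obtain ⟨n, hn⟩ := (C.F1 x.2).2
  rw [P.det x n hn, ZMod.intCast_zmod_eq_zero_iff_dvd] at hdet
  obtain ⟨m, rfl⟩ := hdet
  by_cases hm : (ℓ:ℤ) ∣ m
  swap
  · exact ⟨x, rfl, m, by rw [← hn]; push_cast; rfl, hm⟩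
  have hx := P.ne_zero_of hM
  have : ¬ ∀ y ∈ C.Λ, IsZ ((ℓ:ℚ)⁻¹ * C.tr (C.cj x.1 * y)) := by
    intro h
    apply hx
    have := C.cj_mem (C.L1 P.hlp (C.cj_mem x.2) h)
    rwa [C.cj_smul, C.cj_cj] at this
  push Not at this
  obtain ⟨y, hy, hyt⟩ := this
  obtain ⟨t, ht⟩ := (C.F1 (C.Λ.mul_mem (C.cj_mem x.2) hy)).1
  obtain ⟨k, hk⟩ := (C.F1 hy).2
  have htl : ¬ (ℓ:ℤ) ∣ t := by
    rintro ⟨s, rfl⟩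
    apply hyt
    refine ⟨s, ?_⟩
    rw [← ht]; push_cast; field_simp
  refine ⟨x + (ℓ : C.Λ) * ⟨y, hy⟩, ?_, m + t + ℓ * k, ?_, ?_⟩
  · rw [map_add, map_mul, map_natCast]
    simp [CharP.cast_eq_zero]
  · have : ((x + (ℓ : C.Λ) * ⟨y, hy⟩ : C.Λ) : A) = x.1 + (ℓ:ℚ) • y := by
      push_cast
      rw [← nsmul_eq_mul, Nat.cast_smul_eq_nsmul]
    rw [this, C.nm_add, C.nm_smul, mul_smul_comm, map_smul, ← ht, ← hn, ← hk, smul_eq_mul]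
    push_cast; ring
  · intro h
    apply htl
    have h2 : (ℓ:ℤ) ∣ (m + t + ℓ * k) - m - ℓ * k := dvd_sub (dvd_sub h hm) (dvd_mul_right _ _)
    have e : (m + t + ℓ * k) - m - ℓ * k = t := by ring
    rwa [e] at h2

def Psi.JI (r : Fin 2 → ZMod ℓ) : AddSubgroup A where
  carrier := {x | ∃ h : x ∈ C.Λ, Matrix.vecMul r (P.ψ ⟨x, h⟩) = 0}
  add_mem' := by
    rintro x y ⟨hx, h1⟩ ⟨hy, h2⟩
    refine ⟨C.Λ.add_mem hx hy, ?_⟩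
    have : (⟨x + y, C.Λ.add_mem hx hy⟩ : C.Λ) = ⟨x, hx⟩ + ⟨y, hy⟩ := rfl
    rw [this, map_add, Matrix.vecMul_add, h1, h2, add_zero]
  zero_mem' := by
    refine ⟨C.Λ.zero_mem, ?_⟩
    have : (⟨0, C.Λ.zero_mem⟩ : C.Λ) = 0 := rfl
    rw [this, map_zero, Matrix.vecMul_zero]
  neg_mem' := by
    rintro x ⟨hx, h1⟩
    refine ⟨C.Λ.neg_mem hx, ?_⟩
    have : (⟨-x, C.Λ.neg_mem hx⟩ : C.Λ) = -⟨x, hx⟩ := rfl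
    rw [this, map_neg, Matrix.vecMul_neg, h1, neg_zero]

theorem Psi.mem_JI {r : Fin 2 → ZMod ℓ} {x : A} : x ∈ P.JI r ↔ ∃ h : x ∈ C.Λ, Matrix.vecMul r (P.ψ ⟨x, h⟩) = 0 := Iff.rfl

theorem Psi.det_zero {r : Fin 2 → ZMod ℓ} (hr : r ≠ 0) {x : A} (hx : x ∈ P.JI r) : ∃ m : ℤ, (ℓ * m : ℚ) = C.nm x := by
  obtain ⟨h, hx⟩ := hx
  obtain ⟨n, hn⟩ := (C.F1 h).2
  have hd : (P.ψ ⟨x, h⟩).det = 0 := Matrix.exists_vecMul_eq_zero_iff.1 ⟨r, hr, hx⟩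
  rw [P.det _ n hn, ZMod.intCast_zmod_eq_zero_iff_dvd] at hd
  obtain ⟨m, rfl⟩ := hd
  exact ⟨m, by rw [← hn]; push_cast; rfl⟩

def Psi.J (r : Fin 2 → ZMod ℓ) (hr : r ≠ 0) : Lat C where
  I := P.JI r
  le := fun x hx => hx.1
  right := by
    rintro x ⟨hx, h1⟩ a ha
    refine ⟨C.Λ.mul_mem hx ha, ?_⟩
    have : (⟨x * a, C.Λ.mul_mem hx ha⟩ : C.Λ) = ⟨x, hx⟩ * ⟨a, ha⟩ := rfl
    rw [this, map_mul, ← Matrix.vecMul_vecMul, h1, Matrix.zero_vecMul]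
  N := ℓ
  hN := by exact_mod_cast (Fact.out : ℓ.Prime).pos
  int := by
    intro y hy
    obtain ⟨m, hm⟩ := P.det_zero hr hy
    refine ⟨m, ?_⟩
    have hl0 : (ℓ : ℚ) ≠ 0 := by exact_mod_cast (Fact.out : ℓ.Prime).ne_zero
    rw [← hm]; field_simp
  prim := by
    intro q hq
    have hl0 : (ℓ : ℚ) ≠ 0 := by exact_mod_cast (Fact.out : ℓ.Prime).ne_zero
    by_cases h : q = ℓ
    · subst h
      obtain ⟨x, hx, m, hm, hd⟩ := P.unif (M := !![r 1, 0; -r 0, 0]) (by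
        intro h0
        apply hr
        have a0 := congrFun (congrFun h0 0) 0
        have a1 := congrFun (congrFun h0 1) 0
        simp at a0 a1
        funext i; fin_cases i
        · exact a1
        · exact a0) (by simp [Matrix.det_fin_two])
      refine ⟨x.1, ⟨x.2, ?_⟩, m, ?_, hd⟩
      · rw [show (⟨x.1, x.2⟩ : C.Λ) = x from rfl, hx]
        funext i; fin_cases i <;> simp [Matrix.vecMul, dotProduct, Fin.sum_univ_two]; ring
      · rw [← hm]; field_simp
    · refine ⟨(ℓ:A), ⟨natCast_mem C.Λ ℓ, ?_⟩, ℓ, ?_, ?_⟩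
      · rw [show (⟨(ℓ:A), natCast_mem C.Λ ℓ⟩ : C.Λ) = (ℓ : C.Λ) from rfl, map_natCast]
        simp [CharP.cast_eq_zero]
      · have : (ℓ:A) = (ℓ:ℚ) • (1:A) := by rw [Nat.cast_smul_eq_nsmul, nsmul_eq_mul, mul_one]
        rw [this, C.nm_smul, C.nm_one]; push_cast; field_simp
      · intro hd
        have : q ∣ ℓ := by exact_mod_cast hd
        exact h ((Nat.prime_dvd_prime_iff_eq hq Fact.out).1 this)

theorem exists_row {r : Fin 2 → ZMod ℓ} (hr : r ≠ 0) (r' : Fin 2 → ZMod ℓ) :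
    ∃ M : Matrix (Fin 2) (Fin 2) (ZMod ℓ), Matrix.vecMul r M = r' := by
  obtain ⟨i, hi⟩ := Function.ne_iff.1 hr
  refine ⟨Matrix.vecMulVec (Pi.single i (r i)⁻¹) r', ?_⟩
  rw [Matrix.vecMul_vecMulVec, dotProduct_single, mul_inv_cancel₀ hi, one_smul]

theorem Psi.stab {r r' : Fin 2 → ZMod ℓ} (hr : r ≠ 0) (hr' : r' ≠ 0) : Stab (P.J r hr) (P.J r' hr') := by
  have key : ∀ {r r' : Fin 2 → ZMod ℓ}, ∀ z z' : C.Λ, Matrix.vecMul r (P.ψ z) = r' → Matrix.vecMul r' (P.ψ z') = r →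
     (∀ j ∈ P.JI r, z'.1 * j ∈ P.JI r') ∧ (∀ a ∈ C.Λ, a - z.1 * z'.1 * a ∈ P.JI r) := by
    intro r r' z z' h1 h2
    constructor
    · rintro j ⟨hj, hj0⟩
      refine ⟨C.Λ.mul_mem z'.2 hj, ?_⟩
      rw [show (⟨z'.1 * j, C.Λ.mul_mem z'.2 hj⟩ : C.Λ) = z' * ⟨j, hj⟩ from rfl, map_mul, ← Matrix.vecMul_vecMul, h2, hj0]
    · intro a ha
      have hm := C.Λ.sub_mem ha (C.Λ.mul_mem (C.Λ.mul_mem z.2 z'.2) ha)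
      refine ⟨hm, ?_⟩
      rw [show (⟨a - z.1 * z'.1 * a, hm⟩ : C.Λ) = ⟨a, ha⟩ - z * z' * ⟨a, ha⟩ from rfl, map_sub, map_mul, map_mul,
        Matrix.vecMul_sub, ← Matrix.vecMul_vecMul, ← Matrix.vecMul_vecMul, h1, h2, sub_self]
  obtain ⟨M, hM⟩ := exists_row hr r'
  obtain ⟨M', hM'⟩ := exists_row hr' r
  obtain ⟨z, rfl⟩ := P.surj M
  obtain ⟨z', rfl⟩ := P.surj M'
  have k1 := key z z' hM hM'
  have k2 := key z' z hM' hM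
  exact ⟨z.1, z.2, z'.1, z'.2, k1.1, k2.1, k2.2, k1.2⟩

end
end CQ

namespace CQ

section
variable {p : ℕ} {A : Type*} [Ring A] [Algebra ℚ A]

theorem QD.comm_nm (Q : QD A) (x y : A) : 4 * Q.nm (x * y - y * x) =
    (4 * Q.nm x - Q.tr x ^ 2) * (4 * Q.nm y - Q.tr y ^ 2) - (2 * Q.tr (Q.cj x * y) - Q.tr x * Q.tr y) ^ 2 := by
  simp only [QD.nm, QD.tr_def, map_sub, map_mul, Q.e_cj]
  generalize Q.e x = u
  generalize Q.e y = v
  simp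
  ring

def Ctx.tl (C : Ctx p A) : Lat C where
  I := C.Λ.toAddSubgroup
  le := le_refl _
  right := fun x hx a ha => C.Λ.mul_mem hx ha
  N := 1
  hN := one_pos
  int := fun y hy => by rw [div_one]; exact (C.F1 hy).2
  prim := fun ℓ hl => ⟨1, C.Λ.one_mem, 1, by rw [C.nm_one]; norm_num, by
    intro h
    have : ℓ ∣ 1 := by exact_mod_cast h
    exact hl.one_lt.ne' (Nat.dvd_one.1 this)⟩

theorem Ctx.tl_b (C : Ctx p A) (x y : A) : C.tl.b x y = C.tr (C.cj x * y) := by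
  rw [Lat.b_def]; exact div_one _

theorem Ctx.tl_bs (C : Ctx p A) (x : A) : C.tl.b x x = 2 * C.nm x := by
  rw [C.tl_b, C.cj_mul_self, C.tr_smul_one]

theorem Ctx.tl_b1 (C : Ctx p A) (x : A) : C.tl.b 1 x = C.tr x := by
  rw [C.tl_b, C.cj_one, one_mul]

theorem Ctx.tl_d3 (C : Ctx p A) (x y : A) : C.tl.d3 1 x y = 2 * C.nm (x * y - y * x) := by
  have := C.comm_nm x y
  unfold Lat.d3
  rw [C.tl_b1 x, C.tl_b1 y, C.tl_bs 1, C.tl_bs x, C.tl_bs y, C.tl_b x y, C.nm_one]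
  linear_combination (-1/2) * this

theorem Ctx.kan (C : Ctx p A) [Fact p.Prime] (hp2 : p ≠ 2) {x y : A} (hx : x ∈ C.Λ) (hy : y ∈ C.Λ) :
    ∃ m : ℤ, C.nm (x * y - y * x) = p * m := by
  obtain ⟨m, hm⟩ := C.tl.det3 (show (1:A) ∈ C.tl.I from C.Λ.one_mem) (show x ∈ C.tl.I from hx) (show y ∈ C.tl.I from hy)
  obtain ⟨n, hn⟩ := (C.F1 (C.Λ.sub_mem (C.Λ.mul_mem hx hy) (C.Λ.mul_mem hy hx))).2
  rw [C.tl_d3, ← hn] at hm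
  have h1 : 2 * n = p * m := by exact_mod_cast hm
  have hpo : p % 2 = 1 := (Fact.out : p.Prime).eq_two_or_odd.resolve_left hp2
  have hm2 : (2:ℤ) ∣ m := by
    have : (2:ℤ) ∣ p * m := ⟨n, h1.symm⟩
    rcases Int.prime_two.dvd_or_dvd this with h | h
    · omega
    · exact h
  obtain ⟨k, rfl⟩ := hm2
  refine ⟨k, ?_⟩
  rw [← hn]
  have : n = p * k := by linarith
  rw [this]; push_cast; rfl

theorem Ctx.kan_pos (C : Ctx p A) [Fact p.Prime] (hp2 : p ≠ 2) {x y : A} (hx : x ∈ C.Λ) (hy : y ∈ C.Λ)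
    (h : x * y - y * x ≠ 0) : (p:ℚ) ≤ C.nm (x * y - y * x) := by
  obtain ⟨m, hm⟩ := C.kan hp2 hx hy
  have := C.nm_pos h
  rw [hm] at this ⊢
  have hp0 : (0:ℚ) < p := by exact_mod_cast (Fact.out : p.Prime).pos
  have h1 : (0:ℚ) < m := pos_of_mul_pos_right this hp0.le
  have h2 : (1:ℚ) ≤ m := by exact_mod_cast h1
  nlinarith

/-- two independent rows killed by a matrix -/
theorem rows2 {ℓ : ℕ} [Fact ℓ.Prime] {r r' : Fin 2 → ZMod ℓ} {M : Matrix (Fin 2) (Fin 2) (ZMod ℓ)}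
    (hr : r 0 * r' 1 - r 1 * r' 0 ≠ 0) (h : Matrix.vecMul r M = 0) (h' : Matrix.vecMul r' M = 0) : M = 0 := by
  have a : ∀ j, r 0 * M 0 j + r 1 * M 1 j = 0 := by
    intro j
    have := congrFun h j
    simpa [Matrix.vecMul, dotProduct, Fin.sum_univ_two] using this
  have a' : ∀ j, r' 0 * M 0 j + r' 1 * M 1 j = 0 := by
    intro j
    have := congrFun h' j
    simpa [Matrix.vecMul, dotProduct, Fin.sum_univ_two] using this
  ext i j
  have h0 : M 0 j = 0 := by
    apply (mul_eq_zero.1 (show (r 0 * r' 1 - r 1 * r' 0) * M 0 j = 0 by linear_combination r' 1 * a j - r 1 * a' j)).resolve_left hr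
  have h1 : M 1 j = 0 := by
    apply (mul_eq_zero.1 (show (r 0 * r' 1 - r 1 * r' 0) * M 1 j = 0 by linear_combination r 0 * a' j - r' 0 * a j)).resolve_left hr
  fin_cases i
  · exact h0
  · exact h1

theorem Canc.unitstep {C : Ctx p A} [Fact p.Prime] (H : Canc C) {ℓ : ℕ} [Fact ℓ.Prime] (hl : ℓ ≠ p)
    {s : A} (hs : s ∈ C.Λ) (hn : C.nm s = ℓ) (t : ℤ) (ht : C.tr s = ℓ * t) :
    ∃ y ∈ C.Λ, C.nm y = ℓ ∧ s * y - y * s ≠ 0 := by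
  obtain ⟨P⟩ := C.psi hl
  have hl0 : (ℓ : ℚ) ≠ 0 := by exact_mod_cast (Fact.out : ℓ.Prime).ne_zero
  have hl1 := (Fact.out : ℓ.Prime).one_lt
  have hnz : ∀ (y : C.Λ), C.nm y.1 = ℓ → P.ψ y ≠ 0 := by
    intro y hy h
    obtain ⟨m, hm⟩ := (C.F1 (P.ker y h)).2
    rw [C.nm_smul, hy] at hm
    have h1 : (ℓ:ℚ) * m = 1 := by rw [hm]; field_simp
    have h2 : (ℓ:ℤ) * m = 1 := by exact_mod_cast h1
    have h3 : (ℓ:ℤ) ∣ 1 := ⟨m, h2.symm⟩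
    have : ℓ ∣ 1 := by exact_mod_cast h3
    exact hl1.ne' (Nat.dvd_one.1 this)
  set S : C.Λ := ⟨s, hs⟩ with hS
  have hS0 : P.ψ S ≠ 0 := hnz S hn
  have hSS : P.ψ S * P.ψ S = 0 := by
    have : S * S = (ℓ : C.Λ) * ((t : C.Λ) * S - 1) := by
      apply Subtype.ext
      push_cast
      rw [hS]
      simp only
      rw [C.sq, ht, hn, mul_sub, mul_one, ← mul_assoc]
      rw [show ((ℓ:ℚ) * t) = ((ℓ * t : ℤ) : ℚ) by push_cast; rfl, Int.cast_smul_eq_zsmul, zsmul_eq_mul, Nat.cast_smul_eq_nsmul, nsmul_eq_mul, mul_one]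
      push_cast; rfl
    rw [← map_mul, this, map_mul, map_natCast]
    simp [CharP.cast_eq_zero]
  obtain ⟨r', hr'⟩ : ∃ r' : Fin 2 → ZMod ℓ, Matrix.vecMul r' (P.ψ S) ≠ 0 := by
    by_contra hcon
    push Not at hcon
    apply hS0
    apply rows2 (r := ![1, 0]) (r' := ![0, 1]) (by simp) (hcon _) (hcon _)
  set r := Matrix.vecMul r' (P.ψ S) with hr
  have hrs : Matrix.vecMul r (P.ψ S) = 0 := by rw [hr, Matrix.vecMul_vecMul, hSS, Matrix.vecMul_zero]
  have hr'0 : r' ≠ 0 := by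
    rintro h; apply hr'; rw [hr, h, Matrix.zero_vecMul]
  have hind : r 0 * r' 1 - r 1 * r' 0 ≠ 0 := by
    intro h0
    apply hr'
    have e : ∀ i, r i • r' = r' i • r := by
      intro i; funext j
      fin_cases i <;> fin_cases j <;> simp <;> first | ring1 | linear_combination h0 | linear_combination -h0
    obtain ⟨i, hi⟩ := Function.ne_iff.1 hr'
    have : Matrix.vecMul (r i • r') (P.ψ S) = 0 := by rw [e, Matrix.smul_vecMul, hrs, smul_zero]
    rw [Matrix.smul_vecMul, smul_eq_zero] at this
    exact this.resolve_left hi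
  obtain ⟨x, hx1, hx⟩ := H.nm_one (L := P.J r hr') (L' := P.J r' hr'0) rfl (P.stab _ _)
  have hy : x * s ∈ P.JI r' := (hx _).2 ⟨s, ⟨hs, hrs⟩, rfl⟩
  obtain ⟨hyΛ, hy0⟩ := hy
  have hyn : C.nm (x * s) = ℓ := by rw [C.nm_mul, hx1, one_mul, hn]
  refine ⟨x * s, hyΛ, hyn, ?_⟩
  intro hc
  set Y : C.Λ := ⟨x * s, hyΛ⟩ with hY
  have hcom : S * Y = Y * S := Subtype.ext (sub_eq_zero.1 hc)
  apply hnz Y hyn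
  refine rows2 hind ?_ hy0
  rw [hr, Matrix.vecMul_vecMul, ← map_mul, hcom, map_mul, ← Matrix.vecMul_vecMul, hy0, Matrix.zero_vecMul]

theorem comm_aff (s x y : A) (a b : ℚ) (h : s = a • x + b • 1) : s * y - y * s = a • (x * y - y * x) := by
  rw [h]
  simp only [add_mul, mul_add, smul_mul_assoc, mul_smul_comm, one_mul, mul_one, smul_sub]
  abel

theorem Canc.noQ {C : Ctx p A} [Fact p.Prime] (H : Canc C) (hp : 11 ≤ p) {x : A} (hx : x ∈ C.Λ) :
    4 * C.nm x - C.tr x ^ 2 ≠ 3 ∧ 4 * C.nm x - C.tr x ^ 2 ≠ 4 := by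
  obtain ⟨⟨t, ht⟩, ⟨n, hn⟩⟩ := C.F1 hx
  have hpq : (11:ℚ) ≤ p := by exact_mod_cast hp
  have key : ∀ {ℓ : ℕ} [Fact ℓ.Prime] (hl : ℓ ≠ p) (s : A) (hs : s ∈ C.Λ) (hn : C.nm s = ℓ)
     (t' : ℤ) (ht' : C.tr s = ℓ * t') (a b : ℚ) (h : s = a • x + b • 1)
     (hle : (4 * C.nm x - C.tr x ^ 2) * (4 * ℓ) ≤ 36) (h0 : 0 ≤ 4 * C.nm x - C.tr x ^ 2), False := by
    intro ℓ _ hl s hs hn t' ht' a b h hle h0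
    obtain ⟨y, hy, hyn, hc⟩ := H.unitstep hl hs hn t' ht'
    have h1 : x * y - y * x ≠ 0 := by
      intro h2; apply hc; rw [comm_aff s x y a b h, h2, smul_zero]
    have h2 := C.kan_pos (by omega) hx hy h1
    have h3 := C.comm_nm x y
    rw [hyn] at h3
    nlinarith [mul_nonneg h0 (sq_nonneg (C.tr y)), sq_nonneg (2 * C.tr (C.cj x * y) - C.tr x * C.tr y)]
  constructor
  · intro hQ
    haveI : Fact (Nat.Prime 3) := ⟨Nat.prime_three⟩
    refine key (ℓ := 3) (by omega) ((2:ℚ) • x + (-t:ℚ) • 1) ?_ ?_ 0 ?_ 2 (-t) rfl (by rw [hQ]; norm_num) (by rw [hQ]; norm_num)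
    · exact C.Λ.add_mem (by exact_mod_cast C.int_smul_mem hx 2) (by exact_mod_cast C.int_smul_mem C.Λ.one_mem (-t))
    · rw [C.nm_add, C.nm_smul, C.nm_smul, C.nm_one, C.cj_smul, smul_mul_smul_comm, mul_one, map_smul, mul_one, C.tr_cj, ← ht, smul_eq_mul]
      rw [← ht] at hQ; push_cast; linear_combination hQ
    · rw [map_add, map_smul, map_smul, C.tr_one, ← ht]; simp; ring
  · intro hQ
    haveI : Fact (Nat.Prime 2) := ⟨Nat.prime_two⟩
    have hte : ∃ u, t = 2 * u := by
      have : 4 * n - t ^ 2 = 4 := by rw [← hn, ← ht] at hQ; exact_mod_cast hQ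
      have h2 : (2:ℤ) ∣ t ^ 2 := by omega
      exact Int.prime_two.dvd_of_dvd_pow h2
    obtain ⟨u, rfl⟩ := hte
    push_cast at ht
    refine key (ℓ := 2) (by omega) ((1:ℚ) • x + (1-u:ℚ) • 1) ?_ ?_ 1 ?_ 1 (1-u) rfl (by rw [hQ]; norm_num) (by rw [hQ]; norm_num)
    · exact C.Λ.add_mem (by exact_mod_cast C.int_smul_mem hx 1) (by exact_mod_cast C.int_smul_mem C.Λ.one_mem (1-u))
    · rw [C.nm_add, C.nm_smul, C.nm_smul, C.nm_one, C.cj_smul, smul_mul_smul_comm, mul_one, map_smul, mul_one, C.tr_cj, ← ht, smul_eq_mul]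
      rw [← ht] at hQ; push_cast; linear_combination hQ / 4
    · rw [map_add, map_smul, map_smul, C.tr_one, ← ht]; simp; ring

end
end CQ

namespace CQ

section
variable {p : ℕ} {A : Type*} [Ring A] [Algebra ℚ A]

theorem isZ_of_sq {q : ℚ} (h : IsZ (q ^ 2)) : IsZ q := by
  obtain ⟨m, hm⟩ := h
  refine ⟨q.num, ?_⟩
  have h1 : (q ^ 2).den = 1 := by rw [← hm]; exact Rat.den_intCast m
  rw [Rat.den_pow] at h1
  have h2 : q.den = 1 := by
    have := Nat.pow_eq_one.1 h1
    omega
  exact Rat.coe_int_num_of_den_eq_one h2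

theorem Ctx.exists_basis_one (C : Ctx p A) : ∃ e : Fin 4 → A, IsB C.Λ.toAddSubgroup e ∧ (e 0 = 1 ∨ e 0 = -1) := by
  let M : Submodule ℤ A := AddSubgroup.toIntSubmodule C.Λ.toAddSubgroup
  haveI : Module.Finite ℚ A := Module.finite_of_finrank_pos (by rw [C.finrank_four]; norm_num)
  haveI : M.IsLattice ℚ := by
    constructor
    · have h1 : Module.Finite ℤ C.Λ.toAddSubgroup :=
        Module.Finite.iff_addGroup_fg.2 (AddGroup.fg_iff_addSubgroup_fg _ |>.2 C.fg)
      have h2 : Module.Finite ℤ M := h1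
      exact (Module.Finite.iff_fg).1 h2
    · exact C.span
  haveI : Module.Free ℤ M := Submodule.IsLattice.free ℚ M
  let b0 := Module.finBasisOfFinrankEq ℤ M (n := 4)
    (by rw [← C.finrank_four]; exact congrArg Cardinal.toNat (Submodule.IsLattice.rank' ℚ M))
  let o : M := ⟨1, C.Λ.one_mem⟩
  haveI := C.nontriv
  have ho : o ≠ 0 := fun h => one_ne_zero (congrArg Subtype.val h)
  obtain ⟨n, S⟩ := Submodule.smithNormalForm b0 (Submodule.span ℤ {o})
  have hn : ∃ i : Fin n, True := by
    by_contra hcon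
    push Not at hcon
    haveI : IsEmpty (Fin n) := ⟨fun i => hcon i⟩
    have h0 : (⟨o, Submodule.mem_span_singleton_self o⟩ : Submodule.span ℤ {o}) = 0 := by
      haveI := S.bN.repr.toEquiv.subsingleton
      exact Subsingleton.elim _ _
    exact ho (congrArg Subtype.val h0)
  obtain ⟨i, -⟩ := hn
  have h1 := S.snf i
  obtain ⟨k, hk⟩ := Submodule.mem_span_singleton.1 (S.bN i).2
  have hbn0 : ((S.bN i : Submodule.span ℤ {o}) : M) ≠ 0 := by
    intro h; exact S.bN.ne_zero i (Subtype.ext h)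
  have ha0 : S.a i ≠ 0 := by
    intro h; rw [h, zero_smul] at h1; exact hbn0 h1
  set v := S.bM (S.f i) with hv
  have h2 : k • o = S.a i • v := by rw [hk, h1]
  have h3 : v.1 = ((k:ℚ) / S.a i) • (1:A) := by
    have h4 : k • (1:A) = S.a i • v.1 := congrArg Subtype.val h2
    rw [← Int.cast_smul_eq_zsmul ℚ, ← Int.cast_smul_eq_zsmul ℚ] at h4
    rw [div_eq_inv_mul, mul_smul, h4, smul_smul, inv_mul_cancel₀ (by exact_mod_cast ha0), one_smul]
  have h5 : IsZ ((k:ℚ) / S.a i) := by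
    apply isZ_of_sq
    have := (C.F1 v.2).2
    rw [h3, C.nm_smul, C.nm_one, mul_one] at this
    exact this
  obtain ⟨m, hm⟩ := h5
  have h6 : v = m • o := by
    apply Subtype.ext
    rw [h3, ← hm, Int.cast_smul_eq_zsmul]; rfl
  have h7 : m * S.bM.repr o (S.f i) = 1 := by
    have := congrArg (fun w => S.bM.repr w (S.f i)) h6
    simp only [hv, Module.Basis.repr_self, Finsupp.single_eq_same, map_smul, Finsupp.smul_apply, smul_eq_mul] at this
    exact this.symm
  have h8 := Int.eq_one_or_neg_one_of_mul_eq_one h7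
  let b := S.bM.reindex (Equiv.swap (S.f i) 0)
  refine ⟨fun i => (b i).val, ⟨?_, fun i => (b i).2, ?_⟩, ?_⟩
  · have := (b.extendOfIsLattice ℚ).linearIndependent
    have hfun : (fun i => (b i).val) = ⇑(b.extendOfIsLattice ℚ) :=
      funext fun i => (Module.Basis.extendOfIsLattice_apply ..).symm
    rw [hfun]; exact this
  · intro x hx
    refine ⟨fun i => b.repr ⟨x, hx⟩ i, ?_⟩
    have := congrArg Subtype.val (b.sum_repr ⟨x, hx⟩)
    simp only [Submodule.coe_sum, Submodule.coe_smul] at this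
    conv_lhs => rw [← this]
    apply Finset.sum_congr rfl
    intro k _
    rw [Int.cast_smul_eq_zsmul]
  · have hb : b 0 = v := by
      simp only [b, Module.Basis.reindex_apply, Equiv.symm_swap, Equiv.swap_apply_right]; rfl
    simp only [hb]
    rw [h3, ← hm]
    rcases h8 with h | h
    · left; rw [h]; simp
    · right; rw [h]; simp

theorem Canc.ne11 {C : Ctx p A} [Fact p.Prime] (H : Canc C) : p ≠ 11 := by
  intro hp
  obtain ⟨e, he, he0⟩ := C.exists_basis_one
  have hT := Lat.T_of_basis (L := C.tl) he
  have hneg : ∀ x : A, C.tl.d3 (-1) x = C.tl.d3 1 x ∧ C.tl.d2 (-1) x = C.tl.d2 1 x ∧ C.tl.b (-1) (-1) = C.tl.b 1 1 := by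
    intro x
    refine ⟨?_, ?_, ?_⟩
    · funext y; unfold Lat.d3; simp
    · unfold Lat.d2; simp
    · simp
  obtain ⟨x, hx, y, z, w, ⟨⟨hxI, hy, hz, hw⟩, h1, h2, h3, h4, h5⟩, -, h6, -, -, h7, h8⟩ :=
    Lat.LLL (L := C.tl) {x | x = 1 ∨ x = -1} ⟨e 0, he0, e 1, e 2, e 3, hT⟩
  have hb : C.tl.b x x = 2 := by
    rcases hx with rfl | rfl
    · rw [C.tl_bs, C.nm_one]; norm_num
    · rw [(hneg 1).2.2, C.tl_bs, C.nm_one]; norm_num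
  have hd2 : C.tl.d2 x y = 4 * C.nm y - C.tr y ^ 2 := by
    have : C.tl.d2 1 y = 4 * C.nm y - C.tr y ^ 2 := by
      unfold Lat.d2; rw [C.tl_b1 y, C.tl_bs 1, C.tl_bs y, C.nm_one]; ring
    rcases hx with rfl | rfl
    · exact this
    · rw [(hneg y).2.1, this]
  have hd3 : C.tl.d3 x y z = 2 * C.nm (y * z - z * y) := by
    rcases hx with rfl | rfl
    · exact C.tl_d3 y z
    · rw [(hneg y).1]; exact C.tl_d3 y z
  have hyΛ : y ∈ C.Λ := hy
  have hzΛ : z ∈ C.Λ := hz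
  obtain ⟨k, hk⟩ := C.kan (by omega) hyΛ hzΛ
  obtain ⟨⟨t, ht⟩, ⟨n, hn⟩⟩ := C.F1 hyΛ
  rw [hb] at h7
  rw [hd3, hk] at h3 h7 h8
  have hQ := C.tl.d4 x y z w
  have hpq : (p:ℚ) = 11 := by rw [hp]; norm_num
  rw [hpq] at h3 h5 h7 h8
  rw [hd2, ← ht, ← hn] at h2 h7 h8
  have hD : 3 * (2 * (11 * (k:ℚ))) ^ 2 ≤ 4 * ((4 * n - t ^ 2) * 11 ^ 2) := by nlinarith
  set D := 4 * n - t ^ 2 with hDef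
  have i1 : 3 * k ^ 2 ≤ D := by
    have : (3 * k ^ 2 : ℚ) ≤ ((4 * n - t ^ 2 : ℤ) : ℚ) := by push_cast; linarith
    exact_mod_cast this
  have i2 : 3 * D ^ 2 ≤ 176 * k := by
    have : (3 * ((4 * n - t ^ 2 : ℤ) : ℚ) ^ 2) ≤ 176 * k := by push_cast; linarith
    exact_mod_cast this
  have i3 : 0 < k := by
    have : (0:ℚ) < k := by linarith
    exact_mod_cast this
  have i4 : k < 2 := by
    by_contra hh
    push Not at hh
    have a1 : 2 * k ≤ k ^ 2 := by nlinarith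
    have a2 : 12 ≤ D := by nlinarith
    nlinarith
  have i5 : k = 1 := by omega
  subst i5
  have i6 : D ≤ 7 := by nlinarith
  have i7 : 3 ≤ D := by linarith
  have hmod : D % 4 = 0 ∨ D % 4 = 3 := by
    rw [hDef]
    rcases Int.even_or_odd' t with ⟨u, rfl | rfl⟩
    · left; ring_nf; omega
    · right; ring_nf; omega
  have hDq : 4 * C.nm y - C.tr y ^ 2 = D := by rw [← hn, ← ht, hDef]; push_cast; ring
  have hno := H.noQ (by omega) hyΛ
  rw [hDq] at hno
  have hD7 : D = 7 := by
    have a1 : D ≠ 3 := fun h => hno.1 (by rw [h]; norm_num)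
    have a2 : D ≠ 4 := fun h => hno.2 (by rw [h]; norm_num)
    omega
  apply C.simple_root (x := y) ?_ t n (6 * (t + 2)) ht hn
  · rw [hp]
    push_cast
    have : 4 * ((6 * (t + 2)) ^ 2 - t * (6 * (t + 2)) + n) = 11 * (11 * t ^ 2 + 48 * t + 53) := by
      rw [hD7] at hDef
      linear_combination -hDef
    omega
  · rw [hp]; push_cast; omega
  · intro c hc
    rw [hc, C.nm_smul, C.nm_one, C.tr_smul_one, hD7] at hDq
    push_cast at hDq
    linarith

theorem Canc.w {C : Ctx p A} [Fact p.Prime] [Fact (Nat.Prime 2)] (H : Canc C) (hp : 11 ≤ p) (P : Psi C 2) {r r' : Fin 2 → ZMod 2}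
   (hr : r ≠ 0) (hr' : r' ≠ 0) (hne : r 0 * r' 1 - r 1 * r' 0 ≠ 0) :
   ∃ w : C.Λ, ∃ t : ℤ, (t:ℚ) = C.tr w.1 ∧ C.nm w.1 = 4 ∧ P.ψ w ≠ 0 ∧ Matrix.vecMul r (P.ψ w) = 0 ∧
     Matrix.vecMul r' ((t : Matrix (Fin 2) (Fin 2) (ZMod 2)) - P.ψ w) = 0 := by
  obtain ⟨x, hx1, hx⟩ := H.nm_one (L := P.J r' hr') (L' := P.J r hr) rfl (P.stab _ _)
  have h2 : ∀ r : Fin 2 → ZMod 2, (2:A) ∈ P.JI r := by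
    intro r
    refine ⟨ofNat_mem C.Λ 2, ?_⟩
    rw [show (⟨(2:A), ofNat_mem C.Λ 2⟩ : C.Λ) = ((2:ℕ) : C.Λ) from rfl, map_natCast, CharP.cast_eq_zero, Matrix.vecMul_zero]
  obtain ⟨hw, hw0⟩ := (hx _).2 ⟨2, h2 r', rfl⟩
  have hx2 : x * 2 = (2:ℚ) • x := by rw [mul_two, two_smul]
  obtain ⟨t, ht⟩ := (C.F1 hw).1
  have hx0 : x ≠ 0 := by rintro rfl; rw [C.nm_zero] at hx1; norm_num at hx1
  have hivx : C.iv x = C.cj x := by unfold QD.iv; rw [hx1, inv_one, one_smul]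
  refine ⟨⟨x * 2, hw⟩, t, ht, ?_, ?_, hw0, ?_⟩
  · simp only; rw [hx2, C.nm_smul, hx1]; norm_num
  · intro h0
    have hxΛ := P.ker _ h0
    simp only [hx2, smul_smul] at hxΛ
    norm_num at hxΛ
    obtain ⟨s, hs⟩ := (C.F1 hxΛ).1
    have hno := H.noQ hp hxΛ
    rw [hx1, ← hs] at hno
    have hQ := C.nm_nonneg (x - (s/2:ℚ) • 1)
    have hQe : C.nm (x - (s/2:ℚ) • 1) = (4 - (s:ℚ)^2) / 4 := by
      rw [sub_eq_add_neg, C.nm_add, C.nm_neg, C.nm_smul, C.nm_one, mul_neg, mul_smul_comm, map_neg, map_smul, mul_one, mul_one, C.tr_cj, ← hs, hx1, smul_eq_mul]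
      ring
    rw [hQe] at hQ
    have hs4 : s ^ 2 ≤ 4 := by
      have : (s:ℚ) ^ 2 ≤ 4 := by linarith
      exact_mod_cast this
    have l1 : -2 ≤ s := by nlinarith
    have l2 : s ≤ 2 := by nlinarith
    have hs2 : s = 2 ∨ s = -2 := by
      have a0 : s ≠ 0 := by rintro rfl; apply hno.2; norm_num
      have a1 : s ≠ 1 := by rintro rfl; apply hno.1; norm_num
      have a2 : s ≠ -1 := by rintro rfl; apply hno.1; norm_num
      omega
    have hxe : x = (s/2:ℚ) • 1 := by
      apply sub_eq_zero.1
      apply C.nm_eq_zero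
      rw [hQe]; rcases hs2 with rfl | rfl <;> norm_num
    -- the two ideals agree
    have z2 : (2 : ZMod 2) = 0 := rfl
    obtain ⟨M, hM⟩ : ∃ j, j ∈ P.JI r' ∧ j ∉ P.JI r := by
      obtain ⟨j, hj⟩ := P.surj !![r' 1, 0; r' 0, 0]
      have hj1 : j.1 ∈ P.JI r' := by
        refine ⟨j.2, ?_⟩
        rw [show (⟨j.1, j.2⟩ : C.Λ) = j from rfl, hj]
        funext i; fin_cases i <;> simp [Matrix.vecMul, dotProduct, Fin.sum_univ_two]; linear_combination (r' 0 * r' 1) * z2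
      refine ⟨j.1, hj1, ?_⟩
      rintro ⟨hh, hj2⟩
      rw [show (⟨j.1, hh⟩ : C.Λ) = j from rfl, hj] at hj2
      apply hne
      have := congrFun hj2 0
      simp [Matrix.vecMul, dotProduct, Fin.sum_univ_two] at this
      linear_combination this - r 1 * r' 0 * z2
    apply hM.2
    have h3 := (hx _).2 ⟨M, hM.1, rfl⟩
    have h4 : M = x * M ∨ M = -(x * M) := by
      rw [hxe, smul_mul_assoc, one_mul]
      rcases hs2 with rfl | rfl
      · left; norm_num
      · right; norm_num
    rcases h4 with h4 | h4
    · rw [h4]; exact h3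
    · rw [h4]; exact (P.JI r).neg_mem h3
  · obtain ⟨j, hj, h2j⟩ := (hx _).1 (h2 r)
    have hj2 : j = C.cj (x * 2) := by
      rw [hx2, C.cj_smul, ← hivx]
      have : C.iv x * 2 = j := by rw [h2j, ← mul_assoc, C.iv_mul hx0, one_mul]
      rw [← this, mul_two, two_smul]
    obtain ⟨hjΛ, hj0⟩ := hj
    have e : (⟨j, hjΛ⟩ : C.Λ) = (t : C.Λ) - ⟨x * 2, hw⟩ := by
      apply Subtype.ext
      push_cast
      rw [hj2]; unfold QD.cj
      rw [← ht, Int.cast_smul_eq_zsmul, zsmul_eq_mul, mul_one]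
    rw [e, map_sub, map_intCast] at hj0
    exact hj0

theorem QD.tr_sq_le (C : QD A) (x : A) : C.tr x ^ 2 ≤ 4 * C.nm x := by
  have hQ := C.nm_nonneg (x - (C.tr x/2:ℚ) • 1)
  rw [sub_eq_add_neg, C.nm_add, C.nm_neg, C.nm_smul, C.nm_one, mul_neg, mul_smul_comm, map_neg, map_smul, mul_one, mul_one, C.tr_cj, smul_eq_mul] at hQ
  linarith

theorem zmod2_one {a : ZMod 2} (h : a ≠ 0) : a = 1 := by
  revert h; revert a; decide

theorem odd_bd {t : ℤ} (h : (t : ZMod 2) ≠ 0) (h2 : t ^ 2 ≤ 16) : t ^ 2 = 1 ∨ t ^ 2 = 9 := by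
  have h3 : ¬ (2:ℤ) ∣ t := by
    intro h3; apply h; exact (ZMod.intCast_zmod_eq_zero_iff_dvd t 2).2 h3
  have l1 : -4 ≤ t := by nlinarith
  have l2 : t ≤ 4 := by nlinarith
  interval_cases t <;> simp_all

theorem arith {p : ℕ} (hp : p.Prime) (hp17 : 17 ≤ p) (c s m : ℤ) (hm : 0 < m) (hc : c = 49 ∨ c = 105 ∨ c = 225)
    (h : 8 * (p * m) = c - s ^ 2) : False := by
  have h17 : (17:ℤ) ≤ p := by exact_mod_cast hp17
  have hc2 : c ≤ 225 := by omega
  have hm1 : m = 1 := by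
    by_contra hne
    have : 2 ≤ m := by omega
    nlinarith [sq_nonneg s]
  rw [hm1, mul_one] at h
  have l1 : -10 ≤ s := by nlinarith
  have l2 : s ≤ 10 := by nlinarith
  have hp28 : p ≤ 28 := by
    have : (p:ℤ) ≤ 28 := by nlinarith [sq_nonneg s]
    exact_mod_cast this
  have hp4 : p = 17 ∨ p = 19 ∨ p = 23 := by
    interval_cases p <;> first | omega | (exfalso; revert hp; norm_num)
  rcases hp4 with rfl | rfl | rfl <;> interval_cases s <;> omega

theorem mat12 (t : ZMod 2) (M : Matrix (Fin 2) (Fin 2) (ZMod 2)) (h0 : M ≠ 0) (h1 : Matrix.vecMul ![1, 0] M = 0)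
    (h2 : Matrix.vecMul ![0, 1] (t • (1 : Matrix (Fin 2) (Fin 2) (ZMod 2)) - M) = 0) : t = 1 ∧ M = !![0, 0; 0, 1] := by
  have a0 := congrFun h1 0
  have a1 := congrFun h1 1
  have a2 := congrFun h2 0
  have a3 := congrFun h2 1
  simp [Matrix.vecMul, dotProduct, Fin.sum_univ_two] at a0 a1 a2 a3
  have h3 : t = 1 := by
    apply zmod2_one
    rintro rfl
    apply h0
    ext i j
    fin_cases i <;> fin_cases j <;> simp_all
  refine ⟨h3, ?_⟩
  rw [h3] at a3
  ext i j
  fin_cases i <;> fin_cases j <;> simp [a0, a1, a2]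
  exact (sub_eq_zero.1 a3).symm

theorem mat13 (t : ZMod 2) (M : Matrix (Fin 2) (Fin 2) (ZMod 2)) (h0 : M ≠ 0) (h1 : Matrix.vecMul ![1, 0] M = 0)
    (h2 : Matrix.vecMul ![1, 1] (t • (1 : Matrix (Fin 2) (Fin 2) (ZMod 2)) - M) = 0) : t = 1 ∧ M = !![0, 0; 1, 1] := by
  have a0 := congrFun h1 0
  have a1 := congrFun h1 1
  have a2 := congrFun h2 0
  have a3 := congrFun h2 1
  simp [Matrix.vecMul, dotProduct, Fin.sum_univ_two] at a0 a1 a2 a3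
  rw [a0] at a2
  rw [a1] at a3
  have h3 : t = 1 := by
    apply zmod2_one
    rintro rfl
    apply h0
    ext i j
    fin_cases i <;> fin_cases j <;> simp_all
  refine ⟨h3, ?_⟩
  rw [h3] at a3 a2
  have z2 : (2 : ZMod 2) = 0 := rfl
  have b2 : M 1 0 = 1 := by linear_combination a2 - z2
  have b3 : M 1 1 = 1 := by linear_combination -a3
  ext i j
  fin_cases i <;> fin_cases j <;> simp [a0, a1, b2, b3]

theorem Canc.false {C : Ctx p A} [Fact p.Prime] (H : Canc C) (hp : 17 ≤ p) : False := by
  haveI : Fact (Nat.Prime 2) := ⟨Nat.prime_two⟩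
  obtain ⟨P⟩ := C.psi (ℓ := 2) (by omega)
  have e1 : (![1, 0] : Fin 2 → ZMod 2) ≠ 0 := by simp
  have e2 : (![0, 1] : Fin 2 → ZMod 2) ≠ 0 := by simp
  have e3 : (![1, 1] : Fin 2 → ZMod 2) ≠ 0 := by simp
  obtain ⟨w, t, ht, hn, hw0, hw1, hw2⟩ := H.w (by omega) P e1 e2 (by simp)
  obtain ⟨v, u, hu, hk, hv0, hv1, hv2⟩ := H.w (by omega) P e1 e3 (by simp)
  have hc : ∀ t : ℤ, (t : Matrix (Fin 2) (Fin 2) (ZMod 2)) = (t : ZMod 2) • 1 := by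
    intro t; rw [Int.cast_smul_eq_zsmul, zsmul_one]
  rw [hc] at hw2 hv2
  obtain ⟨t1, hM⟩ := mat12 _ _ hw0 hw1 hw2
  obtain ⟨u1, hM'⟩ := mat13 _ _ hv0 hv1 hv2
  have hcm : P.ψ (w * v - v * w) = !![0, 0; 1, 0] := by
    rw [map_sub, map_mul, map_mul, hM, hM']
    ext i j
    fin_cases i <;> fin_cases j <;> simp [Matrix.mul_apply, Fin.sum_univ_two]
  have hcm0 : w.1 * v.1 - v.1 * w.1 ≠ 0 := by
    intro h
    have : w * v - v * w = 0 := Subtype.ext h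
    rw [this, map_zero] at hcm
    have := congrFun (congrFun hcm 1) 0
    simp at this
  obtain ⟨m, hm⟩ := C.kan (by omega) w.2 v.2
  have hd := P.det (w * v - v * w) (p * m) (by push_cast; exact hm.symm)
  rw [hcm, Matrix.det_fin_two] at hd
  have hd2 : (2:ℤ) ∣ p * m := by
    apply (ZMod.intCast_zmod_eq_zero_iff_dvd _ 2).1
    rw [← hd]; simp
  have hpo : p % 2 = 1 := (Fact.out : p.Prime).eq_two_or_odd.resolve_left (by omega)
  have hm2 : (2:ℤ) ∣ m := by
    rcases Int.prime_two.dvd_or_dvd hd2 with h | h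
    · omega
    · exact h
  obtain ⟨k, rfl⟩ := hm2
  have hpos := C.nm_pos hcm0
  have hp0 : (0:ℚ) < p := by exact_mod_cast (Fact.out : p.Prime).pos
  have hk0 : 0 < k := by
    rw [hm] at hpos
    have := pos_of_mul_pos_right hpos hp0.le
    have : 0 < 2 * k := by exact_mod_cast this
    omega
  have q1 := odd_bd (t := t) (by rw [t1]; simp) (by
    have := C.tr_sq_le w.1
    rw [hn, ← ht] at this
    norm_num at this; exact_mod_cast this)
  have q2 := odd_bd (t := u) (by rw [u1]; simp) (by
    have := C.tr_sq_le v.1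
    rw [hk, ← hu] at this
    norm_num at this; exact_mod_cast this)
  obtain ⟨b, hb⟩ := (C.F1 (C.Λ.mul_mem (C.cj_mem w.2) v.2)).1
  have hK := C.comm_nm w.1 v.1
  rw [hm, hn, hk, ← ht, ← hu, ← hb] at hK
  have hK2 : 4 * (p * (2 * k)) = (4 * 4 - t ^ 2) * (4 * 4 - u ^ 2) - (2 * b - t * u) ^ 2 := by exact_mod_cast hK
  refine arith Fact.out hp ((4 * 4 - t ^ 2) * (4 * 4 - u ^ 2)) (2 * b - t * u) k hk0 ?_ (by rw [← hK2]; ring)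
  rcases q1 with h | h <;> rcases q2 with h' | h' <;> rw [h, h'] <;> norm_num

theorem Canc.main {C : Ctx p A} [Fact p.Prime] (H : Canc C) : p = 2 ∨ p = 3 ∨ p = 5 ∨ p = 7 ∨ p = 13 := by
  by_contra hcon
  have h11 := H.ne11
  have hp := (Fact.out : p.Prime)
  have h17 : p < 17 := by
    by_contra h
    exact H.false (by omega)
  interval_cases p <;> first | omega | (revert hp; norm_num)

end
end CQ

namespace CQ

section
variable {p : ℕ} {A : Type*} [Ring A] [Algebra ℚ A] [FiniteDimensional ℚ A]

theorem of_mul (v : HeightOneSpectrum ℤ) (a b : v.adicCompletion ℚ) (x y : A) :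
    PlaceAlgebra.of ℤ ℚ A v (a ⊗ₜ[ℚ] x) * PlaceAlgebra.of ℤ ℚ A v (b ⊗ₜ[ℚ] y) =
    PlaceAlgebra.of ℤ ℚ A v ((a * b) ⊗ₜ[ℚ] (x * y)) := 
  Algebra.TensorProduct.tmul_mul_tmul a b x y

theorem lat_mem (v : HeightOneSpectrum ℤ) (J : Submodule ℤ A) {c : v.adicCompletion ℚ}
    (hc : c ∈ v.adicCompletionIntegers ℚ) {x : A} (hx : x ∈ J) :
    PlaceAlgebra.of ℤ ℚ A v (c ⊗ₜ[ℚ] x) ∈ latticeAt ℤ ℚ A J v :=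
  AddSubgroup.subset_closure ⟨c, hc, x, hx, rfl⟩

theorem mem_orderAt (v : HeightOneSpectrum ℤ) (Λ : Subalgebra ℤ A) (z : PlaceAlgebra ℤ ℚ A v) :
    z ∈ orderAt ℤ ℚ A Λ v ↔ z ∈ latticeAt ℤ ℚ A (Subalgebra.toSubmodule Λ) v := by
  constructor
  · intro hz
    unfold orderAt at hz
    induction hz using Subring.closure_induction with
    | mem x hx =>
      rcases hx with ⟨c, hc, rfl⟩ | ⟨a, ha, rfl⟩
      · exact lat_mem v _ hc (Subalgebra.one_mem Λ)
      · exact lat_mem v _ (one_mem _) ha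
    | zero => exact zero_mem _
    | one => exact lat_mem v _ (one_mem _) (Subalgebra.one_mem Λ)
    | add x y _ _ hx hy => exact add_mem hx hy
    | neg x _ hx => exact neg_mem hx
    | mul x y g1 g2 hx hy =>
      clear g1 g2
      unfold latticeAt at hx
      induction hx using AddSubgroup.closure_induction with
      | zero => rw [zero_mul]; exact zero_mem _
      | add a b _ _ ha hb => rw [add_mul]; exact add_mem ha hb
      | neg a _ ha => rw [neg_mul]; exact neg_mem ha
      | mem a ha =>
        obtain ⟨c, hc, x, hx, rfl⟩ := ha
        unfold latticeAt at hy
        induction hy using AddSubgroup.closure_induction with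
        | zero => rw [mul_zero]; exact zero_mem _
        | add a b _ _ ha hb => rw [mul_add]; exact add_mem ha hb
        | neg a _ ha => rw [mul_neg]; exact neg_mem ha
        | mem b hb =>
          obtain ⟨d, hd, y, hy, rfl⟩ := hb
          rw [of_mul]
          exact lat_mem v _ (mul_mem hc hd) (Subalgebra.mul_mem Λ hx hy)
  · intro hz
    unfold latticeAt at hz
    induction hz using AddSubgroup.closure_induction with
    | zero => exact zero_mem _
    | add a b _ _ ha hb => exact add_mem ha hb
    | neg a _ ha => exact neg_mem ha
    | mem a ha =>
      obtain ⟨c, hc, x, hx, rfl⟩ := ha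
      have : PlaceAlgebra.of ℤ ℚ A v (c ⊗ₜ[ℚ] x) = PlaceAlgebra.of ℤ ℚ A v (c ⊗ₜ[ℚ] 1) * PlaceAlgebra.of ℤ ℚ A v (1 ⊗ₜ[ℚ] x) := by
        rw [of_mul, mul_one, one_mul]
      rw [this]
      exact mul_mem (Subring.subset_closure (Or.inl ⟨c, hc, rfl⟩)) (Subring.subset_closure (Or.inr ⟨x, hx, rfl⟩))

theorem exists_cinv (v : HeightOneSpectrum ℤ) (m : ℤ) (hm : m ∉ v.asIdeal) :
    ∃ c ∈ v.adicCompletionIntegers ℚ, c * (algebraMap ℚ (v.adicCompletion ℚ) (m:ℚ)) = 1 := by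
  have h1 : Valued.v ((algebraMap ℚ (v.adicCompletion ℚ) (m:ℚ))) = 1 := by
    refine (HeightOneSpectrum.valuedAdicCompletion_eq_valuation' v (m:ℚ)).trans ?_
    have := HeightOneSpectrum.valuation_of_algebraMap (K := ℚ) v m
    simp only [algebraMap_int_eq, eq_intCast] at this
    rw [this]
    exact (HeightOneSpectrum.intValuation_eq_one_iff).2 hm
  refine ⟨((algebraMap ℚ (v.adicCompletion ℚ) (m:ℚ)))⁻¹, ?_, ?_⟩
  · rw [HeightOneSpectrum.mem_adicCompletionIntegers, map_inv₀, h1, inv_one]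
  · apply inv_mul_cancel₀
    intro h; rw [h, map_zero] at h1; exact zero_ne_one h1

theorem of_move (v : HeightOneSpectrum ℤ) (m : ℤ) (c' : v.adicCompletion ℚ) (hc' : c' * (algebraMap ℚ (v.adicCompletion ℚ) (m:ℚ)) = 1)
    (c : v.adicCompletion ℚ) (x : A) :
    PlaceAlgebra.of ℤ ℚ A v (c ⊗ₜ[ℚ] x) = PlaceAlgebra.of ℤ ℚ A v ((c * c') ⊗ₜ[ℚ] ((m:ℚ) • x)) := by
  congr 1
  rw [← TensorProduct.smul_tmul]
  congr 1
  rw [Algebra.smul_def]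
  linear_combination (-c) * hc'

theorem local_free (v : HeightOneSpectrum ℤ) (Λ : Subalgebra ℤ A) (J : Submodule ℤ A) (u ui : A) (h1 : u * ui = 1)
    (h2 : ui * u = 1) (m : ℤ) (hm : m ∉ v.asIdeal) (hJ : ∀ j ∈ J, ∃ a ∈ Λ, (m:ℚ) • j = u * a)
    (hu : ∀ a ∈ Λ, u * a ∈ J) : ∃ u : (PlaceAlgebra ℤ ℚ A v)ˣ,
      (latticeAt ℤ ℚ A J v : Set (PlaceAlgebra ℤ ℚ A v)) =
        (fun y : PlaceAlgebra ℤ ℚ A v => u.val * y) ''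
          (orderAt ℤ ℚ A Λ v : Set (PlaceAlgebra ℤ ℚ A v)) := by
  obtain ⟨c', hc', hcm⟩ := exists_cinv v m hm
  let U : PlaceAlgebra ℤ ℚ A v := PlaceAlgebra.of ℤ ℚ A v (1 ⊗ₜ[ℚ] u)
  let V : PlaceAlgebra ℤ ℚ A v := PlaceAlgebra.of ℤ ℚ A v (1 ⊗ₜ[ℚ] ui)
  have hUV : U * V = 1 := by
    simp only [U, V]; rw [of_mul, h1, one_mul]; rfl
  have hVU : V * U = 1 := by
    simp only [U, V]; rw [of_mul, h2, one_mul]; rfl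
  refine ⟨⟨U, V, hUV, hVU⟩, ?_⟩
  simp only
  apply Set.Subset.antisymm
  · have : latticeAt ℤ ℚ A J v ≤ (orderAt ℤ ℚ A Λ v).toAddSubgroup.map (AddMonoidHom.mulLeft U) := by
      unfold latticeAt
      rw [AddSubgroup.closure_le]
      rintro z ⟨c, hc, j, hj, rfl⟩
      obtain ⟨a, ha, hja⟩ := hJ j hj
      refine ⟨PlaceAlgebra.of ℤ ℚ A v ((c * c') ⊗ₜ[ℚ] a), ?_, ?_⟩
      · exact (mem_orderAt v Λ _).2 (lat_mem v _ (mul_mem hc hc') ha)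
      · rw [of_move v m c' hcm c j, hja]
        simp only [U, AddMonoidHom.coe_mulLeft]
        rw [of_mul, one_mul]
    exact this
  · have key : ∀ z ∈ latticeAt ℤ ℚ A (Subalgebra.toSubmodule Λ) v, U * z ∈ latticeAt ℤ ℚ A J v := by
      intro z hz
      unfold latticeAt at hz
      induction hz using AddSubgroup.closure_induction with
      | zero => rw [mul_zero]; exact zero_mem _
      | add a b _ _ ha hb => rw [mul_add]; exact add_mem ha hb
      | neg a _ ha => rw [mul_neg]; exact neg_mem ha
      | mem a ha =>
        obtain ⟨c, hc, x, hx, rfl⟩ := ha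
        simp only [U]
        rw [of_mul, one_mul]
        exact lat_mem v _ hc (hu x hx)
    rintro _ ⟨z, hz, rfl⟩
    exact key z ((mem_orderAt v Λ z).1 hz)

theorem exists_prime_of_v (v : HeightOneSpectrum ℤ) :
    ∃ ℓ : ℕ, ℓ.Prime ∧ ∀ m : ℤ, ¬ (ℓ:ℤ) ∣ m → m ∉ v.asIdeal := by
  obtain ⟨g, hg⟩ := (IsPrincipalIdealRing.principal v.asIdeal).principal
  have hg' : v.asIdeal = Ideal.span {g} := hg
  have hg0 : g ≠ 0 := by
    rintro rfl
    apply v.ne_bot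
    rw [hg']; simp
  have hpr : Prime g := by
    rw [← Ideal.span_singleton_prime hg0, ← hg']
    exact v.isPrime
  refine ⟨g.natAbs, Int.prime_iff_natAbs_prime.1 hpr, ?_⟩
  intro m hm hmem
  apply hm
  rw [hg', Ideal.mem_span_singleton] at hmem
  exact Int.natAbs_dvd.2 hmem

noncomputable def Lat.toLFI {C : Ctx p A} (L : Lat C) (Λ : Subalgebra ℤ A) (hC : ∀ x, x ∈ C.Λ ↔ x ∈ Λ) :
    LocallyFreeIdeal ℤ ℚ A Λ where
  carrier := AddSubgroup.toIntSubmodule L.I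
  fg := by
    have h1 : Module.Finite ℤ C.Λ.toAddSubgroup :=
      Module.Finite.iff_addGroup_fg.2 (AddGroup.fg_iff_addSubgroup_fg _ |>.2 C.fg)
    have h2 : Module.Finite ℤ (AddSubgroup.toIntSubmodule C.Λ.toAddSubgroup) := h1
    haveI : IsNoetherian ℤ (AddSubgroup.toIntSubmodule C.Λ.toAddSubgroup) := isNoetherian_of_isNoetherianRing_of_finite ℤ _
    have hle : AddSubgroup.toIntSubmodule L.I ≤ AddSubgroup.toIntSubmodule C.Λ.toAddSubgroup := L.le
    haveI : IsNoetherian ℤ (AddSubgroup.toIntSubmodule L.I) := isNoetherian_of_le hle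
    exact (Module.Finite.iff_fg).1 inferInstance
  spans := by
    haveI : Fact p.Prime := ⟨C.hp⟩
    obtain ⟨m, hm, hmx⟩ := L.full
    rw [eq_top_iff, ← C.span, Submodule.span_le]
    intro x hx
    have : x = (m:ℚ)⁻¹ • ((m:ℚ) • x) := by
      rw [smul_smul, inv_mul_cancel₀ (by exact_mod_cast hm), one_smul]
    rw [this]
    exact Submodule.smul_mem _ _ (Submodule.subset_span (hmx x hx))
  right_mul := fun x hx a ha => L.right x hx a ((hC a).2 ha)
  locallyFree := by
    intro v
    haveI : Fact p.Prime := ⟨C.hp⟩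
    obtain ⟨ℓ, hl, hlm⟩ := exists_prime_of_v v
    obtain ⟨x, hx, m, hm, hd⟩ := L.prim ℓ hl
    have hx0 : x ≠ 0 := by
      rintro rfl
      apply hd
      rw [C.nm_zero, zero_div] at hm
      have : m = 0 := by exact_mod_cast hm
      rw [this]; exact dvd_zero _
    refine local_free v Λ _ x (C.iv x) (C.mul_iv hx0) (C.iv_mul hx0) m (hlm m hd) ?_ ?_
    · intro j hj
      refine ⟨_, (hC _).1 (L.V hx hj), ?_⟩
      rw [L.mulV x j, hm]; rfl
    · intro a ha
      exact L.right x hx a ((hC a).2 ha)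

theorem mem_sum2 (I J : Submodule ℤ A) (f : Fin 2 → A) : f ∈ sumLat ![I, J] ↔ f 0 ∈ I ∧ f 1 ∈ J := by
  unfold sumLat
  rw [AddSubgroup.mem_pi]
  simp [Fin.forall_fin_two]

theorem mem_sum1 (I : Submodule ℤ A) (f : Fin 1 → A) : f ∈ sumLat ![I] ↔ f 0 ∈ I := by
  unfold sumLat
  rw [AddSubgroup.mem_pi]
  simp

theorem iso_of_maps {n : ℕ} (Λ : Subalgebra ℤ A) (P Q : AddSubgroup (Fin n → A))
    (F G : (Fin n → A) →+ (Fin n → A)) (hF : ∀ f ∈ P, F f ∈ Q) (hG : ∀ f ∈ Q, G f ∈ P)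
    (h1 : ∀ f, G (F f) = f) (h2 : ∀ f, F (G f) = f)
    (hr : ∀ f a, F (fun i => f i * a) = fun i => F f i * a) : RightLamIso Λ P Q := by
  refine ⟨{ toFun := fun f => ⟨F f.1, hF _ f.2⟩, invFun := fun f => ⟨G f.1, hG _ f.2⟩,
            left_inv := fun f => Subtype.ext (h1 _), right_inv := fun f => Subtype.ext (h2 _),
            map_add' := fun f g => Subtype.ext (map_add F _ _) }, ?_⟩
  intro z a ha h
  exact hr z.1 a

theorem idealIso_of_mul (Λ : Subalgebra ℤ A) (I I' : LocallyFreeIdeal ℤ ℚ A Λ) (g gi : A) (h1 : gi * g = 1)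
    (h2 : g * gi = 1) (hI : ∀ j ∈ I.carrier, g * j ∈ I'.carrier) (hI' : ∀ j ∈ I'.carrier, gi * j ∈ I.carrier) :
    IdealIso Λ I I' := by
  unfold IdealIso
  let F (g : A) : (Fin 1 → A) →+ (Fin 1 → A) :=
    { toFun := fun f i => g * f i, map_zero' := by funext i; simp, map_add' := by intros; funext i; simp [mul_add] }
  refine iso_of_maps Λ _ _ (F g) (F gi) ?_ ?_ ?_ ?_ ?_
  · intro f hf; rw [mem_sum1] at hf ⊢; exact hI _ hf
  · intro f hf; rw [mem_sum1] at hf ⊢; exact hI' _ hf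
  · intro f; funext i; change gi * (g * f i) = f i; rw [← mul_assoc, h1, one_mul]
  · intro f; funext i; change g * (gi * f i) = f i; rw [← mul_assoc, h2, one_mul]
  · intro f a; funext i; change g * (f i * a) = g * f i * a; rw [mul_assoc]

theorem iso_of_stab {C : Ctx p A} (L L' : Lat C) (Λ : Subalgebra ℤ A) (hC : ∀ x, x ∈ C.Λ ↔ x ∈ Λ)
    (h : Stab L L') : RightLamIso Λ (sumLat ![(L.toLFI Λ hC).carrier, Subalgebra.toSubmodule Λ])
            (sumLat ![(L'.toLFI Λ hC).carrier, Subalgebra.toSubmodule Λ]) := by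
  obtain ⟨z, hz, z', hz', a1, a2, a3, a4⟩ := h
  let F : (Fin 2 → A) →+ (Fin 2 → A) :=
    { toFun := fun f => ![f 1 - z' * (f 0 + z * f 1), f 0 + z * f 1]
      map_zero' := by funext i; fin_cases i <;> simp
      map_add' := by intro f g; funext i; fin_cases i <;> simp <;> noncomm_ring }
  let G : (Fin 2 → A) →+ (Fin 2 → A) :=
    { toFun := fun f => ![f 1 - z * (f 0 + z' * f 1), f 0 + z' * f 1]
      map_zero' := by funext i; fin_cases i <;> simp
      map_add' := by intro f g; funext i; fin_cases i <;> simp <;> noncomm_ring }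
  refine iso_of_maps Λ _ _ F G ?_ ?_ ?_ ?_ ?_
  · intro f hf
    rw [mem_sum2] at hf ⊢
    obtain ⟨hf0, hf1⟩ := hf
    have hf1 : f 1 ∈ C.Λ := (hC _).2 hf1
    constructor
    · change f 1 - z' * (f 0 + z * f 1) ∈ L'.I
      have : f 1 - z' * (f 0 + z * f 1) = (f 1 - z' * z * f 1) - z' * f 0 := by noncomm_ring
      rw [this]
      exact sub_mem (a3 _ hf1) (a1 _ hf0)
    · change f 0 + z * f 1 ∈ Λ
      rw [← hC]
      exact add_mem (L.le hf0) (mul_mem hz hf1)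
  · intro f hf
    rw [mem_sum2] at hf ⊢
    obtain ⟨hf0, hf1⟩ := hf
    have hf1 : f 1 ∈ C.Λ := (hC _).2 hf1
    constructor
    · change f 1 - z * (f 0 + z' * f 1) ∈ L.I
      have : f 1 - z * (f 0 + z' * f 1) = (f 1 - z * z' * f 1) - z * f 0 := by noncomm_ring
      rw [this]
      exact sub_mem (a4 _ hf1) (a2 _ hf0)
    · change f 0 + z' * f 1 ∈ Λ
      rw [← hC]
      exact add_mem (L'.le hf0) (mul_mem hz' hf1)
  · intro f; funext i; fin_cases i <;> simp [F, G]
  · intro f; funext i; fin_cases i <;> simp [F, G]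
  · intro f a; funext i; fin_cases i <;> simp [F] <;> noncomm_ring

theorem mul_of_iso {C : Ctx p A} (L L' : Lat C) (Λ : Subalgebra ℤ A) (hC : ∀ x, x ∈ C.Λ ↔ x ∈ Λ)
    (h : IdealIso Λ (L.toLFI Λ hC) (L'.toLFI Λ hC)) : ∃ x, ∀ y, y ∈ L'.I ↔ ∃ j ∈ L.I, y = x * j := by
  obtain ⟨e, he⟩ := h
  haveI : Fact p.Prime := ⟨C.hp⟩
  obtain ⟨m, hm, hmx⟩ := L.full
  have hm' : (m:ℚ) ≠ 0 := by exact_mod_cast hm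
  have h1 : (m:ℚ) • (1:A) ∈ L.I := hmx 1 (one_mem _)
  have hmem : ∀ j ∈ L.I, (![j] : Fin 1 → A) ∈ sumLat ![(L.toLFI Λ hC).carrier] := by
    intro j hj; rw [mem_sum1]; exact hj
  let x : A := (m:ℚ)⁻¹ • (e ⟨![(m:ℚ) • (1:A)], hmem _ h1⟩).val 0
  have key : ∀ j (hj : j ∈ L.I), (e ⟨![j], hmem j hj⟩).val 0 = x * j := by
    intro j hj
    have hjΛ : j ∈ Λ := (hC j).1 (L.le hj)
    have e1 : (fun i => (![(m:ℚ) • (1:A)] : Fin 1 → A) i * j) = m • ![j] := by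
      funext i; fin_cases i
      change ((m:ℚ) • (1:A)) * j = m • j
      rw [smul_mul_assoc, one_mul, Int.cast_smul_eq_zsmul]
    have hP : (fun i => (![(m:ℚ) • (1:A)] : Fin 1 → A) i * j) ∈ sumLat ![(L.toLFI Λ hC).carrier] := by
      rw [e1]; exact AddSubgroup.zsmul_mem _ (hmem j hj) m
    have h2 := he ⟨![(m:ℚ) • (1:A)], hmem _ h1⟩ j hjΛ hP
    have h3 : (⟨_, hP⟩ : sumLat ![(L.toLFI Λ hC).carrier]) = m • ⟨![j], hmem j hj⟩ := Subtype.ext e1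
    rw [h3, map_zsmul] at h2
    have h4 := congrFun h2 0
    simp only [AddSubgroup.coe_zsmul, Pi.smul_apply] at h4
    simp only [x]
    rw [smul_mul_assoc, ← h4, ← Int.cast_smul_eq_zsmul ℚ, smul_smul, inv_mul_cancel₀ hm', one_smul]
  refine ⟨x, fun y => ⟨?_, ?_⟩⟩
  · intro hy
    have hQ : (![y] : Fin 1 → A) ∈ sumLat ![(L'.toLFI Λ hC).carrier] := by
      rw [mem_sum1]; exact hy
    have hw := (e.symm ⟨_, hQ⟩).2
    rw [mem_sum1] at hw
    refine ⟨(e.symm ⟨_, hQ⟩).1 0, hw, ?_⟩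
    rw [← key _ hw]
    have : (⟨![(e.symm ⟨_, hQ⟩).1 0], hmem _ hw⟩ : sumLat ![(L.toLFI Λ hC).carrier]) = e.symm ⟨_, hQ⟩ := by
      apply Subtype.ext
      funext i; fin_cases i; rfl
    rw [this, e.apply_symm_apply]
    rfl
  · rintro ⟨j, hj, rfl⟩
    rw [← key j hj]
    have := (e ⟨![j], hmem j hj⟩).2
    rw [mem_sum1] at this
    exact this

theorem final (C : Ctx p A) [Fact p.Prime] (Λ : Subalgebra ℤ A) (hC : ∀ x, x ∈ C.Λ ↔ x ∈ Λ) :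
    (∀ I I' : LocallyFreeIdeal ℤ ℚ A Λ,
        RightLamIso Λ (sumLat ![I.carrier, Subalgebra.toSubmodule Λ])
            (sumLat ![I'.carrier, Subalgebra.toSubmodule Λ]) →
          IdealIso Λ I I') ↔ (p = 2 ∨ p = 3 ∨ p = 5 ∨ p = 7 ∨ p = 13) := by
  constructor
  · intro H
    apply Canc.main (C := C)
    intro L L' hs
    exact mul_of_iso L L' Λ hC (H _ _ (iso_of_stab L L' Λ hC hs))
  · intro hp I I' _
    have one_ne : (1:A) ≠ 0 := by
      intro h
      have h4 := C.finrank_four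
      haveI : Subsingleton A := ⟨fun a b => by rw [← mul_one a, ← mul_one b, h, mul_zero, mul_zero]⟩
      rw [Module.finrank_zero_of_subsingleton] at h4
      omega
    have pr : ∀ I : LocallyFreeIdeal ℤ ℚ A Λ, ∃ x, x ≠ 0 ∧ ∀ y, y ∈ I.carrier ↔ ∃ a ∈ C.Λ, y = x * a := by
      intro I
      refine C.principal hp I.carrier.toAddSubgroup ?_ ?_ ?_
      · have := I.fg
        rw [Submodule.fg_iff_addSubgroup_fg] at this
        exact this
      · intro x hx a ha
        exact I.right_mul x hx a ((hC a).1 ha)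
      · by_contra hcon
        push Not at hcon
        have hs := I.spans
        have : Submodule.span ℚ (I.carrier : Set A) = ⊥ := by
          rw [Submodule.span_eq_bot]
          exact hcon
        rw [this] at hs
        have : (1:A) ∈ (⊥ : Submodule ℚ A) := by rw [hs]; trivial
        exact one_ne ((Submodule.mem_bot ℚ).1 this)
    obtain ⟨x, hx0, hx⟩ := pr I
    obtain ⟨y, hy0, hy⟩ := pr I'
    refine idealIso_of_mul Λ I I' (y * C.iv x) (x * C.iv y) ?_ ?_ ?_ ?_
    · rw [show x * C.iv y * (y * C.iv x) = x * (C.iv y * y) * C.iv x by noncomm_ring, C.iv_mul hy0, mul_one, C.mul_iv hx0]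
    · rw [show y * C.iv x * (x * C.iv y) = y * (C.iv x * x) * C.iv y by noncomm_ring, C.iv_mul hx0, mul_one, C.mul_iv hy0]
    · intro j hj
      obtain ⟨a, ha, rfl⟩ := (hx j).1 hj
      refine (hy _).2 ⟨a, ha, ?_⟩
      rw [show y * C.iv x * (x * a) = y * (C.iv x * x) * a by noncomm_ring, C.iv_mul hx0, mul_one]
    · intro j hj
      obtain ⟨a, ha, rfl⟩ := (hy j).1 hj
      refine (hx _).2 ⟨a, ha, ?_⟩
      rw [show x * C.iv y * (y * a) = x * (C.iv y * y) * a by noncomm_ring, C.iv_mul hy0, mul_one]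

end
end CQ

noncomputable section

variable {A : Type*} [Ring A] [Algebra ℚ A] [FiniteDimensional ℚ A]
  [Algebra ℤ A] [IsScalarTower ℤ ℚ A]

/-- **Cancellation for maximal orders in `B_{p,∞}`.**
For each prime `p`, let `B_{p,∞}` be the quaternion algebra over `ℚ` ramified exactly at
`p` and `∞`, and let `Λ(p)` be a maximal `ℤ`-order in `B_{p,∞}`.  The cancellation law for
locally free right `Λ(p)`-ideals (`J ⊕ Λ(p) ≅ J' ⊕ Λ(p)` implies `J ≅ J'`) holds if and
only if `p ∈ {2, 3, 5, 7, 13}`. -/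
theorem cancellation_law_for_quaternion_maximal_order_iff
    (p : ℕ) (hp : p.Prime) (hA : IsQuaternionRamifiedExactlyAtPAndInfty p A)
    (Λ : Subalgebra ℤ A) (hΛ : IsROrder ℤ ℚ A Λ)
    (hmax : ∀ Λ' : Subalgebra ℤ A, IsROrder ℤ ℚ A Λ' → Λ ≤ Λ' → Λ' = Λ) :
    (∀ I I' : LocallyFreeIdeal ℤ ℚ A Λ,
        RightLamIso Λ (sumLat ![I.carrier, Subalgebra.toSubmodule Λ])
            (sumLat ![I'.carrier, Subalgebra.toSubmodule Λ]) →
          IdealIso Λ I I') ↔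
      p ∈ ({2, 3, 5, 7, 13} : Set ℕ) := by
  obtain rfl : ‹Algebra ℤ A› = Ring.toIntAlgebra A := Subsingleton.elim _ _
  obtain ⟨h4, hc, hs, hR, hdiv, hspl⟩ := hA
  obtain ⟨Q⟩ := CQ.exists_QD hR h4 hc
  haveI : Fact p.Prime := ⟨hp⟩
  obtain ⟨hfin, hspan⟩ := hΛ
  have hfg : Λ.toSubring.toAddSubgroup.FG := by
    have h1 : (Subalgebra.toSubmodule Λ).FG := (Module.Finite.iff_fg).1 hfin
    rw [Submodule.fg_iff_addSubgroup_fg] at h1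
    exact h1
  let C : CQ.Ctx p A :=
    { toQD := Q
      hp := hp
      hdiv := hdiv hp
      hspl := hspl
      Λ := Λ.toSubring
      fg := hfg
      span := hspan
      hmax := by
        intro Λ' hf hle
        have h1 : (Subalgebra.toSubmodule (subalgebraOfSubring Λ')).FG := by
          rw [Submodule.fg_iff_addSubgroup_fg]
          exact hf
        have h2 := hmax (subalgebraOfSubring Λ') ⟨(Module.Finite.iff_fg).2 h1, by
          rw [eq_top_iff, ← hspan]
          exact Submodule.span_mono hle⟩ hle
        ext x
        have h3 : x ∈ subalgebraOfSubring Λ' ↔ x ∈ Λ := by rw [h2]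
        exact h3 }
  have := CQ.final C Λ (fun x => Iff.rfl)
  rw [this]
  simp

end
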